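/- Let P = B ∪ R be a bichromatic set of 2n points in the plane in general position with |B| = |R| = n. For every BR-matching M on P and every ham-sandwich cut ℓ of P, there exists a BR-matching M^ℓ on P such that M and M^ℓ are ⌊n/2⌋-compatible and no edge of M^ℓ intersects ℓ. -/

import Mathlib

open Finset
open scoped Classical

/-- Points in the plane. -/
abbrev Pt : Type := ℝ × ℝ

/-- A finite point set is in general position if no three distinct points are collinear. -/
def GenPos (S : Finset Pt) : Prop :=
  ∀ p ∈ S, ∀ q ∈ S, ∀ r ∈ S, p ≠ q → p ≠ r → q ≠ r →
    ¬ Collinear ℝ ({p, q, r} : Set Pt)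

/-- `M` is a plane perfect bichromatic (BR-) matching on the bichromatic point set `B ∪ R`:
each edge `e ∈ M` is a pair (blue endpoint, red endpoint); every blue point is the blue
endpoint of exactly one edge, every red point is the red endpoint of exactly one edge, and
the (closed) segments of distinct edges are disjoint. -/
def IsBRMatching (B R : Finset Pt) (M : Finset (Pt × Pt)) : Prop :=
  (∀ e ∈ M, e.1 ∈ B ∧ e.2 ∈ R) ∧
  (∀ b ∈ B, ∃! e, e ∈ M ∧ e.1 = b) ∧
  (∀ r ∈ R, ∃! e, e ∈ M ∧ e.2 = r) ∧
  (∀ e ∈ M, ∀ e' ∈ M, e ≠ e' →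
    segment ℝ e.1 e.2 ∩ segment ℝ e'.1 e'.2 = ∅)

/-- Two matchings are compatible if any two of their segments intersect in at most a
common endpoint (shared edges are allowed). -/
def Compatible (M M' : Finset (Pt × Pt)) : Prop :=
  ∀ e ∈ M, ∀ e' ∈ M', e = e' ∨
    segment ℝ e.1 e.2 ∩ segment ℝ e'.1 e'.2 ⊆
      {x : Pt | (x = e.1 ∨ x = e.2) ∧ (x = e'.1 ∨ x = e'.2)}

/-- `M` and `M'` are `t`-compatible: there is a transformation (sequence of BR-matchings
on `B ∪ R` in which consecutive matchings are compatible) of length `k ≤ t` between them. -/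
def TCompatible (B R : Finset Pt) (t : ℕ) (M M' : Finset (Pt × Pt)) : Prop :=
  ∃ k ≤ t, ∃ f : ℕ → Finset (Pt × Pt),
    f 0 = M ∧ f k = M' ∧ (∀ i ≤ k, IsBRMatching B R (f i)) ∧
    ∀ i < k, Compatible (f i) (f (i + 1))

/-- The line `{p | a * p.1 + b * p.2 = c}`. -/
def lineSet (a b c : ℝ) : Set Pt := {p : Pt | a * p.1 + b * p.2 = c}

/-- The line given by `a * x + b * y = c` is a ham-sandwich cut of the bichromatic point
set `B ∪ R` (with `|B| = |R| = n`): it contains no point of `B ∪ R`, and one of its open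
sides contains exactly `⌊n/2⌋` blue and `⌊n/2⌋` red points while the other open side
contains exactly `⌈n/2⌉` blue and `⌈n/2⌉` red points. -/
def IsHamSandwichCut (a b c : ℝ) (B R : Finset Pt) (n : ℕ) : Prop :=
  (a, b) ≠ ((0 : ℝ), (0 : ℝ)) ∧
  (∀ p ∈ B ∪ R, a * p.1 + b * p.2 ≠ c) ∧
  (((B.filter fun p => a * p.1 + b * p.2 < c).card = n / 2 ∧
    (R.filter fun p => a * p.1 + b * p.2 < c).card = n / 2 ∧
    (B.filter fun p => a * p.1 + b * p.2 > c).card = (n + 1) / 2 ∧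
    (R.filter fun p => a * p.1 + b * p.2 > c).card = (n + 1) / 2) ∨
   ((B.filter fun p => a * p.1 + b * p.2 < c).card = (n + 1) / 2 ∧
    (R.filter fun p => a * p.1 + b * p.2 < c).card = (n + 1) / 2 ∧
    (B.filter fun p => a * p.1 + b * p.2 > c).card = n / 2 ∧
    (R.filter fun p => a * p.1 + b * p.2 > c).card = n / 2))

/-- The edge `e` crosses the line `a * x + b * y = c`: its segment meets the line. -/
def Crosses (a b c : ℝ) (e : Pt × Pt) : Prop :=
  ∃ x ∈ segment ℝ e.1 e.2, a * x.1 + b * x.2 = c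

section

open Topology Filter

/-- The planar cross product. -/
def cross (u v : Pt) : ℝ := u.1 * v.2 - u.2 * v.1

/-- The signed area `ori p q r` is positive iff `r` lies to the left of the directed line `pq`. -/
def ori (p q r : Pt) : ℝ := cross (q - p) (r - p)

lemma ori_lineMap (p q x y : Pt) (t : ℝ) :
    ori p q (x + t • (y - x)) = (1 - t) * ori p q x + t * ori p q y := by
  simp only [ori, cross, Prod.fst_sub, Prod.snd_sub, Prod.fst_add, Prod.snd_add, Prod.smul_fst,
    Prod.smul_snd, smul_eq_mul]; ring

lemma continuous_ori (p q : Pt) : Continuous (ori p q) := by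
  unfold ori cross; fun_prop

lemma mem_segment_iff {x y z : Pt} :
    z ∈ segment ℝ x y ↔ ∃ t : ℝ, 0 ≤ t ∧ t ≤ 1 ∧ z = x + t • (y - x) := by
  rw [segment_eq_image']
  constructor
  · rintro ⟨t, ⟨h0, h1⟩, rfl⟩; exact ⟨t, h0, h1, rfl⟩
  · rintro ⟨t, h0, h1, rfl⟩; exact ⟨t, ⟨h0, h1⟩, rfl⟩

lemma ori_eq_zero_of_mem_segment {p q x : Pt} (h : x ∈ segment ℝ p q) : ori p q x = 0 := by
  obtain ⟨t, -, -, rfl⟩ := mem_segment_iff.1 h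
  rw [ori_lineMap]
  simp [ori, cross]; right; ring

/-- Two vectors with vanishing cross product are parallel. -/
lemma exists_smul_of_cross_eq_zero {u v : Pt} (hu : u ≠ 0) (h : cross u v = 0) :
    ∃ k : ℝ, v = k • u := by
  unfold cross at h
  by_cases h1 : u.1 = 0
  · have h2 : u.2 ≠ 0 := fun h2 => hu (Prod.ext h1 h2)
    refine ⟨v.2 / u.2, Prod.ext ?_ ?_⟩
    · have : v.1 = 0 := by
        rw [h1] at h; simp at h; tauto
      simp [h1, this]
    · simp; field_simp
  · refine ⟨v.1 / u.1, Prod.ext ?_ ?_⟩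
    · simp; field_simp
    · simp; field_simp; linarith

lemma exists_lineMap_of_ori_eq_zero {p q x : Pt} (hpq : p ≠ q) (h : ori p q x = 0) :
    ∃ k : ℝ, x = p + k • (q - p) := by
  obtain ⟨k, hk⟩ := exists_smul_of_cross_eq_zero (sub_ne_zero.2 hpq.symm) h
  exact ⟨k, by rw [← hk]; abel⟩

/-- Any vector is a combination of two linearly independent ones. -/
lemma exists_combination {u w : Pt} (h : cross u w ≠ 0) (v : Pt) :
    ∃ a b : ℝ, v = a • u + b • w := by
  refine ⟨cross v w / cross u w, cross u v / cross u w, Prod.ext ?_ ?_⟩ <;>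
  · simp only [Prod.fst_add, Prod.snd_add, Prod.smul_fst, Prod.smul_snd, smul_eq_mul]
    field_simp
    unfold cross; ring

/-- The segment `xy` misses `W`. -/
def Vis (W : Set Pt) (x y : Pt) : Prop := ∀ z ∈ segment ℝ x y, z ∉ W

/-- The point `x` is the midpoint of a nondegenerate segment inside `W`. -/
def NoEnd (W : Set Pt) (x : Pt) : Prop := ∃ v : Pt, v ≠ 0 ∧ ∀ t : ℝ, |t| ≤ 1 → x + t • v ∈ W

lemma NoEnd.mono {W W' : Set Pt} (h : W ⊆ W') {x : Pt} (hx : NoEnd W x) : NoEnd W' x := by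
  obtain ⟨v, hv, hW⟩ := hx
  exact ⟨v, hv, fun t ht => h (hW t ht)⟩

lemma Vis.symm {W : Set Pt} {x y : Pt} (h : Vis W x y) : Vis W y x := by
  unfold Vis; rw [segment_symm]; exact h

lemma Vis.left {W : Set Pt} {x y : Pt} (h : Vis W x y) : x ∉ W := h x (left_mem_segment _ _ _)

lemma Vis.right {W : Set Pt} {x y : Pt} (h : Vis W x y) : y ∉ W := h y (right_mem_segment _ _ _)

lemma Vis.refl {W : Set Pt} {x : Pt} (h : x ∉ W) : Vis W x x := by
  intro z hz; rw [segment_same] at hz; rwa [hz]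

lemma Vis.mono {W : Set Pt} {x y u v : Pt} (h : Vis W x y) (hu : u ∈ segment ℝ x y)
    (hv : v ∈ segment ℝ x y) : Vis W u v :=
  fun z hz => h z ((convex_segment x y).segment_subset hu hv hz)

lemma exists_small {a b : ℝ} (ha : 0 < a) (b' : ℝ) (hb : b < 1) (a' : ℝ) :
    ∃ δ : ℝ, 0 < δ ∧ δ ≤ 1 ∧ ∀ t, |t| ≤ δ → 0 < a + t * a' ∧ b + t * b' < 1 := by
  have h1 : ∀ᶠ t : ℝ in 𝓝 0, 0 < a + t * a' := by
    apply Tendsto.eventually_const_lt (v := a + 0 * a')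
    · simpa
    · exact Continuous.tendsto (by fun_prop) _
  have h2 : ∀ᶠ t : ℝ in 𝓝 0, b + t * b' < 1 := by
    apply Tendsto.eventually_lt_const (v := b + 0 * b')
    · simpa
    · exact Continuous.tendsto (by fun_prop) _
  obtain ⟨ε, hε, H⟩ := Metric.eventually_nhds_iff.1 (h1.and h2)
  refine ⟨min (ε / 2) 1, by positivity, min_le_right _ _, fun t ht => H ?_⟩
  rw [Real.dist_eq, sub_zero]
  linarith [min_le_left (ε / 2) 1]

/-- If no point of a closed set `W` is a dead end, visibility in the complement is transitive. -/
theorem Vis.trans {W : Set Pt} (hW : IsClosed W) (hne : ∀ x ∈ W, NoEnd W x) {x y z : Pt}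
    (hxy : Vis W x y) (hyz : Vis W y z) : Vis W x z := by
  by_cases hD : cross (y - x) (z - x) = 0
  · by_cases hxz : z = x
    · subst hxz; exact Vis.refl hyz.right
    have hD' : cross (z - x) (y - x) = 0 := by unfold cross at *; linarith
    obtain ⟨k, hk⟩ := exists_smul_of_cross_eq_zero (sub_ne_zero.2 hxz) hD'
    have hy : y = x + k • (z - x) := by rw [← hk]; abel
    intro w hw
    obtain ⟨t, h0, h1, rfl⟩ := mem_segment_iff.1 hw
    rcases le_total t k with htk | htk
    · apply hxy
      rw [mem_segment_iff]
      rcases eq_or_lt_of_le (h0.trans htk) with hk0 | hk0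
      · refine ⟨0, le_rfl, zero_le_one, ?_⟩
        have : t = 0 := by linarith
        simp [this]
      · refine ⟨t / k, by positivity, by rw [div_le_one hk0]; exact htk, ?_⟩
        rw [hk, smul_smul, div_mul_cancel₀ _ hk0.ne']
    · apply hyz
      rw [mem_segment_iff]
      rcases eq_or_lt_of_le (htk.trans h1) with hk0 | hk0
      · refine ⟨0, le_rfl, zero_le_one, ?_⟩
        have : t = k := by linarith
        simp [this, hy]
      · refine ⟨(t - k) / (1 - k), div_nonneg (by linarith) (by linarith),
          by rw [div_le_one (by linarith)]; linarith, ?_⟩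
        have h : z - y = (1 - k) • (z - x) := by rw [hy]; module
        rw [h, smul_smul, div_mul_cancel₀ _ (by linarith), hy]; module
  · intro w hw hwW
    obtain ⟨t, h0, h1, rfl⟩ := mem_segment_iff.1 hw
    let f : ℝ × ℝ → Pt := fun c => x + c.1 • (y - x) + c.2 • (z - x)
    have hf : Continuous f := by fun_prop
    let K : Set (ℝ × ℝ) := (Set.Icc 0 1 ×ˢ Set.Icc 0 1) ∩ ({c | c.1 + c.2 ≤ 1} ∩ f ⁻¹' W)
    have hK : IsCompact K := (isCompact_Icc.prod isCompact_Icc).inter_right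
      ((isClosed_le (by fun_prop) (by fun_prop)).inter (hW.preimage hf))
    have hKm : ∀ a b : ℝ, 0 ≤ a → 0 ≤ b → a + b ≤ 1 → f (a, b) ∈ W → (a, b) ∈ K :=
      fun a b ha hb hab h =>
        ⟨⟨⟨ha, by dsimp only; linarith⟩, ⟨hb, by dsimp only; linarith⟩⟩, hab, h⟩
    obtain ⟨c, hc, hcmax⟩ := hK.exists_isMaxOn ⟨(0, t), hKm 0 t le_rfl h0 (by linarith)
      (by simpa [f] using hwW)⟩ continuous_fst.continuousOn
    have hK' : IsCompact (K ∩ {c' | c'.1 = c.1}) :=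
      hK.inter_right (isClosed_eq (by fun_prop) (by fun_prop))
    obtain ⟨d, ⟨hd, hdc⟩, hdmax⟩ := hK'.exists_isMaxOn ⟨c, hc, rfl⟩ continuous_snd.continuousOn
    obtain ⟨α, β⟩ := d
    have hdc : α = c.1 := hdc
    obtain ⟨⟨⟨hα, -⟩, ⟨hβ, -⟩⟩, hαβ, hfW⟩ := hd
    have hα : 0 ≤ α := hα
    have hβ : 0 ≤ β := hβ
    have hαβ : α + β ≤ 1 := hαβ
    have hfW : f (α, β) ∈ W := hfW
    have hβ0 : 0 < β := by
      refine lt_of_le_of_ne hβ fun h => hxy _ (mem_segment_iff.2 ⟨α, hα, by linarith, ?_⟩) hfW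
      simp [f, ← h]
    have hαβ1 : α + β < 1 := by
      refine lt_of_le_of_ne hαβ fun h => hyz _ (mem_segment_iff.2 ⟨β, hβ, by linarith, ?_⟩) hfW
      have : α = 1 - β := by linarith
      simp only [f, this]; module
    obtain ⟨v, hv, hvW⟩ := hne _ hfW
    obtain ⟨a, b, rfl⟩ := exists_combination hD v
    obtain ⟨δ, hδ, hδ1, H⟩ := exists_small hβ0 (a + b) hαβ1 b
    have hmove : ∀ s : ℝ, |s| ≤ δ → 0 ≤ α + s * a → (α + s * a, β + s * b) ∈ K := by
      intro s hs hsa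
      obtain ⟨h1, h2⟩ := H s hs
      refine hKm _ _ hsa h1.le (by linarith) ?_
      have := hvW s (hs.trans hδ1)
      convert this using 1
      simp only [f]; module
    have hδa : |δ| ≤ δ := (abs_of_pos hδ).le
    have hδn : |-δ| ≤ δ := by rw [abs_neg]; exact hδa
    have key : ∀ s : ℝ, |s| ≤ δ → ¬ (0 < s * a ∨ a = 0 ∧ 0 < s * b) := by
      rintro s hs (h | ⟨rfl, h⟩)
      · have := hcmax (hmove s hs (by linarith))
        have : α + s * a ≤ c.1 := this
        linarith
      · have := hdmax ⟨hmove s hs (by linarith), show α + s * 0 = c.1 by linarith⟩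
        have : β + s * b ≤ β := this
        linarith
    rcases lt_trichotomy a 0 with ha | ha | ha
    · exact key _ hδn (Or.inl (by nlinarith))
    · rcases lt_trichotomy b 0 with hb | hb | hb
      · exact key _ hδn (Or.inr ⟨ha, by nlinarith⟩)
      · exact hv (by simp [ha, hb])
      · exact key _ hδa (Or.inr ⟨ha, by nlinarith⟩)
    · exact key _ hδa (Or.inl (by nlinarith))

end

section

open Topology Filter

/-- The ray from `o` in direction `d` leaves the complement of `W` at parameter `t`. -/
def Hit (W : Set Pt) (o d : Pt) (t : ℝ) : Prop :=
  0 < t ∧ o + t • d ∈ W ∧ ∀ s, 0 ≤ s → s < t → o + s • d ∉ W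

lemma Hit.notMem {W : Set Pt} {o d : Pt} {t : ℝ} (h : Hit W o d t) : o ∉ W := by
  simpa using h.2.2 0 le_rfl h.1

lemma Hit.ne_zero {W : Set Pt} {o d : Pt} {t : ℝ} (h : Hit W o d t) : d ≠ 0 := by
  rintro rfl
  exact h.notMem (by simpa using h.2.1)

lemma Hit.unique {W : Set Pt} {o d : Pt} {t t' : ℝ} (h : Hit W o d t) (h' : Hit W o d t') :
    t = t' := by
  rcases lt_trichotomy t t' with hl | hl | hl
  · exact absurd h.2.1 (h'.2.2 t h.1.le hl)
  · exact hl
  · exact absurd h'.2.1 (h.2.2 t' h'.1.le hl)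

lemma exists_hit_le {W : Set Pt} (hW : IsClosed W) {o d : Pt} (ho : o ∉ W) {t : ℝ} (ht : 0 ≤ t)
    (h : o + t • d ∈ W) : ∃ t', Hit W o d t' ∧ t' ≤ t := by
  let S : Set ℝ := Set.Ici 0 ∩ (fun t : ℝ => o + t • d) ⁻¹' W
  have hS : IsClosed S := isClosed_Ici.inter (hW.preimage (by fun_prop))
  have hb : BddBelow S := ⟨0, fun x hx => hx.1⟩
  have hm : sInf S ∈ S := hS.csInf_mem ⟨t, ht, h⟩ hb
  refine ⟨sInf S, ⟨lt_of_le_of_ne hm.1 fun h0 => ho ?_, hm.2, fun s hs hlt hsW => ?_⟩,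
    csInf_le hb ⟨ht, h⟩⟩
  · have := hm.2
    rw [← h0] at this
    simpa using this
  · exact absurd (csInf_le hb (show s ∈ S from ⟨hs, hsW⟩)) (not_le.2 hlt)

lemma Hit.smul {W : Set Pt} {o d : Pt} {t c : ℝ} (h : Hit W o d t) (hc : 0 < c) :
    Hit W o (c • d) (t / c) := by
  refine ⟨div_pos h.1 hc, ?_, fun s hs hst => ?_⟩
  · rw [smul_smul, div_mul_cancel₀ _ hc.ne']; exact h.2.1
  · rw [smul_smul]
    exact h.2.2 _ (by positivity) ((lt_div_iff₀ hc).1 hst)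

lemma cross_smul_right (u v : Pt) (c : ℝ) : cross u (c • v) = c * cross u v := by
  simp [cross]; ring

lemma cross_smul_left (u v : Pt) (c : ℝ) : cross (c • u) v = c * cross u v := by
  simp [cross]; ring

lemma cross_same (u : Pt) : cross u u = 0 := by simp [cross]; ring

lemma continuous_cross_left (v : Pt) : Continuous fun u => cross u v := by
  unfold cross; fun_prop

/-- The first wall point seen from `o` depends continuously on the direction, if it is not a
dead end. -/
theorem Hit.eventually {W : Set Pt} (hW : IsClosed W) {o d₀ : Pt} {t₀ : ℝ} (h : Hit W o d₀ t₀)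
    (hne : NoEnd W (o + t₀ • d₀)) {T : Set ℝ} (hT : T ∈ 𝓝 t₀) :
    ∀ᶠ d in 𝓝 d₀, ∃ t ∈ T, Hit W o d t := by
  obtain ⟨v, hv, hvW⟩ := hne
  have hc : cross d₀ v ≠ 0 := by
    intro hc
    obtain ⟨k, rfl⟩ := exists_smul_of_cross_eq_zero h.ne_zero hc
    have hk : k ≠ 0 := by rintro rfl; simp at hv
    have hk' : 0 < |k| := abs_pos.2 hk
    set r := min 1 (t₀ / |k|)
    have hr : 0 < r := lt_min one_pos (div_pos h.1 hk')
    have hr1 : r * |k| ≤ t₀ := by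
      rw [← le_div_iff₀ hk']; exact min_le_right _ _
    obtain ⟨s, hs, hs1⟩ : ∃ s : ℝ, |s| ≤ 1 ∧ s * k = -(r * |k|) := by
      rcases le_total 0 k with h0 | h0
      · exact ⟨-r, by rw [abs_neg, abs_of_pos hr]; exact min_le_left _ _, by
          rw [abs_of_nonneg h0]; ring⟩
      · exact ⟨r, by rw [abs_of_pos hr]; exact min_le_left _ _, by
          rw [abs_of_nonpos h0]; ring⟩
    have := hvW s hs
    rw [smul_smul, hs1, add_assoc, ← add_smul] at this
    exact h.2.2 _ (by linarith) (by nlinarith) this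
  obtain ⟨ε, hε, hεT⟩ := Metric.mem_nhds_iff.1 hT
  have hlow : ∀ᶠ d in 𝓝 d₀, ∀ s ∈ Set.Icc 0 (t₀ - ε / 2), o + s • d ∉ W := by
    apply isCompact_Icc.eventually_forall_of_forall_eventually
    intro s hs
    have hO : IsOpen ((fun x : Pt × ℝ => o + x.2 • x.1) ⁻¹' Wᶜ) :=
      hW.isOpen_compl.preimage (by fun_prop)
    exact hO.mem_nhds (h.2.2 s hs.1 (by linarith [hs.2]))
  have hcd : ∀ᶠ d in 𝓝 d₀, cross d v ≠ 0 :=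
    (continuous_cross_left v).continuousAt.eventually_ne hc
  have ht : Tendsto (fun d => cross (t₀ • d₀) v / cross d v) (𝓝 d₀) (𝓝 t₀) := by
    have : t₀ = cross (t₀ • d₀) v / cross d₀ v := by rw [cross_smul_left]; field_simp
    conv in 𝓝 t₀ => rw [this]
    exact tendsto_const_nhds.div ((continuous_cross_left v).tendsto d₀) hc
  have hr : Tendsto (fun d => cross d (-t₀ • d₀) / cross d v) (𝓝 d₀) (𝓝 0) := by
    have : 0 = cross d₀ (-t₀ • d₀) / cross d₀ v := by rw [cross_smul_right, cross_same]; simp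
    conv in 𝓝 (0 : ℝ) => rw [this]
    exact ((continuous_cross_left _).tendsto d₀).div ((continuous_cross_left v).tendsto d₀) hc
  have hr1 : ∀ᶠ d in 𝓝 d₀, |cross d (-t₀ • d₀) / cross d v| < 1 := by
    have := hr.abs
    rw [abs_zero] at this
    exact this.eventually_lt_const one_pos
  filter_upwards [hlow, hcd, hr1, ht.eventually_lt_const (show t₀ < t₀ + ε by linarith),
    ht.eventually_const_lt h.1] with d h1 h2 h3 h5 h6
  have hmem : o + (cross (t₀ • d₀) v / cross d v) • d ∈ W := by
    convert hvW _ h3.le using 1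
    refine Prod.ext ?_ ?_ <;>
    · simp only [Prod.fst_add, Prod.snd_add, Prod.smul_fst, Prod.smul_snd, smul_eq_mul]
      field_simp
      simp only [cross, Prod.smul_fst, Prod.smul_snd, smul_eq_mul]; ring
  obtain ⟨t, hit, hle⟩ := exists_hit_le hW h.notMem h6.le hmem
  refine ⟨t, hεT ?_, hit⟩
  rw [Metric.mem_ball, Real.dist_eq, abs_lt]
  have : t₀ - ε / 2 < t := by
    by_contra hcon
    exact h1 t ⟨hit.1.le, not_lt.1 hcon⟩ hit.2.1
  constructor <;> linarith

lemma Hit.eventually_mem {W : Set Pt} (hW : IsClosed W) {o d₀ : Pt} {t₀ : ℝ} (h : Hit W o d₀ t₀)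
    (hne : NoEnd W (o + t₀ • d₀)) {N : Set Pt} (hN : N ∈ 𝓝 (o + t₀ • d₀)) :
    ∀ᶠ d in 𝓝 d₀, ∃ t, Hit W o d t ∧ o + t • d ∈ N := by
  have hF : Tendsto (fun x : ℝ × Pt => o + x.1 • x.2) (𝓝 (t₀, d₀)) (𝓝 (o + t₀ • d₀)) :=
    Continuous.tendsto (f := fun x : ℝ × Pt => o + x.1 • x.2) (by fun_prop) _
  have hN' := hF hN
  rw [Filter.mem_map, nhds_prod_eq, mem_prod_iff] at hN'
  obtain ⟨T, hT, V, hV, hTV⟩ := hN'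
  filter_upwards [h.eventually hW hne hT, hV] with d ⟨t, htT, ht⟩ hd
  exact ⟨t, ht, hTV (show (t, d) ∈ T ×ˢ V from ⟨htT, hd⟩)⟩

end

section

open Topology Filter

/-- The union of the edges of `M`. -/
def edgeUnion (M : Finset (Pt × Pt)) : Set Pt := {x | ∃ e ∈ M, x ∈ segment ℝ e.1 e.2}

/-- The endpoints of the edges of `M`. -/
noncomputable def endpoints (M : Finset (Pt × Pt)) : Finset Pt :=
  M.image Prod.fst ∪ M.image Prod.snd

lemma mem_endpoints {M : Finset (Pt × Pt)} {x : Pt} :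
    x ∈ endpoints M ↔ ∃ e ∈ M, x = e.1 ∨ x = e.2 := by
  simp only [endpoints, mem_union, mem_image]
  constructor
  · rintro (⟨e, he, rfl⟩ | ⟨e, he, rfl⟩)
    exacts [⟨e, he, Or.inl rfl⟩, ⟨e, he, Or.inr rfl⟩]
  · rintro ⟨e, he, rfl | rfl⟩
    exacts [Or.inl ⟨e, he, rfl⟩, Or.inr ⟨e, he, rfl⟩]

/-- `M` consists of disjoint nondegenerate segments with endpoints in general position. -/
structure PlaneMatching (M : Finset (Pt × Pt)) : Prop where
  ne : ∀ e ∈ M, e.1 ≠ e.2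
  ori_ne : ∀ p ∈ endpoints M, ∀ q ∈ endpoints M, ∀ r ∈ endpoints M, p ≠ q → p ≠ r → q ≠ r →
    ori p q r ≠ 0
  eq_of_mem : ∀ e ∈ M, ∀ e' ∈ M, ∀ x ∈ segment ℝ e.1 e.2, x ∈ segment ℝ e'.1 e'.2 → e = e'

/-- The walls of sign `true` and `false` together with the edges of the matching. -/
def walls (M : Finset (Pt × Pt)) (w : Bool → Set Pt) : Set Pt :=
  edgeUnion M ∪ (w true ∪ w false)

lemma mem_walls {M : Finset (Pt × Pt)} {w : Bool → Set Pt} {x : Pt} :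
    x ∈ walls M w ↔ x ∈ edgeUnion M ∨ ∃ s, x ∈ w s := by
  simp only [walls, Set.mem_union, Bool.exists_bool]; tauto

/-- `1` or `-1`. -/
def turn (s : Bool) : ℝ := if s then 1 else -1

/-- The wall point `x`, seen from `o`, has sign `s`; the left side of an edge has sign `true`. -/
def SignAt (M : Finset (Pt × Pt)) (w : Bool → Set Pt) (x o : Pt) (s : Bool) : Prop :=
  (x ∉ edgeUnion M ∧ x ∈ w s) ∨
    ∃ e ∈ M, x ∈ segment ℝ e.1 e.2 ∧ 0 < turn s * ori e.1 e.2 o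

variable {M : Finset (Pt × Pt)} {w : Bool → Set Pt} {U : Finset Pt}

lemma SignAt.mono {w' : Bool → Set Pt} {x o : Pt} {s : Bool} (h : SignAt M w x o s)
    (hw : w ≤ w') : SignAt M w' x o s :=
  h.imp (fun h => ⟨h.1, hw s h.2⟩) id

lemma ori_of_mem {p q x : Pt} (h : x ∈ segment ℝ p q) (o : Pt) (t : ℝ) :
    ori p q (x + t • (o - x)) = t * ori p q o := by
  rw [ori_lineMap, ori_eq_zero_of_mem_segment h]; ring

lemma ori_of_mem' {p q x : Pt} (h : x ∈ segment ℝ p q) (o : Pt) (t : ℝ) :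
    ori p q (o + t • (x - o)) = (1 - t) * ori p q o := by
  rw [ori_lineMap, ori_eq_zero_of_mem_segment h]; ring

lemma SignAt.lineMap {x o : Pt} {s : Bool} (h : SignAt M w x o s) {t : ℝ} (ht : 0 < t) :
    SignAt M w x (x + t • (o - x)) s := by
  refine h.imp id ?_
  rintro ⟨e, he, hx, hp⟩
  refine ⟨e, he, hx, ?_⟩
  rw [ori_of_mem hx]
  nlinarith [mul_pos ht hp]

lemma SignAt.mem {x o : Pt} {s : Bool} (h : SignAt M w x o s) : x ∈ walls M w := by
  rcases h with h | ⟨e, he, hx, -⟩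
  · exact mem_walls.2 (Or.inr ⟨s, h.2⟩)
  · exact mem_walls.2 (Or.inl ⟨e, he, hx⟩)

lemma endpoint_mem_edgeUnion {x : Pt} (h : x ∈ endpoints M) : x ∈ edgeUnion M := by
  obtain ⟨e, he, rfl | rfl⟩ := mem_endpoints.1 h
  exacts [⟨e, he, left_mem_segment _ _ _⟩, ⟨e, he, right_mem_segment _ _ _⟩]

lemma isClosed_segment (x y : Pt) : IsClosed (segment ℝ x y) := by
  rw [segment_eq_image_lineMap]
  exact (isCompact_Icc.image (by fun_prop)).isClosed

lemma isClosed_edgeUnion (M : Finset (Pt × Pt)) : IsClosed (edgeUnion M) := by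
  have : edgeUnion M = ⋃ e ∈ M, segment ℝ e.1 e.2 := by ext; simp [edgeUnion]
  rw [this]
  exact isClosed_biUnion_finset fun e _ => isClosed_segment _ _

lemma mem_openSegment_of_mem {x y z : Pt} (hz : z ∈ segment ℝ x y) (hx : z ≠ x) (hy : z ≠ y) :
    z ∈ openSegment ℝ x y :=
  mem_openSegment_of_ne_left_right hx.symm hy.symm hz

lemma mem_openSegment_iff {x y z : Pt} :
    z ∈ openSegment ℝ x y ↔ ∃ t : ℝ, 0 < t ∧ t < 1 ∧ z = x + t • (y - x) := by
  rw [openSegment_eq_image']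
  constructor
  · rintro ⟨t, ⟨h0, h1⟩, rfl⟩; exact ⟨t, h0, h1, rfl⟩
  · rintro ⟨t, h0, h1, rfl⟩; exact ⟨t, ⟨h0, h1⟩, rfl⟩

/-- Interior points of a segment are not dead ends. -/
lemma noEnd_of_mem_openSegment {W : Set Pt} {x y z : Pt} (hxy : x ≠ y)
    (hz : z ∈ openSegment ℝ x y) (hW : segment ℝ x y ⊆ W) : NoEnd W z := by
  obtain ⟨t, h0, h1, rfl⟩ := mem_openSegment_iff.1 hz
  have hm : 0 < min t (1 - t) := lt_min h0 (by linarith)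
  refine ⟨min t (1 - t) • (y - x), smul_ne_zero hm.ne' (sub_ne_zero.2 hxy.symm),
    fun r hr => hW (mem_segment_iff.2 ⟨t + r * min t (1 - t), ?_, ?_, by module⟩)⟩
  · have := neg_le_of_abs_le hr
    nlinarith [min_le_left t (1 - t)]
  · have := le_of_abs_le hr
    nlinarith [min_le_right t (1 - t)]

/-- The invariants of a system of signed walls in which all endpoints outside `U` are extended. -/
structure WallSystem (M : Finset (Pt × Pt)) (w : Bool → Set Pt) (U : Finset Pt) : Prop where
  subset : U ⊆ endpoints M
  closed : ∀ s, IsClosed (w s)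
  noEnd : ∀ x ∈ walls M w, x ∉ U → NoEnd (walls M w) x
  sep : ∀ s x, x ∈ w s → x ∈ w (!s) → x ∈ edgeUnion M
  edge : ∀ e ∈ M, ∀ x ∈ openSegment ℝ e.1 e.2, ∀ s,
    ∀ᶠ y in 𝓝 x, y ∈ w s → 0 ≤ turn s * ori e.1 e.2 y
  unextended : ∀ x ∈ U, ∀ s, x ∉ w s
  extended : ∀ e ∈ M, ∀ x, x = e.1 ∨ x = e.2 → x ∉ U →
    (∃ s, x ∉ w s) ∧ ∀ s, ∀ᶠ y in 𝓝 x, y ∈ w s → ori e.1 e.2 y = 0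
  bdd : ∃ K, ∀ x : Pt, K ≤ ‖x‖ → x ∈ walls M w

lemma WallSystem.isClosed (h : WallSystem M w U) : IsClosed (walls M w) :=
  (isClosed_edgeUnion M).union ((h.closed true).union (h.closed false))

/-- Rays are eventually blocked. -/
lemma WallSystem.exists_mem_ray (h : WallSystem M w U) (o : Pt) {d : Pt} (hd : d ≠ 0) :
    ∃ t : ℝ, 0 ≤ t ∧ o + t • d ∈ walls M w := by
  obtain ⟨K, hK⟩ := h.bdd
  have hd' : 0 < ‖d‖ := norm_pos_iff.2 hd
  refine ⟨(|K| + ‖o‖) / ‖d‖, by positivity, hK _ ?_⟩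
  have h1 : ‖((|K| + ‖o‖) / ‖d‖) • d‖ = |K| + ‖o‖ := by
    rw [norm_smul, Real.norm_eq_abs, abs_of_nonneg (by positivity), div_mul_cancel₀ _ hd'.ne']
  have h2 := norm_sub_le (o + ((|K| + ‖o‖) / ‖d‖) • d) o
  rw [add_sub_cancel_left, h1] at h2
  linarith [le_abs_self K]

lemma WallSystem.exists_hit (h : WallSystem M w U) {o d : Pt} (ho : o ∉ walls M w) (hd : d ≠ 0) :
    ∃ t, Hit (walls M w) o d t := by
  obtain ⟨t, ht, hm⟩ := h.exists_mem_ray o hd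
  obtain ⟨t', ht', -⟩ := exists_hit_le h.isClosed ho ht hm
  exact ⟨t', ht'⟩

lemma turn_mul_pos_or {x : ℝ} (hx : x ≠ 0) : ∃ s, 0 < turn s * x := by
  rcases lt_or_gt_of_ne hx with h | h
  · exact ⟨false, by simp [turn, h]⟩
  · exact ⟨true, by simp [turn, h]⟩

/-- A wall point that is not an endpoint of the matching has a sign. -/
lemma exists_signAt (hM : PlaneMatching M) {x o : Pt} (hx : x ∈ walls M w)
    (hxp : x ∉ endpoints M) (hvis : openSegment ℝ o x ∩ walls M w = ∅) :
    ∃ s, SignAt M w x o s := by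
  by_cases hE : x ∈ edgeUnion M
  · obtain ⟨e, he, hxe⟩ := hE
    have hox : ori e.1 e.2 o ≠ 0 := by
      intro h0
      have hxo : x ∈ openSegment ℝ e.1 e.2 :=
        mem_openSegment_of_mem hxe (fun h => hxp (mem_endpoints.2 ⟨e, he, Or.inl h⟩))
          (fun h => hxp (mem_endpoints.2 ⟨e, he, Or.inr h⟩))
      obtain ⟨a, ha0, ha1, rfl⟩ := mem_openSegment_iff.1 hxo
      obtain ⟨k, rfl⟩ := exists_lineMap_of_ori_eq_zero (hM.ne e he) h0
      obtain ⟨δ, hδ, hδ1, H⟩ := exists_small ha0 (k - a) ha1 (k - a)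
      have hy : e.1 + (a + δ / 2 * (k - a)) • (e.2 - e.1) ∈ segment ℝ e.1 e.2 := by
        obtain ⟨h1, h2⟩ := H (δ / 2) (by rw [abs_of_pos (by positivity)]; linarith)
        exact mem_segment_iff.2 ⟨_, h1.le, h2.le, rfl⟩
      have : e.1 + (a + δ / 2 * (k - a)) • (e.2 - e.1) ∈
          openSegment ℝ (e.1 + k • (e.2 - e.1)) (e.1 + a • (e.2 - e.1)) ∩ walls M w := by
        refine ⟨?_, mem_walls.2 (Or.inl ⟨e, he, hy⟩)⟩
        rw [mem_openSegment_iff]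
        exact ⟨1 - δ / 2, by linarith, by linarith, by module⟩
      rw [hvis] at this
      exact this
    obtain ⟨s, hs⟩ := turn_mul_pos_or hox
    exact ⟨s, Or.inr ⟨e, he, hxe, hs⟩⟩
  · obtain h | ⟨s, hs⟩ := mem_walls.1 hx
    · exact absurd h hE
    · exact ⟨s, Or.inl ⟨hE, hs⟩⟩

/-- The system `w` with the segment `uv` added to the walls of sign `s`. -/
def addWall (w : Bool → Set Pt) (s : Bool) (u v : Pt) : Bool → Set Pt :=
  fun s' => if s' = s then w s' ∪ segment ℝ u v else w s'

lemma mem_addWall {s s' : Bool} {u v x : Pt} :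
    x ∈ addWall w s u v s' ↔ x ∈ w s' ∨ s' = s ∧ x ∈ segment ℝ u v := by
  unfold addWall; split_ifs with h <;> simp [h]

lemma le_addWall (s : Bool) (u v : Pt) : w ≤ addWall w s u v :=
  fun _ _ hx => mem_addWall.2 (Or.inl hx)

lemma walls_addWall (s : Bool) (u v : Pt) :
    walls M (addWall w s u v) = walls M w ∪ segment ℝ u v := by
  ext x
  simp only [mem_walls, mem_addWall, Set.mem_union, Bool.exists_bool]
  cases s <;> simp <;> tauto

/-- Adding a signed wall through free space, with at most one end at an unextended endpoint. -/
theorem WallSystem.insert_wall (h : WallSystem M w U) (hM : PlaneMatching M) {s : Bool} {u v : Pt}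
    (hfree : openSegment ℝ u v ∩ walls M w = ∅) (hv : v ∉ endpoints M) (hvs : SignAt M w v u s)
    (hu : (u ∉ endpoints M ∧ SignAt M w u v s) ∨
      (u ∈ U ∧ ∃ e ∈ M, ∃ u', (u = e.1 ∧ u' = e.2 ∨ u = e.2 ∧ u' = e.1) ∧
        ∃ t : ℝ, 0 < t ∧ v = u + t • (u - u'))) :
    WallSystem M (addWall w s u v) (U.erase u) := by
  have huW : u ∈ walls M w := by
    rcases hu with hu | hu
    · exact hu.2.mem
    · exact mem_walls.2 (Or.inl (endpoint_mem_edgeUnion (h.subset hu.1)))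
  have huv : u ≠ v := by
    rintro rfl
    have : u ∈ openSegment ℝ u u ∩ walls M w := ⟨by simp, huW⟩
    rw [hfree] at this; exact this
  have hseg : ∀ x ∈ segment ℝ u v, x ∈ walls M w → x = u ∨ x = v := by
    intro x hx hxW
    by_contra hcon
    push Not at hcon
    have : x ∈ openSegment ℝ u v ∩ walls M w :=
      ⟨mem_openSegment_of_mem hx hcon.1 hcon.2, hxW⟩
    rw [hfree] at this; exact this
  refine ⟨(erase_subset _ _).trans h.subset, fun s' => ?_, ?_, ?_, ?_, ?_, ?_, ?_⟩
  · unfold addWall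
    split_ifs
    · exact (h.closed s').union (isClosed_segment _ _)
    · exact h.closed s'
  · rw [walls_addWall]
    intro x hx hxU
    by_cases hxW : x ∈ walls M w
    · by_cases hxU' : x ∈ U
      · have hxu : x = u := by
          by_contra hcon
          exact hxU (mem_erase.2 ⟨hcon, hxU'⟩)
        subst hxu
        rcases hu with hu | ⟨-, e, he, u', hu', t, ht, rfl⟩
        · exact absurd (h.subset hxU') hu.1
        have hxu' : x ≠ u' := by
          rintro rfl
          have := hM.ne e he
          rcases hu' with ⟨h1, h2⟩ | ⟨h1, h2⟩
          · exact this (h1.symm.trans h2)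
          · exact this (h2.symm.trans h1)
        have hE : segment ℝ x u' ⊆ walls M w := by
          intro z hz
          refine mem_walls.2 (Or.inl ⟨e, he, ?_⟩)
          rcases hu' with ⟨rfl, rfl⟩ | ⟨rfl, rfl⟩
          · exact hz
          · rwa [segment_symm]
        refine noEnd_of_mem_openSegment (x := u') (y := x + t • (x - u')) (fun hc => ?_) ?_ ?_
        · have h0 : (1 + t) • (x - u') = 0 := by
            have : (1 + t) • (x - u') = (x + t • (x - u')) - u' := by module
            rw [this, ← hc, sub_self]
          rcases smul_eq_zero.1 h0 with h0 | h0
          · linarith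
          · exact hxu' (sub_eq_zero.1 h0)
        · rw [mem_openSegment_iff]
          refine ⟨1 / (1 + t), by positivity, by rw [div_lt_one (by linarith)]; linarith, ?_⟩
          have : x + t • (x - u') - u' = (1 + t) • (x - u') := by module
          rw [this, smul_smul, one_div, inv_mul_cancel₀ (by linarith)]
          module
        · intro z hz
          obtain ⟨r, hr0, hr1, rfl⟩ := mem_segment_iff.1 hz
          rcases le_total (r * (1 + t)) 1 with hr | hr
          · left
            exact hE (mem_segment_iff.2 ⟨1 - r * (1 + t), by linarith, by
              nlinarith, by module⟩)
          · right
            refine mem_segment_iff.2 ⟨(r * (1 + t) - 1) / t, div_nonneg (by linarith) ht.le, ?_, ?_⟩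
            · rw [div_le_one ht]; nlinarith
            · rw [add_sub_cancel_left, smul_smul, div_mul_cancel₀ _ ht.ne']; module
      · exact (h.noEnd x hxW hxU').mono Set.subset_union_left
    · have hx' : x ∈ segment ℝ u v := hx.resolve_left hxW
      refine noEnd_of_mem_openSegment huv (mem_openSegment_of_mem hx' ?_ ?_)
        Set.subset_union_right
      · rintro rfl; exact hxW huW
      · rintro rfl; exact hxW hvs.mem
  · have key : ∀ x, x ∈ segment ℝ u v → x ∈ w (!s) → x ∈ edgeUnion M := by
      intro x hx hxs
      have aux : ∀ z, SignAt M w x z s → x ∈ edgeUnion M := by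
        rintro z (hz | ⟨e, he, hz, -⟩)
        · exact h.sep s x hz.2 hxs
        · exact ⟨e, he, hz⟩
      rcases hseg x hx (mem_walls.2 (Or.inr ⟨_, hxs⟩)) with rfl | rfl
      · rcases hu with hu | hu
        · exact aux _ hu.2
        · exact endpoint_mem_edgeUnion (h.subset hu.1)
      · exact aux _ hvs
    intro s' x hx hx'
    rcases mem_addWall.1 hx with h1 | ⟨rfl, h1⟩
    · rcases mem_addWall.1 hx' with h2 | ⟨h2, h2'⟩
      · exact h.sep _ _ h1 h2
      · subst h2
        exact key x h2' (by simpa using h1)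
    · rcases mem_addWall.1 hx' with h2 | ⟨h2, h2'⟩
      · exact key x h1 h2
      · simp at h2
  · intro e he x hx s'
    have hxe := openSegment_subset_segment ℝ _ _ hx
    have hxP : x ∉ endpoints M := by
      intro hxP
      obtain ⟨e', he', hx'⟩ := mem_endpoints.1 hxP
      have hxe' : x ∈ segment ℝ e'.1 e'.2 := by
        rcases hx' with rfl | rfl
        exacts [left_mem_segment _ _ _, right_mem_segment _ _ _]
      obtain rfl := hM.eq_of_mem e he e' he' x hxe hxe'
      rcases hx' with rfl | rfl
      · exact hM.ne e he (left_mem_openSegment_iff.1 hx)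
      · exact hM.ne e he (right_mem_openSegment_iff.1 hx)
    by_cases hxs : x ∈ segment ℝ u v
    · have aux : ∀ z, SignAt M w x z s → 0 < turn s * ori e.1 e.2 z := by
        rintro z (hz | ⟨e', he', hz, hp⟩)
        · exact absurd ⟨e, he, hxe⟩ hz.1
        · obtain rfl := hM.eq_of_mem e he e' he' x hxe hz
          exact hp
      filter_upwards [h.edge e he x hx s'] with y hy hyw
      rcases mem_addWall.1 hyw with h1 | ⟨rfl, h1⟩
      · exact hy h1
      obtain ⟨r, hr0, hr1, rfl⟩ := mem_segment_iff.1 h1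
      rcases hseg x hxs (mem_walls.2 (Or.inl ⟨e, he, hxe⟩)) with rfl | rfl
      · rcases hu with hu | hu
        · rw [ori_of_mem hxe]
          nlinarith [aux _ hu.2]
        · exact absurd (h.subset hu.1) hxP
      · rw [ori_of_mem' hxe]
        nlinarith [aux _ hvs]
    · filter_upwards [h.edge e he x hx s',
        (isClosed_segment u v).isOpen_compl.mem_nhds hxs] with y hy hyn hyw
      rcases mem_addWall.1 hyw with h1 | ⟨-, h1⟩
      · exact hy h1
      · exact absurd h1 hyn
  · intro x hx s' hxs
    obtain ⟨hxu, hxU⟩ := mem_erase.1 hx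
    rcases mem_addWall.1 hxs with h1 | ⟨-, h1⟩
    · exact h.unextended x hxU _ h1
    · have hxP := h.subset hxU
      rcases hseg x h1 (mem_walls.2 (Or.inl (endpoint_mem_edgeUnion hxP))) with rfl | rfl
      · exact hxu rfl
      · exact hv hxP
  · intro e he x hx hxU
    have hxP : x ∈ endpoints M := mem_endpoints.2 ⟨e, he, hx⟩
    have hxe : x ∈ segment ℝ e.1 e.2 := by
      rcases hx with rfl | rfl
      exacts [left_mem_segment _ _ _, right_mem_segment _ _ _]
    have hxW : x ∈ walls M w := mem_walls.2 (Or.inl ⟨e, he, hxe⟩)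
    by_cases hxU' : x ∈ U
    · have hxu : x = u := by
        by_contra hcon
        exact hxU (mem_erase.2 ⟨hcon, hxU'⟩)
      subst hxu
      rcases hu with hu | ⟨-, e', he', u', hu', t, ht, rfl⟩
      · exact absurd hxP hu.1
      have hxe' : x ∈ segment ℝ e'.1 e'.2 := by
        rcases hu' with ⟨rfl, -⟩ | ⟨rfl, -⟩
        exacts [left_mem_segment _ _ _, right_mem_segment _ _ _]
      obtain rfl := hM.eq_of_mem e he e' he' x hxe hxe'
      refine ⟨⟨!s, fun hc => ?_⟩, fun s' => ?_⟩
      · rcases mem_addWall.1 hc with h1 | ⟨h1, -⟩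
        · exact h.unextended x hxU' _ h1
        · simp at h1
      · filter_upwards [(h.closed s').isOpen_compl.mem_nhds (h.unextended x hxU' s')]
          with y hy hyw
        rcases mem_addWall.1 hyw with h1 | ⟨-, h1⟩
        · exact absurd h1 hy
        · obtain ⟨r, -, -, rfl⟩ := mem_segment_iff.1 h1
          have h0 : ori e.1 e.2 u' = 0 := by
            rcases hu' with ⟨-, rfl⟩ | ⟨-, rfl⟩ <;> simp [ori, cross]; ring
          have : x + r • (x + t • (x - u') - x) = x + (-(r * t)) • (u' - x) := by module
          rw [this, ori_of_mem hxe, h0, mul_zero]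
    · have hxs : x ∉ segment ℝ u v := by
        intro hxs
        rcases hseg x hxs hxW with rfl | rfl
        · rcases hu with hu | hu
          · exact hu.1 hxP
          · exact hxU' hu.1
        · exact hv hxP
      obtain ⟨⟨s₀, hs₀⟩, h2⟩ := h.extended e he x hx hxU'
      refine ⟨⟨s₀, fun hc => ?_⟩, fun s' => ?_⟩
      · rcases mem_addWall.1 hc with h1 | ⟨-, h1⟩
        · exact hs₀ h1
        · exact hxs h1
      · filter_upwards [h2 s', (isClosed_segment u v).isOpen_compl.mem_nhds hxs]
          with y hy hyn hyw
        rcases mem_addWall.1 hyw with h1 | ⟨-, h1⟩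
        · exact hy h1
        · exact absurd h1 hyn
  · obtain ⟨K, hK⟩ := h.bdd
    refine ⟨K, fun x hx => ?_⟩
    rw [walls_addWall]
    exact Or.inl (hK x hx)

end

section

open Topology Filter

variable {M : Finset (Pt × Pt)} {w : Bool → Set Pt} {U : Finset Pt}

/-- The pairs in `Γ` are the components of the complement of `W` on the line `τ ↦ q + τ • D`. -/
structure Gaps (W : Set Pt) (q D : Pt) (Γ : Finset (ℝ × ℝ)) : Prop where
  lt : ∀ γ ∈ Γ, γ.1 < γ.2
  ends : ∀ γ ∈ Γ, q + γ.1 • D ∈ W ∧ q + γ.2 • D ∈ W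
  free : ∀ γ ∈ Γ, ∀ τ, γ.1 < τ → τ < γ.2 → q + τ • D ∉ W
  cover : ∀ τ : ℝ, q + τ • D ∉ W → ∃ γ ∈ Γ, γ.1 < τ ∧ τ < γ.2

variable {W : Set Pt} {q D : Pt} {Γ : Finset (ℝ × ℝ)}

lemma Gaps.eq (h : Gaps W q D Γ) {γ γ' : ℝ × ℝ} (hγ : γ ∈ Γ) (hγ' : γ' ∈ Γ) {τ : ℝ}
    (h1 : γ.1 < τ) (h2 : τ < γ.2) (h1' : γ'.1 < τ) (h2' : τ < γ'.2) : γ = γ' := by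
  have key : ∀ γ ∈ Γ, ∀ γ' ∈ Γ, γ.1 < τ → τ < γ.2 → γ'.1 < τ → τ < γ'.2 →
      γ.1 ≤ γ'.1 ∧ γ'.2 ≤ γ.2 := by
    intro γ hγ γ' hγ' h1 h2 h1' h2'
    constructor
    · by_contra hcon
      exact h.free γ' hγ' _ (not_le.1 hcon) (h1.trans h2') (h.ends γ hγ).1
    · by_contra hcon
      exact h.free γ' hγ' _ (h1'.trans h2) (not_le.1 hcon) (h.ends γ hγ).2
  have k1 := key γ hγ γ' hγ' h1 h2 h1' h2'
  have k2 := key γ' hγ' γ hγ h1' h2' h1 h2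
  exact Prod.ext (le_antisymm k1.1 k2.1) (le_antisymm k2.2 k1.2)

lemma Gaps.of_subset {W' : Set Pt} (h : Gaps W q D Γ) (hW : W ⊆ W')
    (hW' : ∀ τ : ℝ, q + τ • D ∈ W' → q + τ • D ∈ W) : Gaps W' q D Γ :=
  ⟨h.lt, fun γ hγ => ⟨hW (h.ends γ hγ).1, hW (h.ends γ hγ).2⟩,
    fun γ hγ τ h1 h2 h3 => h.free γ hγ τ h1 h2 (hW' τ h3),
    fun τ hτ => h.cover τ fun h' => hτ (hW h')⟩

lemma Gaps.split {S : Set Pt} (h : Gaps W q D Γ) {γ : ℝ × ℝ} (hγ : γ ∈ Γ) {τ : ℝ}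
    (h1 : γ.1 < τ) (h2 : τ < γ.2) (hτ : q + τ • D ∈ S)
    (hS : ∀ τ' : ℝ, q + τ' • D ∈ S → q + τ' • D ∈ W ∨ τ' = τ) :
    Gaps (W ∪ S) q D (insert (γ.1, τ) (insert (τ, γ.2) (Γ.erase γ))) := by
  have hnew : ∀ τ' : ℝ, q + τ' • D ∈ W ∪ S → q + τ' • D ∈ W ∨ τ' = τ := by
    rintro τ' (h' | h')
    · exact Or.inl h'
    · exact hS τ' h'
  refine ⟨?_, ?_, ?_, ?_⟩
  · intro γ' hγ'
    rcases mem_insert.1 hγ' with rfl | hγ'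
    · exact h1
    rcases mem_insert.1 hγ' with rfl | hγ'
    · exact h2
    exact h.lt _ (mem_of_mem_erase hγ')
  · intro γ' hγ'
    rcases mem_insert.1 hγ' with rfl | hγ'
    · exact ⟨Or.inl (h.ends γ hγ).1, Or.inr hτ⟩
    rcases mem_insert.1 hγ' with rfl | hγ'
    · exact ⟨Or.inr hτ, Or.inl (h.ends γ hγ).2⟩
    have := h.ends _ (mem_of_mem_erase hγ')
    exact ⟨Or.inl this.1, Or.inl this.2⟩
  · intro γ' hγ' τ' ht1 ht2 hm
    rcases mem_insert.1 hγ' with rfl | hγ'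
    · rcases hnew τ' hm with hm | rfl
      · exact h.free γ hγ τ' ht1 (lt_trans ht2 h2) hm
      · exact lt_irrefl _ ht2
    rcases mem_insert.1 hγ' with rfl | hγ'
    · rcases hnew τ' hm with hm | rfl
      · exact h.free γ hγ τ' (lt_trans h1 ht1) ht2 hm
      · exact lt_irrefl _ ht1
    obtain ⟨hne, hmem⟩ := mem_erase.1 hγ'
    rcases hnew τ' hm with hm | rfl
    · exact h.free γ' hmem τ' ht1 ht2 hm
    · exact hne (h.eq hmem hγ ht1 ht2 h1 h2)
  · intro τ' hτ'
    have hτ'W : q + τ' • D ∉ W := fun h' => hτ' (Or.inl h')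
    have hne : τ' ≠ τ := by rintro rfl; exact hτ' (Or.inr hτ)
    obtain ⟨γ', hγ', ht1, ht2⟩ := h.cover τ' hτ'W
    by_cases hc : γ' = γ
    · subst hc
      rcases lt_or_gt_of_ne hne with hl | hl
      · exact ⟨(γ'.1, τ), by simp, ht1, hl⟩
      · exact ⟨(τ, γ'.2), by simp, hl, ht2⟩
    · exact ⟨γ', by simp [hc, hγ'], ht1, ht2⟩

lemma mem_segment_line (hD : D ≠ 0) {a b τ : ℝ} (hab : a < b) :
    q + τ • D ∈ segment ℝ (q + a • D) (q + b • D) ↔ a ≤ τ ∧ τ ≤ b := by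
  rw [mem_segment_iff]
  constructor
  · rintro ⟨r, h0, h1, h⟩
    have h' : (τ - (a + r * (b - a))) • D = 0 := by
      have : (τ - (a + r * (b - a))) • D =
          (q + τ • D) - (q + a • D + r • (q + b • D - (q + a • D))) := by module
      rw [this, h, sub_self]
    have := (smul_eq_zero.1 h').resolve_right hD
    constructor <;> nlinarith
  · rintro ⟨h1, h2⟩
    have hab' : 0 < b - a := by linarith
    refine ⟨(τ - a) / (b - a), div_nonneg (by linarith) hab'.le,
      by rw [div_le_one hab']; linarith, ?_⟩
    have : q + b • D - (q + a • D) = (b - a) • D := by module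
    rw [this, smul_smul, div_mul_cancel₀ _ hab'.ne']; module

lemma mem_openSegment_line {a b : ℝ} (hab : a < b) {x : Pt}
    (hx : x ∈ openSegment ℝ (q + a • D) (q + b • D)) :
    ∃ τ, a < τ ∧ τ < b ∧ x = q + τ • D := by
  obtain ⟨t, h0, h1, rfl⟩ := mem_openSegment_iff.1 hx
  exact ⟨a + t * (b - a), by nlinarith, by nlinarith, by module⟩

lemma Gaps.openSegment_free (h : Gaps W q D Γ) {γ : ℝ × ℝ} (hγ : γ ∈ Γ) :
    openSegment ℝ (q + γ.1 • D) (q + γ.2 • D) ∩ W = ∅ := by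
  ext x
  simp only [Set.mem_inter_iff, Set.mem_empty_iff_false, iff_false, not_and]
  intro hx
  obtain ⟨τ, h1, h2, rfl⟩ := mem_openSegment_line (h.lt γ hγ) hx
  exact h.free γ hγ τ h1 h2

/-- The two ends of the gap `γ` have signs `s` and `s'`. -/
def GapSigns (M : Finset (Pt × Pt)) (w : Bool → Set Pt) (q D : Pt) (γ : ℝ × ℝ) (s s' : Bool) :
    Prop :=
  SignAt M w (q + γ.1 • D) (q + γ.2 • D) s ∧ SignAt M w (q + γ.2 • D) (q + γ.1 • D) s'

lemma GapSigns.mono {w' : Bool → Set Pt} {γ : ℝ × ℝ} {s s' : Bool} (h : GapSigns M w q D γ s s')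
    (hw : w ≤ w') : GapSigns M w' q D γ s s' := ⟨h.1.mono hw, h.2.mono hw⟩

lemma Gaps.exists_signs (hM : PlaneMatching M) (hq : ∀ τ : ℝ, q + τ • D ∉ endpoints M)
    (h : Gaps (walls M w) q D Γ) {γ : ℝ × ℝ} (hγ : γ ∈ Γ) : ∃ s s', GapSigns M w q D γ s s' := by
  obtain ⟨s, hs⟩ := exists_signAt hM (h.ends γ hγ).1 (hq _)
    (by rw [openSegment_symm]; exact h.openSegment_free hγ)
  obtain ⟨s', hs'⟩ := exists_signAt hM (h.ends γ hγ).2 (hq _) (h.openSegment_free hγ)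
  exact ⟨s, s', hs, hs'⟩

/-- A gap whose ends have the same sign can be filled. -/
lemma WallSystem.fill (h : WallSystem M w U) (hM : PlaneMatching M) (hD : D ≠ 0)
    (hq : ∀ τ : ℝ, q + τ • D ∉ endpoints M) (hG : Gaps (walls M w) q D Γ) {γ : ℝ × ℝ}
    (hγ : γ ∈ Γ) {s : Bool} (hs : GapSigns M w q D γ s s) :
    ∃ w', w ≤ w' ∧ WallSystem M w' U ∧ Gaps (walls M w') q D (Γ.erase γ) := by
  refine ⟨_, le_addWall s (q + γ.1 • D) (q + γ.2 • D), ?_, ?_⟩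
  · have := h.insert_wall hM (hG.openSegment_free hγ) (hq _) hs.2 (Or.inl ⟨hq _, hs.1⟩)
    rwa [erase_eq_of_notMem fun hu => hq _ (h.subset hu)] at this
  · rw [walls_addWall]
    have hmem : ∀ τ : ℝ, q + τ • D ∈ segment ℝ (q + γ.1 • D) (q + γ.2 • D) ↔
        γ.1 ≤ τ ∧ τ ≤ γ.2 := fun τ => mem_segment_line hD (hG.lt γ hγ)
    refine ⟨fun γ' hγ' => hG.lt _ (mem_of_mem_erase hγ'), fun γ' hγ' => ?_, ?_, ?_⟩
    · have := hG.ends _ (mem_of_mem_erase hγ')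
      exact ⟨Or.inl this.1, Or.inl this.2⟩
    · intro γ' hγ' τ h1 h2 hτ
      obtain ⟨hne, hγ'⟩ := mem_erase.1 hγ'
      rcases hτ with hτ | hτ
      · exact hG.free γ' hγ' τ h1 h2 hτ
      obtain ⟨h3, h4⟩ := (hmem τ).1 hτ
      rcases eq_or_lt_of_le h3 with rfl | h3
      · exact hG.free γ' hγ' _ h1 h2 (hG.ends γ hγ).1
      rcases eq_or_lt_of_le h4 with rfl | h4
      · exact hG.free γ' hγ' _ h1 h2 (hG.ends γ hγ).2
      exact hne (hG.eq hγ' hγ h1 h2 h3 h4)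
    · intro τ hτ
      obtain ⟨γ', hγ', h1, h2⟩ := hG.cover τ fun h' => hτ (Or.inl h')
      refine ⟨γ', mem_erase.2 ⟨?_, hγ'⟩, h1, h2⟩
      rintro rfl
      exact hτ (Or.inr ((hmem τ).2 ⟨h1.le, h2.le⟩))

/-- All gaps whose ends have the same sign can be filled. -/
theorem WallSystem.fill_all (hM : PlaneMatching M) (hD : D ≠ 0)
    (hq : ∀ τ : ℝ, q + τ • D ∉ endpoints M) (h : WallSystem M w U)
    (hG : Gaps (walls M w) q D Γ) :
    ∃ w' Γ', WallSystem M w' U ∧ Gaps (walls M w') q D Γ' ∧ Γ' ⊆ Γ ∧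
      (∀ γ ∈ Γ', ∃ s, GapSigns M w' q D γ s (!s)) ∧
      ∀ γ ∈ Γ, (∃ s, GapSigns M w q D γ s s) → γ ∉ Γ' := by
  induction hn : Γ.card generalizing w Γ with
  | zero =>
    obtain rfl := card_eq_zero.1 hn
    exact ⟨w, ∅, h, hG, Subset.rfl, by simp, by simp⟩
  | succ n ih =>
    by_cases hex : ∃ γ ∈ Γ, ∃ s, GapSigns M w q D γ s s
    · obtain ⟨γ, hγ, s, hs⟩ := hex
      obtain ⟨w₁, hw₁, h₁, hG₁⟩ := h.fill hM hD hq hG hγ hs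
      obtain ⟨w', Γ', h', hG', hsub, hopp, hsame⟩ :=
        ih h₁ hG₁ (by rw [card_erase_of_mem hγ]; omega)
      refine ⟨w', Γ', h', hG', hsub.trans (erase_subset _ _), hopp, fun γ' hγ' hs' hm => ?_⟩
      obtain ⟨s', hs'⟩ := hs'
      exact hsame γ' (hsub hm) ⟨s', hs'.mono hw₁⟩ hm
    · push Not at hex
      refine ⟨w, Γ, h, hG, Subset.rfl, fun γ hγ => ?_, fun γ hγ ⟨s, hs⟩ => (hex γ hγ s hs).elim⟩
      obtain ⟨s, s', hs⟩ := hG.exists_signs hM hq hγ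
      refine ⟨s, ?_⟩
      rcases Bool.eq_or_eq_not s' s with rfl | rfl
      · exact (hex γ hγ _ hs).elim
      · exact hs

/-- An unextended edge end can be extended up to the next wall. -/
lemma WallSystem.exists_extension (h : WallSystem M w U) (hM : PlaneMatching M) {u : Pt}
    (hu : u ∈ U) :
    ∃ e ∈ M, ∃ u', (u = e.1 ∧ u' = e.2 ∨ u = e.2 ∧ u' = e.1) ∧ ∃ t : ℝ, 0 < t ∧
      openSegment ℝ u (u + t • (u - u')) ∩ walls M w = ∅ ∧ u + t • (u - u') ∉ endpoints M ∧
      ∃ s, SignAt M w (u + t • (u - u')) u s := by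
  obtain ⟨e, he, hue⟩ := mem_endpoints.1 (h.subset hu)
  obtain ⟨u', hu'⟩ : ∃ u', u = e.1 ∧ u' = e.2 ∨ u = e.2 ∧ u' = e.1 := by
    rcases hue with hue | hue
    exacts [⟨e.2, Or.inl ⟨hue, rfl⟩⟩, ⟨e.1, Or.inr ⟨hue, rfl⟩⟩]
  refine ⟨e, he, u', hu', ?_⟩
  have hne : u ≠ u' := by
    rintro rfl
    rcases hu' with ⟨h1, h2⟩ | ⟨h1, h2⟩
    · exact hM.ne e he (h1.symm.trans h2)
    · exact hM.ne e he (h2.symm.trans h1)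
  have hd : u - u' ≠ 0 := sub_ne_zero.2 hne
  have hseg : segment ℝ e.1 e.2 = segment ℝ u u' := by
    rcases hu' with ⟨rfl, rfl⟩ | ⟨rfl, rfl⟩
    exacts [rfl, segment_symm _ _ _]
  have hmem_e : ∀ t : ℝ, 0 < t → u + t • (u - u') ∉ segment ℝ e.1 e.2 := by
    intro t ht hm
    rw [hseg] at hm
    obtain ⟨r, hr, -, hr'⟩ := mem_segment_iff.1 hm
    have h0 : (t + r) • (u - u') = 0 := by
      have : (t + r) • (u - u') = (u + t • (u - u')) - (u + r • (u' - u)) := by module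
      rw [this, hr', sub_self]
    rcases smul_eq_zero.1 h0 with h0 | h0
    · linarith
    · exact hd h0
  have hsplit : ∀ x, x ∈ walls M w → x ∈ segment ℝ e.1 e.2 ∨ x ∈ walls (M.erase e) w := by
    intro x hx
    rcases mem_walls.1 hx with ⟨e', he', hx⟩ | hx
    · by_cases hc : e' = e
      · subst hc; exact Or.inl hx
      · exact Or.inr (mem_walls.2 (Or.inl ⟨e', mem_erase.2 ⟨hc, he'⟩, hx⟩))
    · exact Or.inr (mem_walls.2 (Or.inr hx))
  have huF : u ∉ walls (M.erase e) w := by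
    intro hc
    rcases mem_walls.1 hc with ⟨e', he', hx⟩ | ⟨s, hs⟩
    · obtain ⟨hne', he'⟩ := mem_erase.1 he'
      refine hne' (hM.eq_of_mem e' he' e he u hx ?_)
      rw [hseg]; exact left_mem_segment _ _ _
    · exact h.unextended u hu s hs
  have hFc : IsClosed (walls (M.erase e) w) :=
    (isClosed_edgeUnion _).union ((h.closed true).union (h.closed false))
  have hev : ∀ᶠ t : ℝ in 𝓝 0, u + t • (u - u') ∉ walls (M.erase e) w := by
    have hc : Continuous fun t : ℝ => u + t • (u - u') := by fun_prop
    exact (hFc.isOpen_compl.preimage hc).mem_nhds (by simpa using huF)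
  obtain ⟨ε, hε, H⟩ := Metric.eventually_nhds_iff.1 hev
  have hnear : ∀ t : ℝ, 0 < t → t ≤ ε / 2 → u + t • (u - u') ∉ walls M w := by
    intro t ht hte hm
    rcases hsplit _ hm with hm | hm
    · exact hmem_e t ht hm
    · refine H ?_ hm
      rw [Real.dist_eq, sub_zero, abs_of_pos ht]; linarith
  obtain ⟨t, ht⟩ := h.exists_hit (hnear (ε / 2) (by positivity) le_rfl) hd
  have hv : u + (ε / 2) • (u - u') + t • (u - u') = u + (ε / 2 + t) • (u - u') := by module
  have hT : 0 < ε / 2 + t := by linarith [ht.1]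
  have hfree : openSegment ℝ u (u + (ε / 2 + t) • (u - u')) ∩ walls M w = ∅ := by
    ext x
    simp only [Set.mem_inter_iff, Set.mem_empty_iff_false, iff_false, not_and]
    intro hx
    obtain ⟨r, h0, h1, rfl⟩ := mem_openSegment_iff.1 hx
    rw [add_sub_cancel_left, smul_smul]
    rcases le_total (r * (ε / 2 + t)) (ε / 2) with hr | hr
    · exact hnear _ (by positivity) hr
    · convert ht.2.2 (r * (ε / 2 + t) - ε / 2) (by linarith) (by nlinarith) using 2
      module
  have hP : u + (ε / 2 + t) • (u - u') ∉ endpoints M := by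
    intro hP
    refine hM.ori_ne u (h.subset hu) u' ?_ _ hP hne ?_ ?_ ?_
    · exact mem_endpoints.2 ⟨e, he, by tauto⟩
    · intro hc
      rw [left_eq_add] at hc
      rcases smul_eq_zero.1 hc with hc | hc
      exacts [hT.ne' hc, hd hc]
    · intro hc
      have h0 : (1 + (ε / 2 + t)) • (u - u') = 0 := by
        have : (1 + (ε / 2 + t)) • (u - u') = (u + (ε / 2 + t) • (u - u')) - u' := by module
        rw [this, ← hc, sub_self]
      rcases smul_eq_zero.1 h0 with h0 | h0
      · linarith
      · exact hd h0
    · simp [ori, cross]; ring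
  exact ⟨ε / 2 + t, hT, hfree, hP, exists_signAt hM (by rw [← hv]; exact ht.2.1) hP hfree⟩

/-- Extending an edge end and filling does not increase the number of gaps. -/
lemma WallSystem.extend (h : WallSystem M w U) (hM : PlaneMatching M) (hD : D ≠ 0)
    (hq : ∀ τ : ℝ, q + τ • D ∉ endpoints M) (hqg : ∀ p ∈ endpoints M, cross D (p - q) ≠ 0)
    (hG : Gaps (walls M w) q D Γ) (hopp : ∀ γ ∈ Γ, ∃ s, GapSigns M w q D γ s (!s)) {u : Pt}
    (hu : u ∈ U) :
    ∃ w' Γ', WallSystem M w' (U.erase u) ∧ Gaps (walls M w') q D Γ' ∧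
      (∀ γ ∈ Γ', ∃ s, GapSigns M w' q D γ s (!s)) ∧ Γ'.card ≤ Γ.card := by
  obtain ⟨e, he, u', hu', t, ht, hfree, hv, σ, hσ⟩ := h.exists_extension hM hu
  set v := u + t • (u - u') with hvdef
  have h₁ := h.insert_wall hM hfree hv hσ (Or.inr ⟨hu, e, he, u', hu', t, ht, rfl⟩)
  have hw₁ : walls M (addWall w σ u v) = walls M w ∪ segment ℝ u v := walls_addWall _ _ _
  by_cases hex : ∃ τ : ℝ, q + τ • D ∈ segment ℝ u v ∧ q + τ • D ∉ walls M w
  · obtain ⟨τ, hτ, hτW⟩ := hex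
    have huniq : ∀ τ' : ℝ, q + τ' • D ∈ segment ℝ u v → τ' = τ := by
      intro τ' hτ'
      obtain ⟨r, -, -, hr⟩ := mem_segment_iff.1 hτ
      obtain ⟨r', -, -, hr'⟩ := mem_segment_iff.1 hτ'
      have hg := hqg u (h.subset hu)
      have e1 : cross D (u - q) + r * cross D (v - u) = 0 := by
        have : cross D (u - q) + r * cross D (v - u) = cross D (u + r • (v - u) - q) := by
          simp [cross]; ring
        rw [this, ← hr]; simp [cross]; ring
      have e2 : cross D (u - q) + r' * cross D (v - u) = 0 := by
        have : cross D (u - q) + r' * cross D (v - u) = cross D (u + r' • (v - u) - q) := by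
          simp [cross]; ring
        rw [this, ← hr']; simp [cross]; ring
      have hc : cross D (v - u) ≠ 0 := by
        intro hc; rw [hc] at e1; simp at e1; exact hg e1
      have hrr : r' = r := mul_right_cancel₀ hc (by linarith)
      have h0 : (τ' - τ) • D = 0 := by
        have : (τ' - τ) • D = (q + τ' • D) - (q + τ • D) := by module
        rw [this, hr, hr', hrr, sub_self]
      exact sub_eq_zero.1 ((smul_eq_zero.1 h0).resolve_right hD)
    obtain ⟨γ, hγ, h1, h2⟩ := hG.cover τ hτW
    have hG₁ := hG.split hγ h1 h2 hτ fun τ' h' => Or.inr (huniq τ' h')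
    rw [← hw₁] at hG₁
    obtain ⟨w', Γ', h', hG', hsub, hopp', hsame⟩ := h₁.fill_all hM hD hq hG₁
    refine ⟨w', Γ', h', hG', hopp', ?_⟩
    have hz : ∀ o, SignAt M (addWall w σ u v) (q + τ • D) o σ := fun o =>
      Or.inl ⟨fun hc => hτW (mem_walls.2 (Or.inl hc)), mem_addWall.2 (Or.inr ⟨rfl, hτ⟩)⟩
    obtain ⟨s, hs⟩ := hopp γ hγ
    have hs := hs.mono (le_addWall σ u v)
    have hγ12 := hG.lt γ hγ
    have hcard : (Γ.erase γ).card + 1 = Γ.card := card_erase_add_one hγ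
    rcases Bool.eq_or_eq_not σ s with rfl | hσs
    · have hn : (γ.1, τ) ∉ Γ' := by
        refine hsame _ (by simp) ⟨σ, ?_, hz _⟩
        have := hs.1.lineMap (t := (τ - γ.1) / (γ.2 - γ.1))
          (div_pos (by linarith) (by linarith))
        convert this using 1
        have h3 : q + γ.2 • D - (q + γ.1 • D) = (γ.2 - γ.1) • D := by module
        rw [h3, smul_smul, div_mul_cancel₀ _ (by linarith)]; module
      have : Γ' ⊆ insert (τ, γ.2) (Γ.erase γ) := by
        intro x hx
        rcases mem_insert.1 (hsub hx) with rfl | hx'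
        · exact absurd hx hn
        · exact hx'
      have := card_le_card this
      have := card_insert_le (τ, γ.2) (Γ.erase γ)
      omega
    · have hn : (τ, γ.2) ∉ Γ' := by
        refine hsame _ (by simp) ⟨σ, hz _, ?_⟩
        rw [← hσs] at hs
        have := hs.2.lineMap (t := (γ.2 - τ) / (γ.2 - γ.1))
          (div_pos (by linarith) (by linarith))
        convert this using 1
        have h3 : q + γ.1 • D - (q + γ.2 • D) = -(γ.2 - γ.1) • D := by module
        rw [h3, smul_smul, mul_neg, div_mul_cancel₀ _ (by linarith)]; module
      have : Γ' ⊆ insert (γ.1, τ) (Γ.erase γ) := by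
        intro x hx
        rcases mem_insert.1 (hsub hx) with rfl | hx'
        · simp
        rcases mem_insert.1 hx' with rfl | hx'
        · exact absurd hx hn
        · exact mem_insert_of_mem hx'
      have := card_le_card this
      have := card_insert_le (γ.1, τ) (Γ.erase γ)
      omega
  · push Not at hex
    have hG₁ : Gaps (walls M (addWall w σ u v)) q D Γ := by
      rw [hw₁]
      refine hG.of_subset Set.subset_union_left ?_
      rintro τ (hτ | hτ)
      exacts [hτ, hex τ hτ]
    exact ⟨_, Γ, h₁, hG₁, fun γ hγ => (hopp γ hγ).imp fun s hs => hs.mono (le_addWall _ _ _),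
      le_rfl⟩

/-- All edge ends can be extended without increasing the number of gaps. -/
theorem WallSystem.extend_all (h : WallSystem M w U) (hM : PlaneMatching M) (hD : D ≠ 0)
    (hq : ∀ τ : ℝ, q + τ • D ∉ endpoints M) (hqg : ∀ p ∈ endpoints M, cross D (p - q) ≠ 0)
    (hG : Gaps (walls M w) q D Γ) (hopp : ∀ γ ∈ Γ, ∃ s, GapSigns M w q D γ s (!s)) :
    ∃ w' Γ', WallSystem M w' ∅ ∧ Gaps (walls M w') q D Γ' ∧ Γ'.card ≤ Γ.card := by
  induction hn : U.card generalizing w U Γ with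
  | zero =>
    obtain rfl := card_eq_zero.1 hn
    exact ⟨w, Γ, h, hG, le_rfl⟩
  | succ n ih =>
    obtain ⟨u, hu⟩ := card_pos.1 (by omega : 0 < U.card)
    obtain ⟨w₁, Γ₁, h₁, hG₁, hopp₁, hc₁⟩ := h.extend hM hD hq hqg hG hopp hu
    obtain ⟨w', Γ', h', hG', hc'⟩ := ih h₁ hG₁ hopp₁ (by rw [card_erase_of_mem hu]; omega)
    exact ⟨w', Γ', h', hG', hc'.trans hc₁⟩

end

section

open Topology Filter

variable {M : Finset (Pt × Pt)} {w : Bool → Set Pt} {U : Finset Pt}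
variable {W : Set Pt} {q D : Pt} {Γ : Finset (ℝ × ℝ)}

/-- The pairs of consecutive elements of `Y`. -/
noncomputable def consecutive (Y : Finset ℝ) : Finset (ℝ × ℝ) :=
  (Y ×ˢ Y).filter fun γ => γ.1 < γ.2 ∧ ∀ y ∈ Y, ¬(γ.1 < y ∧ y < γ.2)

lemma mem_consecutive {Y : Finset ℝ} {γ : ℝ × ℝ} : γ ∈ consecutive Y ↔
    γ.1 ∈ Y ∧ γ.2 ∈ Y ∧ γ.1 < γ.2 ∧ ∀ y ∈ Y, ¬(γ.1 < y ∧ y < γ.2) := by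
  simp only [consecutive, mem_filter, mem_product, and_assoc]

lemma exists_consecutive {Y : Finset ℝ} {a b τ : ℝ} (ha : a ∈ Y) (hb : b ∈ Y) (haτ : a < τ)
    (hτb : τ < b) (hτ : τ ∉ Y) : ∃ γ ∈ consecutive Y, γ.1 < τ ∧ τ < γ.2 := by
  obtain ⟨x, hx, hxm⟩ := (Y.filter (· < τ)).exists_max_image id ⟨a, mem_filter.2 ⟨ha, haτ⟩⟩
  obtain ⟨y, hy, hym⟩ := (Y.filter (τ < ·)).exists_min_image id ⟨b, mem_filter.2 ⟨hb, hτb⟩⟩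
  rw [mem_filter] at hx hy
  refine ⟨(x, y), mem_consecutive.2 ⟨hx.1, hy.1, hx.2.trans hy.2, fun z hz hxz => ?_⟩, hx.2, hy.2⟩
  rcases lt_trichotomy z τ with h | rfl | h
  · exact not_lt.2 (hxm z (mem_filter.2 ⟨hz, h⟩)) hxz.1
  · exact hτ hz
  · exact not_lt.2 (hym z (mem_filter.2 ⟨hz, h⟩)) hxz.2

/-- A sequence of types whose first and last entries are chosen suitably has at least three
changes. -/
lemma card_consecutive_filter_eq {X : Finset ℝ} {lo hi m : ℝ} {ty : ℝ → Bool} (hm : m ∈ X)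
    (hmin : ∀ x ∈ X, m ≤ x) (hlo : ∀ x ∈ X, lo < x) (hhi : ∀ x ∈ X, x < hi)
    (htlo : ty lo = !ty m) (hthi : ty hi = ty m) (hex : ∃ x ∈ X, ty x = !ty m) :
    ((consecutive (insert lo (insert hi X))).filter fun γ => ty γ.1 = ty γ.2).card + 2 ≤
      X.card := by
  obtain ⟨y₂, hy₂, hmax₂⟩ := (X.filter fun x => ty x = !ty m).exists_max_image id
    (hex.imp fun x hx => mem_filter.2 hx)
  rw [mem_filter] at hy₂
  have hmy : m < y₂ := lt_of_le_of_ne (hmin _ hy₂.1) fun h => by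
    have := hy₂.2; rw [← h] at this; simp at this
  obtain ⟨y₁, hy₁, hmax₁⟩ := (X.filter fun x => ty x = ty m ∧ x < y₂).exists_max_image id
    ⟨m, mem_filter.2 ⟨hm, rfl, hmy⟩⟩
  rw [mem_filter] at hy₁
  have hcard : ((X.erase y₂).erase y₁).card + 2 = X.card := by
    have h1 := card_erase_add_one hy₂.1
    have h2 := card_erase_add_one (mem_erase.2 ⟨hy₁.2.2.ne, hy₁.1⟩)
    omega
  rw [← hcard, add_le_add_iff_right]
  refine card_le_card_of_injOn Prod.fst ?_ ?_
  · intro γ hγ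
    obtain ⟨hγ, hty⟩ := mem_filter.1 hγ
    obtain ⟨h1, h2, hlt, hno⟩ := mem_consecutive.1 hγ
    simp only [mem_insert] at h1 h2
    have hX2 : γ.2 = hi ∨ γ.2 ∈ X := by
      rcases h2 with h2 | h2 | h2
      · rcases h1 with h1 | h1 | h1
        · linarith
        · linarith [hlo m hm, hhi m hm]
        · linarith [hlo _ h1]
      · exact Or.inl h2
      · exact Or.inr h2
    have hX1 : γ.1 = lo ∨ γ.1 ∈ X := by
      rcases h1 with h1 | h1 | h1
      · exact Or.inl h1
      · rcases hX2 with h2 | h2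
        · linarith
        · linarith [hhi _ h2]
      · exact Or.inr h1
    have hne_lo : γ.1 ≠ lo := by
      intro hc
      have h2m : γ.2 = m := by
        rcases hX2 with h2 | h2
        · exact absurd ⟨hc ▸ hlo m hm, h2 ▸ hhi m hm⟩ (hno m (by simp [hm]))
        · refine le_antisymm (not_lt.1 fun h => ?_) (hmin _ h2)
          exact hno m (by simp [hm]) ⟨hc ▸ hlo m hm, h⟩
      rw [hc, h2m, htlo] at hty
      simp at hty
    have hne_y₂ : γ.1 ≠ y₂ := by
      intro hc
      rcases hX2 with h2 | h2
      · rw [hc, h2, hthi, hy₂.2] at hty; simp at hty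
      · rw [hc, hy₂.2] at hty
        have := hmax₂ γ.2 (mem_filter.2 ⟨h2, hty.symm⟩)
        simp only [id] at this
        linarith
    have hne_y₁ : γ.1 ≠ y₁ := by
      intro hc
      have hle : γ.2 ≤ y₂ :=
        not_lt.1 fun h => hno y₂ (by simp [hy₂.1]) ⟨hc ▸ hy₁.2.2, h⟩
      rw [hc, hy₁.2.1] at hty
      have hne : γ.2 ≠ y₂ := by
        intro h
        rw [h, hy₂.2] at hty; simp at hty
      rcases hX2 with h2 | h2
      · linarith [hhi _ hy₂.1]
      · have := hmax₁ γ.2 (mem_filter.2 ⟨h2, hty.symm, lt_of_le_of_ne hle hne⟩)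
        simp only [id] at this
        linarith
    exact mem_erase.2 ⟨hne_y₁, mem_erase.2 ⟨hne_y₂, hX1.resolve_left hne_lo⟩⟩
  · intro γ hγ γ' hγ' h
    obtain ⟨-, h2, h3, h4⟩ := mem_consecutive.1 (mem_filter.1 hγ).1
    obtain ⟨-, h2', h3', h4'⟩ := mem_consecutive.1 (mem_filter.1 hγ').1
    refine Prod.ext h (le_antisymm (not_lt.1 fun hl => ?_) (not_lt.1 fun hl => ?_))
    · exact h4 _ h2' ⟨h ▸ h3', hl⟩
    · exact h4' _ h2 ⟨h ▸ h3, hl⟩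

/-- The scalar product. -/
def scal (u v : Pt) : ℝ := u.1 * v.1 + u.2 * v.2

lemma scal_self_pos {u : Pt} (hu : u ≠ 0) : 0 < scal u u := by
  unfold scal
  by_contra h
  have h1 : u.1 = 0 := by nlinarith [sq_nonneg u.1, sq_nonneg u.2]
  have h2 : u.2 = 0 := by nlinarith [sq_nonneg u.1, sq_nonneg u.2]
  exact hu (Prod.ext h1 h2)

/-- The complement of the open square with center `q`, side direction `D` and size `K`. -/
def outside (q D : Pt) (K : ℝ) : Set Pt := {x | K ≤ |cross D (x - q)| ∨ K ≤ |scal D (x - q)|}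

lemma isClosed_outside (K : ℝ) : IsClosed (outside q D K) := by
  have h1 : Continuous fun x : Pt => |cross D (x - q)| := by unfold cross; fun_prop
  have h2 : Continuous fun x : Pt => |scal D (x - q)| := by unfold scal; fun_prop
  exact (isClosed_le continuous_const h1).union (isClosed_le continuous_const h2)

lemma noEnd_outside (hD : D ≠ 0) {K : ℝ} {x : Pt} (hx : x ∈ outside q D K) :
    NoEnd (outside q D K) x := by
  rcases hx with hx | hx
  · refine ⟨D, hD, fun t _ => Or.inl ?_⟩
    have : cross D (x + t • D - q) = cross D (x - q) := by simp [cross]; ring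
    rwa [this]
  · refine ⟨(-D.2, D.1), fun h => hD ?_, fun t _ => Or.inr ?_⟩
    · simp only [Prod.mk_eq_zero, neg_eq_zero] at h
      exact Prod.ext h.2 h.1
    · have : scal D (x + t • (-D.2, D.1) - q) = scal D (x - q) := by simp [scal]; ring
      rwa [this]

lemma notMem_outside_of_mem_segment {K : ℝ} {x y z : Pt} (hx : x ∉ outside q D K)
    (hy : y ∉ outside q D K) (hz : z ∈ segment ℝ x y) : z ∉ outside q D K := by
  obtain ⟨t, h0, h1, rfl⟩ := mem_segment_iff.1 hz
  simp only [outside, Set.mem_ofPred_eq, not_or, not_le, abs_lt] at hx hy ⊢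
  have e1 : cross D (x + t • (y - x) - q) =
      (1 - t) * cross D (x - q) + t * cross D (y - q) := by simp [cross]; ring
  have e2 : scal D (x + t • (y - x) - q) =
      (1 - t) * scal D (x - q) + t * scal D (y - q) := by simp [scal]; ring
  rw [e1, e2]
  obtain ⟨⟨hx1, hx2⟩, hx3, hx4⟩ := hx
  obtain ⟨⟨hy1, hy2⟩, hy3, hy4⟩ := hy
  have key : ∀ a b k : ℝ, a < k → b < k → (1 - t) * a + t * b < k := by
    intro a b k ha hb
    rcases eq_or_lt_of_le h0 with rfl | h0
    · simpa
    · nlinarith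
  have key' : ∀ a b k : ℝ, -k < a → -k < b → -k < (1 - t) * a + t * b := by
    intro a b k ha hb
    have := key (-a) (-b) k (by linarith) (by linarith)
    linarith
  exact ⟨⟨key' _ _ _ hx1 hy1, key _ _ _ hx2 hy2⟩, key' _ _ _ hx3 hy3, key _ _ _ hx4 hy4⟩

lemma exists_mem_outside_of_le_norm (hD : D ≠ 0) (K : ℝ) :
    ∃ K', ∀ x : Pt, K' ≤ ‖x‖ → x ∈ outside q D K := by
  have hN := scal_self_pos hD
  set c := (K * |D.1| + K * |D.2|) / scal D D with hc
  refine ⟨‖q‖ + c + 1, fun x hx => ?_⟩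
  by_contra hcon
  simp only [outside, Set.mem_ofPred_eq, not_or, not_le] at hcon
  obtain ⟨h1, h2⟩ := hcon
  have k1 : |(x - q).1| ≤ c := by
    rw [hc, le_div_iff₀ hN, ← abs_of_pos hN, ← abs_mul]
    have : (x - q).1 * scal D D = scal D (x - q) * D.1 - cross D (x - q) * D.2 := by
      simp [scal, cross]; ring
    rw [this]
    refine (abs_sub _ _).trans ?_
    rw [abs_mul, abs_mul]
    gcongr
  have k2 : |(x - q).2| ≤ c := by
    rw [hc, le_div_iff₀ hN, ← abs_of_pos hN, ← abs_mul]
    have : (x - q).2 * scal D D = scal D (x - q) * D.2 + cross D (x - q) * D.1 := by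
      simp [scal, cross]; ring
    rw [this]
    refine (abs_add_le _ _).trans ?_
    rw [abs_mul, abs_mul, add_comm]
    gcongr
  have k3 : ‖x - q‖ ≤ c := by
    rw [Prod.norm_def]; exact max_le k1 k2
  have := norm_le_norm_add_norm_sub' x q
  linarith

/-- The walls of sign `s` are the outside of a large square, and there are no others. -/
def squareWall (q D : Pt) (K : ℝ) (s : Bool) : Bool → Set Pt :=
  fun s' => if s' = s then outside q D K else ∅

lemma mem_squareWall {K : ℝ} {s s' : Bool} {x : Pt} :
    x ∈ squareWall q D K s s' ↔ s' = s ∧ x ∈ outside q D K := by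
  unfold squareWall; split_ifs with h <;> simp [h]

lemma mem_walls_squareWall {K : ℝ} {s : Bool} {x : Pt} :
    x ∈ walls M (squareWall q D K s) ↔ x ∈ edgeUnion M ∨ x ∈ outside q D K := by
  simp [mem_walls, mem_squareWall]

lemma edgeUnion_notMem_outside {K : ℝ} (hK : ∀ p ∈ endpoints M, p ∉ outside q D K) {x : Pt}
    (hx : x ∈ edgeUnion M) : x ∉ outside q D K := by
  obtain ⟨e, he, hx⟩ := hx
  exact notMem_outside_of_mem_segment (hK _ (mem_endpoints.2 ⟨e, he, Or.inl rfl⟩))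
    (hK _ (mem_endpoints.2 ⟨e, he, Or.inr rfl⟩)) hx

lemma wallSystem_squareWall (hM : PlaneMatching M) (hD : D ≠ 0) {K : ℝ}
    (hK : ∀ p ∈ endpoints M, p ∉ outside q D K) (s : Bool) :
    WallSystem M (squareWall q D K s) (endpoints M) := by
  refine ⟨Subset.rfl, fun s' => ?_, fun x hx hxU => ?_, fun s' x hx hx' => ?_,
    fun e he x hx s' => ?_, fun x hx s' hs => ?_,
    fun e he x hx hxU => absurd (mem_endpoints.2 ⟨e, he, hx⟩) hxU, ?_⟩
  · unfold squareWall
    split_ifs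
    exacts [isClosed_outside _, isClosed_empty]
  · rcases mem_walls_squareWall.1 hx with ⟨e, he, hx⟩ | hx
    · refine noEnd_of_mem_openSegment (hM.ne e he) (mem_openSegment_of_mem hx ?_ ?_) ?_
      · exact fun h => hxU (mem_endpoints.2 ⟨e, he, Or.inl h⟩)
      · exact fun h => hxU (mem_endpoints.2 ⟨e, he, Or.inr h⟩)
      · exact fun y hy => mem_walls_squareWall.2 (Or.inl ⟨e, he, hy⟩)
    · exact (noEnd_outside hD hx).mono fun y hy => mem_walls_squareWall.2 (Or.inr hy)
  · have h1 := (mem_squareWall.1 hx).1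
    have h2 := (mem_squareWall.1 hx').1
    rw [h1] at h2; simp at h2
  · have := edgeUnion_notMem_outside hK ⟨e, he, openSegment_subset_segment ℝ _ _ hx⟩
    filter_upwards [(isClosed_outside K).isOpen_compl.mem_nhds this] with y hy hyw
    exact absurd (mem_squareWall.1 hyw).2 hy
  · exact hK x hx (mem_squareWall.1 hs).2
  · obtain ⟨K', hK'⟩ := exists_mem_outside_of_le_norm (q := q) hD K
    exact ⟨K', fun x hx => mem_walls_squareWall.2 (Or.inr (hK' x hx))⟩

lemma cross_line (τ : ℝ) : cross D (q + τ • D - q) = 0 := by simp [cross]; ring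

lemma scal_line (τ : ℝ) : scal D (q + τ • D - q) = τ * scal D D := by simp [scal]; ring

lemma exists_line_mem_openSegment (hD : D ≠ 0) {x y : Pt}
    (h : cross D (x - q) * cross D (y - q) < 0) :
    ∃ τ : ℝ, q + τ • D ∈ openSegment ℝ x y := by
  set a := cross D (x - q)
  set b := cross D (y - q)
  have hab : a - b ≠ 0 := by
    intro h0
    have : a = b := by linarith
    rw [this] at h; nlinarith [mul_self_nonneg b]
  have hr : 0 < a / (a - b) ∧ a / (a - b) < 1 := by
    rcases lt_or_gt_of_ne hab with h0 | h0
    · have : a < 0 := by nlinarith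
      have hb : 0 < b := by nlinarith
      exact ⟨div_pos_of_neg_of_neg this h0, by rw [div_lt_one_of_neg h0]; linarith⟩
    · have : 0 < a := by nlinarith
      have hb : b < 0 := by nlinarith
      exact ⟨div_pos this h0, by rw [div_lt_one h0]; linarith⟩
  have h0 : cross D (x + (a / (a - b)) • (y - x) - q) = 0 := by
    have : cross D (x + (a / (a - b)) • (y - x) - q) = a + a / (a - b) * (b - a) := by
      simp [a, b, cross]; ring
    rw [this]; field_simp; ring
  obtain ⟨k, hk⟩ := exists_smul_of_cross_eq_zero hD h0
  refine ⟨k, mem_openSegment_iff.2 ⟨_, hr.1, hr.2, ?_⟩⟩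
  rw [← hk]; abel

lemma cross_mul_neg_of_line_mem_segment {x y : Pt} {τ : ℝ} (hx : cross D (x - q) ≠ 0)
    (hy : cross D (y - q) ≠ 0) (h : q + τ • D ∈ segment ℝ x y) :
    cross D (x - q) * cross D (y - q) < 0 := by
  obtain ⟨t, h0, h1, ht⟩ := mem_segment_iff.1 h
  have e := cross_line (q := q) (D := D) τ
  rw [ht] at e
  have e1 : cross D (x + t • (y - x) - q) =
      (1 - t) * cross D (x - q) + t * cross D (y - q) := by simp [cross]; ring
  rw [e1] at e
  by_contra hcon
  push Not at hcon
  have hpos := lt_of_le_of_ne hcon (mul_ne_zero hx hy).symm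
  have h2 : (1 - t) * (cross D (x - q) * cross D (x - q)) +
      t * (cross D (x - q) * cross D (y - q)) = 0 := by linear_combination cross D (x - q) * e
  have h3 : 0 < cross D (x - q) * cross D (x - q) := mul_self_pos.2 hx
  rcases eq_or_lt_of_le h0 with rfl | h0
  · linarith
  · nlinarith [mul_pos h0 hpos, mul_nonneg (sub_nonneg.2 h1) h3.le]

lemma ori_line {x y : Pt} {τ : ℝ} (h : q + τ • D ∈ segment ℝ x y) (τ' : ℝ) :
    ori x y (q + τ' • D) = (τ' - τ) * (cross D (x - q) - cross D (y - q)) := by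
  have h0 := ori_eq_zero_of_mem_segment h
  have : ori x y (q + τ' • D) =
      ori x y (q + τ • D) + (τ' - τ) * (cross D (x - q) - cross D (y - q)) := by
    simp [ori, cross]; ring
  rw [this, h0, zero_add]

/-- If `M` has edges crossing the line in both directions, then there is a complete wall system
with few gaps on the line. -/
theorem exists_wallSystem (hM : PlaneMatching M) (hD : D ≠ 0)
    (hqg : ∀ p ∈ endpoints M, cross D (p - q) ≠ 0)
    (hpos : ∃ e ∈ M, 0 < cross D (e.1 - q) ∧ cross D (e.2 - q) < 0)
    (hneg : ∃ e ∈ M, cross D (e.1 - q) < 0 ∧ 0 < cross D (e.2 - q)) :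
    ∃ w Γ, WallSystem M w ∅ ∧ Gaps (walls M w) q D Γ ∧
      Γ.card + 2 ≤ (M.filter fun e => cross D (e.1 - q) * cross D (e.2 - q) < 0).card := by
  have hq : ∀ τ : ℝ, q + τ • D ∉ endpoints M := fun τ h => hqg _ h (cross_line τ)
  have hN := scal_self_pos hD
  set C := M.filter fun e => cross D (e.1 - q) * cross D (e.2 - q) < 0 with hC
  have hex : ∀ e ∈ C, ∃ τ : ℝ, q + τ • D ∈ segment ℝ e.1 e.2 := fun e he =>
    (exists_line_mem_openSegment hD (mem_filter.1 he).2).imp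
      fun τ h => openSegment_subset_segment ℝ _ _ h
  choose! ξ hξ using hex
  have he1 : ∀ e ∈ M, e.1 ∈ endpoints M := fun e he => mem_endpoints.2 ⟨e, he, Or.inl rfl⟩
  have he2 : ∀ e ∈ M, e.2 ∈ endpoints M := fun e he => mem_endpoints.2 ⟨e, he, Or.inr rfl⟩
  have hinC : ∀ e ∈ M, ∀ τ : ℝ, q + τ • D ∈ segment ℝ e.1 e.2 → e ∈ C := fun e he τ h =>
    mem_filter.2 ⟨he, cross_mul_neg_of_line_mem_segment (hqg _ (he1 e he)) (hqg _ (he2 e he)) h⟩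
  have hdiff : ∀ e ∈ C, cross D (e.1 - q) - cross D (e.2 - q) ≠ 0 := by
    intro e he h0
    have := (mem_filter.1 he).2
    have h1 : cross D (e.1 - q) = cross D (e.2 - q) := by linarith
    rw [h1] at this; nlinarith [mul_self_nonneg (cross D (e.2 - q))]
  have huniq : ∀ e ∈ M, ∀ τ : ℝ, q + τ • D ∈ segment ℝ e.1 e.2 → τ = ξ e := by
    intro e he τ h
    have heC := hinC e he τ h
    have h1 := ori_line h (ξ e)
    rw [ori_eq_zero_of_mem_segment (hξ e heC)] at h1
    rcases mul_eq_zero.1 h1.symm with h2 | h2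
    · linarith
    · exact absurd h2 (hdiff e heC)
  obtain ⟨K₀, hK₀⟩ : ∃ K, ∀ p ∈ endpoints M, |cross D (p - q)| + |scal D (p - q)| < K := by
    obtain ⟨K, hK⟩ := ((endpoints M).image fun p =>
      |cross D (p - q)| + |scal D (p - q)|).exists_le
    exact ⟨K + 1, fun p hp => by linarith [hK _ (mem_image_of_mem _ hp)]⟩
  obtain ⟨e₀, he₀, hpos₀⟩ := hpos
  obtain ⟨e₁, he₁, hneg₁⟩ := hneg
  have hK0 : 0 < K₀ := lt_of_le_of_lt (by positivity) (hK₀ _ (he1 _ he₀))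
  have hK : ∀ p ∈ endpoints M, p ∉ outside q D K₀ := by
    intro p hp hc
    have := hK₀ p hp
    rcases hc with hc | hc
    · linarith [abs_nonneg (scal D (p - q))]
    · linarith [abs_nonneg (cross D (p - q))]
  set T := K₀ / scal D D with hT
  have hT0 : 0 < T := div_pos hK0 hN
  have hout : ∀ τ : ℝ, q + τ • D ∈ outside q D K₀ ↔ T ≤ |τ| := by
    intro τ
    simp only [outside, Set.mem_ofPred_eq, cross_line, scal_line, abs_zero, abs_mul]
    rw [abs_of_pos hN, hT, div_le_iff₀ hN]
    exact or_iff_right (not_le.2 hK0)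
  set X := C.image ξ with hX
  have hXE : ∀ τ : ℝ, τ ∈ X ↔ ∃ e ∈ M, q + τ • D ∈ segment ℝ e.1 e.2 := by
    intro τ
    rw [hX, mem_image]
    constructor
    · rintro ⟨e, he, rfl⟩
      exact ⟨e, (mem_filter.1 he).1, hξ e he⟩
    · rintro ⟨e, he, h⟩
      exact ⟨e, hinC e he τ h, (huniq e he τ h).symm⟩
  have hXT : ∀ τ ∈ X, |τ| < T := by
    intro τ hτ
    have := edgeUnion_notMem_outside hK ((hXE τ).1 hτ)
    rw [hout] at this
    exact not_le.1 this
  have he₀C : e₀ ∈ C := mem_filter.2 ⟨he₀, mul_neg_of_pos_of_neg hpos₀.1 hpos₀.2⟩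
  have he₁C : e₁ ∈ C := mem_filter.2 ⟨he₁, mul_neg_of_neg_of_pos hneg₁.1 hneg₁.2⟩
  let ty₀ : ℝ → Bool := fun τ => decide (∃ e ∈ M, q + τ • D ∈ segment ℝ e.1 e.2 ∧
    0 < cross D (e.1 - q))
  have hty₀ : ∀ e ∈ C, ty₀ (ξ e) = decide (0 < cross D (e.1 - q)) := by
    intro e he
    simp only [ty₀, decide_eq_decide]
    constructor
    · rintro ⟨e', he', h1, h2⟩
      rwa [hM.eq_of_mem e (mem_filter.1 he).1 e' he' _ (hξ e he) h1]
    · exact fun h => ⟨e, (mem_filter.1 he).1, hξ e he, h⟩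
  obtain ⟨m, hm, hmin⟩ := X.exists_min_image id ⟨ξ e₀, mem_image_of_mem _ he₀C⟩
  let ty : ℝ → Bool := fun τ => if τ = -T then !ty₀ m else if τ = T then ty₀ m else ty₀ τ
  have htX : ∀ τ ∈ X, ty τ = ty₀ τ := by
    intro τ hτ
    have := abs_lt.1 (hXT τ hτ)
    simp only [ty]
    rw [if_neg (by linarith), if_neg (by linarith)]
  have htlo : ty (-T) = !ty₀ m := by simp [ty]
  have hthi : ty T = ty₀ m := by
    simp only [ty]
    rw [if_neg (by linarith), if_pos trivial]
  have hcount := card_consecutive_filter_eq (ty := ty) hm hmin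
    (fun x hx => (abs_lt.1 (hXT x hx)).1) (fun x hx => (abs_lt.1 (hXT x hx)).2)
    (by rw [htlo, htX m hm]) (by rw [hthi, htX m hm]) (by
      rcases h : ty₀ m
      · refine ⟨ξ e₀, mem_image_of_mem _ he₀C, ?_⟩
        rw [htX _ (mem_image_of_mem _ he₀C), htX m hm, h, hty₀ e₀ he₀C]
        simp [hpos₀.1]
      · refine ⟨ξ e₁, mem_image_of_mem _ he₁C, ?_⟩
        rw [htX _ (mem_image_of_mem _ he₁C), htX m hm, h, hty₀ e₁ he₁C]
        simp [hneg₁.1.le])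
  set Y := insert (-T) (insert T X) with hY
  set w₀ := squareWall q D K₀ (!ty₀ m) with hw₀
  have h₀ := wallSystem_squareWall hM hD hK (!ty₀ m)
  rw [← hw₀] at h₀
  have hmemW : ∀ τ : ℝ, q + τ • D ∈ walls M w₀ ↔ τ ∈ X ∨ T ≤ |τ| := by
    intro τ
    rw [mem_walls_squareWall, hout, hXE]; rfl
  have hYW : ∀ τ ∈ Y, q + τ • D ∈ walls M w₀ := by
    intro τ hτ
    rw [hmemW]
    simp only [hY, mem_insert] at hτ
    rcases hτ with rfl | rfl | hτ
    · right; rw [abs_neg]; exact le_abs_self _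
    · right; exact le_abs_self _
    · exact Or.inl hτ
  have hYle : ∀ τ ∈ Y, |τ| ≤ T := by
    intro τ hτ
    simp only [hY, mem_insert] at hτ
    rcases hτ with rfl | rfl | hτ
    · rw [abs_neg, abs_of_pos hT0]
    · rw [abs_of_pos hT0]
    · exact (hXT τ hτ).le
  have hG₀ : Gaps (walls M w₀) q D (consecutive Y) := by
    refine ⟨fun γ hγ => (mem_consecutive.1 hγ).2.2.1, fun γ hγ => ?_, fun γ hγ τ h1 h2 h3 => ?_,
      fun τ hτ => ?_⟩
    · obtain ⟨h1, h2, -⟩ := mem_consecutive.1 hγ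
      exact ⟨hYW _ h1, hYW _ h2⟩
    · obtain ⟨h4, h5, -, h6⟩ := mem_consecutive.1 hγ
      rcases (hmemW τ).1 h3 with h | h
      · exact h6 τ (by simp [hY, h]) ⟨h1, h2⟩
      · have := abs_le.1 (hYle _ h4)
        have := abs_le.1 (hYle _ h5)
        exact absurd h (not_le.2 (abs_lt.2 ⟨by linarith, by linarith⟩))
    · rw [hmemW] at hτ
      push Not at hτ
      obtain ⟨h1, h2⟩ := abs_lt.1 hτ.2
      refine exists_consecutive (a := -T) (b := T) (by simp [hY]) (by simp [hY]) h1 h2 ?_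
      simp only [hY, mem_insert]
      rintro (h | h | h)
      exacts [by linarith, by linarith, hτ.1 h]
  have hsgn : ∀ τ ∈ X, ∀ τ' : ℝ, (τ < τ' → SignAt M w₀ (q + τ • D) (q + τ' • D) (ty τ)) ∧
      (τ' < τ → SignAt M w₀ (q + τ • D) (q + τ' • D) (!ty τ)) := by
    intro τ hτ τ'
    rw [htX τ hτ]
    obtain ⟨e, he, rfl⟩ := mem_image.1 hτ
    have heM := (mem_filter.1 he).1
    have hprod := (mem_filter.1 he).2
    rw [hty₀ e he]
    have ho := ori_line (hξ e he) τ'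
    constructor
    · intro hl
      refine Or.inr ⟨e, heM, hξ e he, ?_⟩
      rw [ho]
      by_cases h0 : 0 < cross D (e.1 - q)
      · have : cross D (e.2 - q) < 0 := by nlinarith
        simp only [turn, h0, decide_true, if_true, one_mul]
        exact mul_pos (by linarith) (by linarith)
      · have h0' := lt_of_le_of_ne (not_lt.1 h0) (hqg _ (he1 e heM))
        have : 0 < cross D (e.2 - q) := by nlinarith
        simp only [turn, h0, decide_false, Bool.false_eq_true, if_false]
        nlinarith
    · intro hl
      refine Or.inr ⟨e, heM, hξ e he, ?_⟩
      rw [ho]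
      by_cases h0 : 0 < cross D (e.1 - q)
      · have : cross D (e.2 - q) < 0 := by nlinarith
        simp only [turn, h0, decide_true, Bool.not_true, Bool.false_eq_true, if_false]
        nlinarith
      · have h0' := lt_of_le_of_ne (not_lt.1 h0) (hqg _ (he1 e heM))
        have : 0 < cross D (e.2 - q) := by nlinarith
        simp only [turn, h0, decide_false, Bool.not_false, if_true, one_mul]
        exact mul_pos_of_neg_of_neg (by linarith) (by linarith)
  have hend : ∀ τ o, T ≤ |τ| → SignAt M w₀ (q + τ • D) o (!ty₀ m) := by
    intro τ o h
    have hmo := (hout τ).2 h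
    exact Or.inl ⟨fun hc => edgeUnion_notMem_outside hK hc hmo, mem_squareWall.2 ⟨rfl, hmo⟩⟩
  have hsame : ∀ γ ∈ consecutive Y, ty γ.1 ≠ ty γ.2 → GapSigns M w₀ q D γ (ty γ.1) (ty γ.1) := by
    intro γ hγ hne
    obtain ⟨h1, h2, hlt, -⟩ := mem_consecutive.1 hγ
    have hne' : ty γ.1 = !ty γ.2 := Bool.eq_not_of_ne hne
    have a1 := abs_le.1 (hYle _ h1)
    have a2 := abs_le.1 (hYle _ h2)
    simp only [hY, mem_insert] at h1 h2
    constructor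
    · rcases h1 with h1 | h1 | h1
      · rw [h1, htlo]
        exact hend _ _ (by rw [abs_neg]; exact le_abs_self _)
      · linarith
      · exact (hsgn _ h1 _).1 hlt
    · rw [hne']
      rcases h2 with h2 | h2 | h2
      · linarith
      · rw [h2, hthi]
        exact hend _ _ (le_abs_self _)
      · exact (hsgn _ h2 _).2 hlt
  obtain ⟨w₁, Γ₁, h₁, hG₁, hsub, hopp, hdrop⟩ := h₀.fill_all hM hD hq hG₀
  obtain ⟨w₂, Γ₂, h₂, hG₂, hle⟩ := h₁.extend_all hM hD hq hqg hG₁ hopp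
  refine ⟨w₂, Γ₂, h₂, hG₂, ?_⟩
  have hsub' : Γ₁ ⊆ (consecutive Y).filter fun γ => ty γ.1 = ty γ.2 := by
    intro γ hγ
    refine mem_filter.2 ⟨hsub hγ, ?_⟩
    by_contra hne
    exact hdrop γ (hsub hγ) ⟨_, hsame γ (hsub hγ) hne⟩ hγ
  have h1 := card_le_card hsub'
  have h2 : X.card ≤ C.card := card_image_le
  omega

end

section

open Topology Filter

variable {M : Finset (Pt × Pt)} {w : Bool → Set Pt} {U : Finset Pt} {o d : Pt} {s s' : Bool}
  {i j : (Pt × Pt) × Bool} {α : (Pt × Pt) × Bool → Bool}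

lemma SignAt.unique (hM : PlaneMatching M) (h : WallSystem M w U) {x : Pt}
    (hs : SignAt M w x o s) (hs' : SignAt M w x o s') : s = s' := by
  rcases hs with ⟨hx, hs⟩ | ⟨e, he, hx, hs⟩ <;> rcases hs' with ⟨hx', hs'⟩ | ⟨e', he', hx', hs'⟩
  · by_contra hne
    obtain rfl : s' = !s := by cases s <;> cases s' <;> simp_all
    exact hx (h.sep s x hs hs')
  · exact absurd ⟨e', he', hx'⟩ hx
  · exact absurd ⟨e, he, hx⟩ hx'
  · obtain rfl := hM.eq_of_mem e he e' he' x hx hx'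
    cases s <;> cases s' <;> simp_all [turn] <;> linarith

/-- The first endpoint of the edge `i.1` if `i.2 = true`, and the second one otherwise. -/
def endpt (i : (Pt × Pt) × Bool) : Pt := if i.2 then i.1.1 else i.1.2

/-- The vector from `endpt i` to the other endpoint of the edge `i.1`. -/
def inward (i : (Pt × Pt) × Bool) : Pt := turn i.2 • (i.1.2 - i.1.1)

lemma endpt_eq_or (i : (Pt × Pt) × Bool) : endpt i = i.1.1 ∨ endpt i = i.1.2 := by
  unfold endpt; split_ifs <;> simp

lemma endpt_mem_segment (i : (Pt × Pt) × Bool) : endpt i ∈ segment ℝ i.1.1 i.1.2 := by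
  rcases endpt_eq_or i with h | h <;> rw [h]
  exacts [left_mem_segment _ _ _, right_mem_segment _ _ _]

lemma endpt_mem_endpoints (hi : i.1 ∈ M) : endpt i ∈ endpoints M :=
  mem_endpoints.2 ⟨i.1, hi, endpt_eq_or i⟩

lemma exists_endpt_eq {x : Pt} (hx : x ∈ endpoints M) :
    ∃ i : (Pt × Pt) × Bool, i.1 ∈ M ∧ x = endpt i := by
  obtain ⟨e, he, rfl | rfl⟩ := mem_endpoints.1 hx
  exacts [⟨(e, true), he, rfl⟩, ⟨(e, false), he, rfl⟩]

lemma endpt_injective (hM : PlaneMatching M) (hi : i.1 ∈ M) (hj : j.1 ∈ M)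
    (h : endpt i = endpt j) : i = j := by
  obtain ⟨e, k⟩ := i
  obtain ⟨e', k'⟩ := j
  obtain rfl : e = e' := hM.eq_of_mem e hi e' hj _ (endpt_mem_segment (e, k))
    (h ▸ endpt_mem_segment (e', k'))
  have := hM.ne e hi
  cases k <;> cases k' <;> simp_all [endpt]

lemma turn_sq (s : Bool) : turn s * turn s = 1 := by cases s <;> simp [turn]

lemma turn_ne_zero (s : Bool) : turn s ≠ 0 := by cases s <;> simp [turn]

lemma ori_eq_cross_inward (i : (Pt × Pt) × Bool) (y : Pt) :
    ori i.1.1 i.1.2 y = turn i.2 * cross (inward i) (y - endpt i) := by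
  obtain ⟨e, k⟩ := i
  cases k <;> simp [ori, inward, endpt, turn, cross]
  ring

lemma mem_segment_iff_inward (i : (Pt × Pt) × Bool) {y : Pt} :
    y ∈ segment ℝ i.1.1 i.1.2 ↔ ∃ t : ℝ, 0 ≤ t ∧ t ≤ 1 ∧ y = endpt i + t • inward i := by
  obtain ⟨e, k⟩ := i
  cases k
  · rw [segment_symm, mem_segment_iff]; simp [endpt, inward, turn]
  · rw [mem_segment_iff]; simp [endpt, inward, turn]

lemma inward_ne_zero (hM : PlaneMatching M) (hi : i.1 ∈ M) : inward i ≠ 0 :=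
  smul_ne_zero (turn_ne_zero _) (sub_ne_zero.2 (hM.ne _ hi).symm)

/-- All endpoints are extended, and `α i` is a sign missing at the endpoint `endpt i`. -/
structure Assigned (M : Finset (Pt × Pt)) (w : Bool → Set Pt)
    (α : (Pt × Pt) × Bool → Bool) : Prop where
  plane : PlaneMatching M
  sys : WallSystem M w ∅
  notMem : ∀ i : (Pt × Pt) × Bool, i.1 ∈ M → endpt i ∉ w (α i)

/-- Near `endpt i` the walls look like `y` does: a line through `i.1`, without sign `α i`
outside the edge. -/
structure LocalAt (M : Finset (Pt × Pt)) (w : Bool → Set Pt) (α : (Pt × Pt) × Bool → Bool)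
    (i : (Pt × Pt) × Bool) (y : Pt) : Prop where
  mem_iff : y ∈ walls M w ↔ ori i.1.1 i.1.2 y = 0
  notMem : y ∉ w (α i)
  mem_edge : y ∈ edgeUnion M → y ∈ segment ℝ i.1.1 i.1.2
  lt_one : ∀ κ : ℝ, y = endpt i + κ • inward i → κ < 1

lemma eventually_mem_segment_of_mem_edgeUnion (hM : PlaneMatching M) {e : Pt × Pt} (he : e ∈ M)
    {x : Pt} (hx : x ∈ segment ℝ e.1 e.2) :
    ∀ᶠ y in 𝓝 x, y ∈ edgeUnion M → y ∈ segment ℝ e.1 e.2 := by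
  have : ∀ e' ∈ M, ∀ᶠ y in 𝓝 x, y ∈ segment ℝ e'.1 e'.2 → y ∈ segment ℝ e.1 e.2 := by
    intro e' he'
    by_cases h : x ∈ segment ℝ e'.1 e'.2
    · obtain rfl := hM.eq_of_mem e he e' he' x hx h
      exact Eventually.of_forall fun _ => id
    · filter_upwards [(isClosed_segment e'.1 e'.2).isOpen_compl.mem_nhds h] with y hy hy'
      exact absurd hy' hy
  filter_upwards [(Finset.eventually_all M).2 this] with y hy
  rintro ⟨e', he', h⟩
  exact hy e' he' h

lemma Assigned.eventually_localAt (h : Assigned M w α) (hi : i.1 ∈ M) :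
    ∀ᶠ y in 𝓝 (endpt i), LocalAt M w α i y := by
  have hu := inward_ne_zero h.plane hi
  have hss := scal_self_pos hu
  have hedge := eventually_mem_segment_of_mem_edgeUnion h.plane hi (endpt_mem_segment i)
  obtain ⟨-, hline⟩ := h.sys.extended _ hi _ (endpt_eq_or i) (notMem_empty _)
  have hsub : ∀ᶠ y in 𝓝 (endpt i), y ∈ walls M w → ori i.1.1 i.1.2 y = 0 := by
    filter_upwards [hedge, hline true, hline false] with y h1 h2 h3 hy
    rcases hy with hy | hy | hy
    exacts [ori_eq_zero_of_mem_segment (h1 hy), h2 hy, h3 hy]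
  have hpW : endpt i ∈ walls M w := mem_walls.2 (Or.inl ⟨_, hi, endpt_mem_segment i⟩)
  obtain ⟨v, hv, hvW⟩ := h.sys.noEnd _ hpW (notMem_empty _)
  have hcv : cross (inward i) v = 0 := by
    have hT : Tendsto (fun t : ℝ => endpt i + t • v) (𝓝[>] 0) (𝓝 (endpt i)) := by
      have : Tendsto (fun t : ℝ => endpt i + t • v) (𝓝 0) (𝓝 (endpt i + (0 : ℝ) • v)) :=
        Continuous.tendsto (by fun_prop) _
      rw [zero_smul, add_zero] at this
      exact this.mono_left nhdsWithin_le_nhds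
    obtain ⟨t, h1, h2⟩ := ((hT.eventually hsub).and (Ioo_mem_nhdsGT zero_lt_one)).exists
    have h3 := h1 (hvW t (by rw [abs_of_pos h2.1]; exact h2.2.le))
    rw [ori_eq_cross_inward, add_sub_cancel_left, cross_smul_right] at h3
    simpa [turn_ne_zero, h2.1.ne'] using h3
  obtain ⟨c, rfl⟩ := exists_smul_of_cross_eq_zero hu hcv
  have hc : c ≠ 0 := by rintro rfl; simp at hv
  have hcont : Continuous fun y : Pt => scal (inward i) (y - endpt i) := by
    unfold scal; fun_prop
  have hscal : ∀ κ : ℝ, scal (inward i) (κ • inward i) = κ * scal (inward i) (inward i) := by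
    intro κ; simp [scal]; ring
  have hsmall : ∀ᶠ y in 𝓝 (endpt i), ∀ κ : ℝ, y = endpt i + κ • inward i → κ < 1 ∧ |κ| < |c| := by
    have h0 : scal (inward i) (endpt i - endpt i) = 0 := by simp [scal]
    have hm : 0 < min 1 |c| * scal (inward i) (inward i) := by positivity
    have h1 := hcont.abs.tendsto (endpt i)
    rw [h0, abs_zero] at h1
    filter_upwards [h1.eventually_lt_const hm] with y hy κ hκ
    rw [hκ, add_sub_cancel_left, hscal, abs_mul, abs_of_pos hss, mul_lt_mul_iff_left₀ hss] at hy
    exact ⟨lt_of_le_of_lt (le_abs_self κ) (hy.trans_le (min_le_left _ _)),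
      hy.trans_le (min_le_right _ _)⟩
  filter_upwards [hedge, hsub, hsmall,
    (h.sys.closed _).isOpen_compl.mem_nhds (h.notMem i hi)] with y h1 h2 h3 h4
  refine ⟨⟨h2, fun hy => ?_⟩, h4, h1, fun κ hκ => (h3 κ hκ).1⟩
  rw [ori_eq_cross_inward, mul_eq_zero, or_iff_right (turn_ne_zero _)] at hy
  obtain ⟨κ, hκ⟩ := exists_smul_of_cross_eq_zero hu hy
  have hyκ : y = endpt i + κ • inward i := by rw [← hκ]; abel
  have := hvW (κ / c) (by
    rw [abs_div, div_le_one (abs_pos.2 hc)]; exact (h3 κ hyκ).2.le)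
  rwa [smul_smul, div_mul_cancel₀ _ hc, ← hyκ] at this

/-- The first wall point in direction `d` from `o` has sign `s`. -/
def Sg (M : Finset (Pt × Pt)) (w : Bool → Set Pt) (o d : Pt) (s : Bool) : Prop :=
  ∃ t, Hit (walls M w) o d t ∧ SignAt M w (o + t • d) o s

lemma Sg.unique (hM : PlaneMatching M) (h : WallSystem M w U) (hs : Sg M w o d s)
    (hs' : Sg M w o d s') : s = s' := by
  obtain ⟨t, ht, hs⟩ := hs
  obtain ⟨t', ht', hs'⟩ := hs'
  obtain rfl := ht.unique ht'
  exact hs.unique hM h hs'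

lemma Sg.smul {c : ℝ} (hc : 0 < c) (h : Sg M w o d s) : Sg M w o (c • d) s := by
  obtain ⟨t, ht, hs⟩ := h
  refine ⟨t / c, ht.smul hc, ?_⟩
  rwa [smul_smul, div_mul_cancel₀ _ hc.ne']

lemma Hit.openSegment_inter {W : Set Pt} {t : ℝ} (h : Hit W o d t) :
    openSegment ℝ o (o + t • d) ∩ W = ∅ := by
  ext z
  simp only [Set.mem_inter_iff, Set.mem_empty_iff_false, iff_false, not_and]
  intro hz
  obtain ⟨r, h0, h1, rfl⟩ := mem_openSegment_iff.1 hz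
  rw [add_sub_cancel_left, smul_smul]
  exact h.2.2 _ (mul_nonneg h0.le h.1.le) (by nlinarith [h.1])

/-- Away from the endpoints of the matching, the sign of the first wall point is locally
constant. -/
lemma Assigned.eventually_sg (h : Assigned M w α) {t₀ : ℝ} (ht : Hit (walls M w) o d t₀)
    (hz : o + t₀ • d ∉ endpoints M) : ∃ s, ∀ᶠ d' in 𝓝 d, Sg M w o d' s := by
  obtain ⟨s, hs⟩ := exists_signAt h.plane ht.2.1 hz ht.openSegment_inter
  have hne := h.sys.noEnd _ ht.2.1 (notMem_empty _)
  refine ⟨s, ?_⟩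
  rcases hs with ⟨hzE, hzs⟩ | ⟨e, he, hze, hs⟩
  · have h1 : ∀ᶠ y in 𝓝 (o + t₀ • d), y ∉ edgeUnion M ∧ y ∉ w (!s) :=
      Eventually.and ((isClosed_edgeUnion M).isOpen_compl.mem_nhds hzE)
        ((h.sys.closed _).isOpen_compl.mem_nhds fun h' => hzE (h.sys.sep s _ hzs h'))
    filter_upwards [Hit.eventually_mem h.sys.isClosed ht hne h1] with d' hd'
    obtain ⟨t, ht, h2, h3⟩ := hd'
    refine ⟨t, ht, Or.inl ⟨h2, ?_⟩⟩
    rcases ht.2.1 with h4 | h4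
    · exact absurd h4 h2
    · cases s
      · exact h4.resolve_left h3
      · exact h4.resolve_right h3
  · have hzo : o + t₀ • d ∈ openSegment ℝ e.1 e.2 :=
      mem_openSegment_of_mem hze (fun h' => hz (mem_endpoints.2 ⟨e, he, Or.inl h'⟩))
        (fun h' => hz (mem_endpoints.2 ⟨e, he, Or.inr h'⟩))
    have hte : Hit (segment ℝ e.1 e.2) o d t₀ :=
      ⟨ht.1, hze, fun r h0 h1 h' => ht.2.2 r h0 h1 (mem_walls.2 (Or.inl ⟨e, he, h'⟩))⟩
    have h1 : ∀ᶠ y in 𝓝 (o + t₀ • d), (y ∈ edgeUnion M → y ∈ segment ℝ e.1 e.2) ∧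
        (y ∈ w (!s) → 0 ≤ turn (!s) * ori e.1 e.2 y) :=
      (eventually_mem_segment_of_mem_edgeUnion h.plane he hze).and (h.sys.edge e he _ hzo _)
    filter_upwards [Hit.eventually_mem h.sys.isClosed ht hne h1,
      Hit.eventually (isClosed_segment _ _) hte
        (noEnd_of_mem_openSegment (h.plane.ne e he) hzo subset_rfl) univ_mem] with d' h2 h3
    obtain ⟨t, ht, h2, h2'⟩ := h2
    obtain ⟨r, -, hr⟩ := h3
    refine ⟨t, ht, ?_⟩
    by_cases hE : o + t • d' ∈ edgeUnion M
    · exact Or.inr ⟨e, he, h2 hE, hs⟩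
    refine Or.inl ⟨hE, ?_⟩
    have htr : t < r := by
      rcases lt_trichotomy t r with hl | hl | hl
      · exact hl
      · subst hl; exact absurd ⟨e, he, hr.2.1⟩ hE
      · exact absurd (mem_walls.2 (Or.inl ⟨e, he, hr.2.1⟩)) (ht.2.2 r hr.1.le hl)
    have hori : ori e.1 e.2 (o + t • d') = (1 - t / r) * ori e.1 e.2 o := by
      have := ori_of_mem' hr.2.1 o (t / r)
      rwa [add_sub_cancel_left, smul_smul, div_mul_cancel₀ _ hr.1.ne'] at this
    have hpos : 0 < 1 - t / r := by
      rw [sub_pos, div_lt_one hr.1]; exact htr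
    have h4 : o + t • d' ∉ w (!s) := fun h' => by
      have h5 := h2' h'
      rw [hori] at h5
      have h6 := mul_pos hpos hs
      cases s <;> simp [turn] at h5 h6 <;> linarith
    rcases ht.2.1 with h5 | h5
    · exact absurd h5 hE
    · cases s
      · exact h5.resolve_left h4
      · exact h5.resolve_right h4

/-- If the ray from `o` first meets the walls in the endpoint of an edge, then nearby rays
meet the edge on one side and a wall of sign `!α i` on the other. -/
lemma Assigned.eventually_sg_endpt (h : Assigned M w α) (hi : i.1 ∈ M) {t₀ : ℝ}
    (ht : Hit (walls M w) o d t₀) (hz : o + t₀ • d = endpt i)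
    (hs : 0 < turn s * ori i.1.1 i.1.2 o) :
    ∀ᶠ d' in 𝓝 d, (0 < turn i.2 * turn s * cross d d' → Sg M w o d' s) ∧
      (turn i.2 * turn s * cross d d' < 0 → Sg M w o d' (!α i)) := by
  have hne := h.sys.noEnd _ ht.2.1 (notMem_empty _)
  have hloc := h.eventually_localAt hi
  rw [← hz] at hloc
  filter_upwards [Hit.eventually_mem h.sys.isClosed ht hne hloc] with d' hd'
  obtain ⟨t, ht', hl⟩ := hd'
  have h0 := hl.mem_iff.1 ht'.2.1
  rw [ori_eq_cross_inward, mul_eq_zero, or_iff_right (turn_ne_zero _)] at h0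
  obtain ⟨κ, hκ⟩ := exists_smul_of_cross_eq_zero (inward_ne_zero h.plane hi) h0
  have hzκ : o + t • d' = endpt i + κ • inward i := by rw [← hκ]; abel
  have hκ1 := hl.lt_one κ hzκ
  -- relate `κ` to the direction
  have key : t * (t₀ * cross d d') = κ * (turn i.2 * ori i.1.1 i.1.2 o) := by
    have e1 : t₀ • d = endpt i - o := by rw [← hz]; abel
    have e2 : t • d' = (endpt i - o) + κ • inward i := by
      rw [← add_sub_cancel_left o (t • d'), hzκ]; abel
    have : t * (t₀ * cross d d') = cross (t₀ • d) (t • d') := by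
      rw [cross_smul_left, cross_smul_right]; ring
    rw [this, e1, e2, ori_eq_cross_inward]
    simp only [cross, Prod.fst_sub, Prod.snd_sub, Prod.fst_add, Prod.snd_add, Prod.smul_fst,
      Prod.smul_snd, smul_eq_mul]
    linear_combination -κ * ((inward i).1 * (o.2 - (endpt i).2)
      - (inward i).2 * (o.1 - (endpt i).1)) * turn_sq i.2
  have h1 : 0 < t * t₀ := mul_pos ht'.1 ht.1
  have key2 : t * t₀ * (turn i.2 * turn s * cross d d') = κ * (turn s * ori i.1.1 i.1.2 o) := by
    have := congrArg (fun x => x * (turn i.2 * turn s)) key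
    linear_combination this + κ * turn s * ori i.1.1 i.1.2 o * turn_sq i.2
  constructor
  · intro hp
    have hκ0 : 0 < κ := by
      by_contra hcon
      nlinarith [mul_pos h1 hp]
    exact ⟨t, ht', Or.inr ⟨i.1, hi, (mem_segment_iff_inward i).2 ⟨κ, hκ0.le, hκ1.le, hzκ⟩, hs⟩⟩
  · intro hn
    have hκ0 : κ < 0 := by
      by_contra hcon
      nlinarith [mul_neg_of_pos_of_neg h1 hn]
    have hE : o + t • d' ∉ edgeUnion M := fun hE => by
      obtain ⟨r, hr0, -, hr⟩ := (mem_segment_iff_inward i).1 (hl.mem_edge hE)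
      rw [hzκ] at hr
      have := smul_left_injective ℝ (inward_ne_zero h.plane hi) (add_left_cancel hr)
      linarith
    refine ⟨t, ht', Or.inl ⟨hE, ?_⟩⟩
    have hα := hl.notMem
    rcases ht'.2.1 with h5 | h5
    · exact absurd h5 hE
    · revert hα
      generalize α i = a
      intro hα
      cases a
      · exact h5.resolve_right hα
      · exact h5.resolve_left hα

/-- A first wall point that is an endpoint is not seen along its edge. -/
lemma Assigned.ori_ne_zero_of_hit (h : Assigned M w α) (hi : i.1 ∈ M) {t₀ : ℝ}
    (ht : Hit (walls M w) o d t₀) (hz : o + t₀ • d = endpt i) : ori i.1.1 i.1.2 o ≠ 0 := by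
  intro h0
  have hloc := h.eventually_localAt hi
  rw [← hz] at hloc
  have hT : Tendsto (fun t : ℝ => o + t • d) (𝓝[<] t₀) (𝓝 (o + t₀ • d)) :=
    (Continuous.tendsto (f := fun t : ℝ => o + t • d) (by fun_prop) _).mono_left
      nhdsWithin_le_nhds
  obtain ⟨t, h1, h2⟩ := ((hT.eventually hloc).and (Ioo_mem_nhdsLT ht.1)).exists
  refine ht.2.2 t h2.1.le h2.2 (h1.mem_iff.2 ?_)
  have : o + t • d = o + (t / t₀) • (endpt i - o) := by
    rw [← hz, add_sub_cancel_left, smul_smul, div_mul_cancel₀ _ ht.1.ne']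
  rw [this, ori_of_mem' (endpt_mem_segment i), h0, mul_zero]

end

section

open Topology Filter

variable {M : Finset (Pt × Pt)} {w : Bool → Set Pt} {U : Finset Pt} {o d D : Pt} {s s' : Bool}
  {i j : (Pt × Pt) × Bool} {α : (Pt × Pt) × Bool → Bool}

/-- The total jump of a step function is the sum of its jumps. -/
lemma sum_jumps {ι : Type*} (S : Finset ι) (pos c : ι → ℝ) (f : ℝ → ℝ) {A B : ℝ}
    (hA : ∀ᶠ s in atBot, f s = A) (hB : ∀ᶠ s in atTop, f s = B)
    (h : ∀ s, ∃ a b, (∀ᶠ t in 𝓝 s, (t < s → f t = a) ∧ (s < t → f t = b)) ∧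
      b - a = ∑ i ∈ S, if pos i = s then c i else 0) : B - A = ∑ i ∈ S, c i := by
  let G : ℝ → ℝ := fun t => f t - ∑ i ∈ S, if pos i < t then c i else 0
  have hG : ∀ s, ∃ g, ∀ᶠ t in 𝓝[≠] s, G t = g := by
    intro s
    obtain ⟨a, b, hab, hsum⟩ := h s
    refine ⟨a - ∑ i ∈ S, (if pos i < s then c i else 0), ?_⟩
    have h1 : ∀ i ∈ S, ∀ᶠ t in 𝓝 s, (pos i < s → pos i < t) ∧ (s < pos i → t < pos i) := by
      intro i _
      rcases lt_trichotomy (pos i) s with hl | hl | hl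
      · filter_upwards [lt_mem_nhds hl] with t ht
        exact ⟨fun _ => ht, fun h' => absurd h' hl.not_gt⟩
      · exact Eventually.of_forall fun t => ⟨fun h' => absurd hl h'.ne, fun h' => absurd hl h'.ne'⟩
      · filter_upwards [gt_mem_nhds hl] with t ht
        exact ⟨fun h' => absurd h' hl.not_gt, fun _ => ht⟩
    rw [eventually_nhdsWithin_iff]
    filter_upwards [hab, (Finset.eventually_all S).2 h1] with t ht hpos hne
    rcases lt_or_gt_of_ne hne with hl | hl
    · have : ∑ i ∈ S, (if pos i < t then c i else 0) = ∑ i ∈ S, if pos i < s then c i else 0 := by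
        refine Finset.sum_congr rfl fun i hi => ?_
        have h2 : pos i < t ↔ pos i < s := ⟨fun h' => h'.trans hl, (hpos i hi).1⟩
        simp only [h2]
      simp only [G, this, ht.1 hl]
    · have : ∑ i ∈ S, (if pos i < t then c i else 0) =
          ∑ i ∈ S, ((if pos i < s then c i else 0) + if pos i = s then c i else 0) := by
        refine Finset.sum_congr rfl fun i hi => ?_
        rcases lt_trichotomy (pos i) s with h3 | h3 | h3
        · simp [h3, h3.ne, h3.trans hl]
        · simp [h3, hl]
        · simp [h3.not_gt, h3.ne', ((hpos i hi).2 h3).not_gt]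
      simp only [G, this, ht.2 hl, Finset.sum_add_distrib, ← hsum]
      ring
  choose g hg using hG
  have hloc : IsLocallyConstant g := by
    rw [IsLocallyConstant.iff_eventually_eq]
    intro s
    have h1 := eventually_eventually_nhdsWithin.2 (hg s)
    rw [eventually_nhdsWithin_iff] at h1
    filter_upwards [h1] with t ht
    by_cases hts : t = s
    · rw [hts]
    have h2 := ht hts
    rw [isOpen_compl_singleton.nhdsWithin_eq hts] at h2
    obtain ⟨x, h3, h4⟩ := ((h2.filter_mono nhdsWithin_le_nhds).and (hg t)).exists
    exact h4.symm.trans h3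
  have hconst : ∀ x y, g x = g y := fun x y => hloc.apply_eq_of_preconnectedSpace x y
  have hlow : ∀ᶠ s in atBot, ∀ i ∈ S, s < pos i :=
    (Finset.eventually_all S).2 fun i _ => eventually_lt_atBot _
  have hhigh : ∀ᶠ s in atTop, ∀ i ∈ S, pos i < s :=
    (Finset.eventually_all S).2 fun i _ => eventually_gt_atTop _
  have key : ∀ {x C : ℝ}, (∀ᶠ t in 𝓝 x, G t = C) → g x = C := by
    intro x C hx
    obtain ⟨y, h1, h2⟩ := ((hx.filter_mono nhdsWithin_le_nhds).and (hg x)).exists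
    exact h2.symm.trans h1
  obtain ⟨x, hx⟩ := eventually_atBot.1 (hA.and hlow)
  obtain ⟨y, hy⟩ := eventually_atTop.1 (hB.and hhigh)
  have hgx : g (x - 1) = A := key (by
    filter_upwards [gt_mem_nhds (show x - 1 < x by linarith)] with t ht
    have := hx t ht.le
    simp only [G, this.1]
    rw [Finset.sum_eq_zero fun i hi => if_neg (this.2 i hi).not_gt, sub_zero])
  have hgy : g (y + 1) = B - ∑ i ∈ S, c i := key (by
    filter_upwards [lt_mem_nhds (show y < y + 1 by linarith)] with t ht
    have := hy t ht.le
    simp only [G, this.1]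
    rw [Finset.sum_congr rfl fun i hi => if_pos (this.2 i hi)])
  have := hconst (x - 1) (y + 1)
  linarith

/-- The point `o` sees the endpoint `endpt i` from the side `α i` of its edge. -/
def Sees (M : Finset (Pt × Pt)) (w : Bool → Set Pt) (α : (Pt × Pt) × Bool → Bool)
    (i : (Pt × Pt) × Bool) (o : Pt) : Prop :=
  Hit (walls M w) o (endpt i - o) 1 ∧ 0 < turn (α i) * ori i.1.1 i.1.2 o

/-- The sign of the first wall point in direction `d` from `o`. -/
noncomputable def sgn (M : Finset (Pt × Pt)) (w : Bool → Set Pt) (o d : Pt) : ℝ :=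
  turn (decide (Sg M w o d true))

lemma Sg.sgn_eq (hM : PlaneMatching M) (h : WallSystem M w U) (hs : Sg M w o d s) :
    sgn M w o d = turn s := by
  unfold sgn
  cases s
  · rw [decide_eq_false]
    exact fun h' => Bool.noConfusion (hs.unique hM h h')
  · rw [decide_eq_true hs]

lemma abs_sgn_sub_le (d' : Pt) : |sgn M w o d - sgn M w o d'| ≤ 2 := by
  unfold sgn
  cases decide (Sg M w o d true) <;> cases decide (Sg M w o d' true) <;> norm_num [turn]

lemma Assigned.eventually_sgn (h : Assigned M w α) {t₀ : ℝ} (ht : Hit (walls M w) o d t₀)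
    (hz : o + t₀ • d ∉ endpoints M) : ∀ᶠ d' in 𝓝 d, sgn M w o d' = sgn M w o d := by
  obtain ⟨s, hs⟩ := h.eventually_sg ht hz
  have h1 := hs.self_of_nhds
  filter_upwards [hs] with d' hd'
  rw [hd'.sgn_eq h.plane h.sys, h1.sgn_eq h.plane h.sys]

lemma sgn_smul {c : ℝ} (hc : 0 < c) : sgn M w o (c • d) = sgn M w o d := by
  unfold sgn
  congr 2
  refine propext ⟨fun h => ?_, Sg.smul hc⟩
  have := h.smul (inv_pos.2 hc)
  rwa [smul_smul, inv_mul_cancel₀ hc.ne', one_smul] at this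

/-- The counterclockwise rotation by a right angle. -/
def perp (u : Pt) : Pt := (-u.2, u.1)

lemma cross_perp (u : Pt) : cross u (perp u) = scal u u := by simp [cross, scal, perp]

lemma Assigned.tendsto_sgn (h : Assigned M w α) (ho : o ∉ walls M w) (hd : d ≠ 0)
    (hline : ∀ x ∈ endpoints M, cross d (x - o) ≠ 0) (N : Pt) :
    ∀ᶠ s : ℝ in atTop, sgn M w o (N + s • d) = sgn M w o d := by
  obtain ⟨t, ht⟩ := h.sys.exists_hit ho hd
  have hz : o + t • d ∉ endpoints M := fun hz => hline _ hz (by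
    rw [add_sub_cancel_left, cross_smul_right, cross_same, mul_zero])
  have hT : Tendsto (fun s : ℝ => s⁻¹ • N + d) atTop (𝓝 d) := by
    have h1 : Tendsto (fun s : ℝ => s⁻¹ • N) atTop (𝓝 ((0 : ℝ) • N)) :=
      tendsto_inv_atTop_zero.smul tendsto_const_nhds
    simpa using h1.add_const d
  filter_upwards [hT.eventually (h.eventually_sgn ht hz), eventually_gt_atTop 0] with s hs h0
  rw [← hs, ← sgn_smul (inv_pos.2 h0), smul_add, smul_smul, inv_mul_cancel₀ h0.ne', one_smul]

lemma Assigned.jump_eq (h : Assigned M w α) (hi : i.1 ∈ M) {t₀ : ℝ}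
    (ht : Hit (walls M w) o d t₀) (hz : o + t₀ • d = endpt i) :
    ∃ a b, (∀ᶠ d' in 𝓝 d, (cross d d' < 0 → sgn M w o d' = a) ∧
      (0 < cross d d' → sgn M w o d' = b)) ∧
      b - a = if 0 < turn (α i) * ori i.1.1 i.1.2 o then 2 * turn i.2 else 0 := by
  obtain ⟨s, hs⟩ := turn_mul_pos_or (h.ori_ne_zero_of_hit hi ht hz)
  have hev := h.eventually_sg_endpt hi ht hz hs
  by_cases hk : 0 < turn i.2 * turn s
  · refine ⟨turn (!α i), turn s, ?_, ?_⟩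
    · filter_upwards [hev] with d' hd'
      exact ⟨fun h' => (hd'.2 (mul_neg_of_pos_of_neg hk h')).sgn_eq h.plane h.sys,
        fun h' => (hd'.1 (mul_pos hk h')).sgn_eq h.plane h.sys⟩
    · revert hk hs
      generalize α i = a, i.2 = k, ori i.1.1 i.1.2 o = x
      cases a <;> cases k <;> cases s <;> intro hs hk <;>
        simp only [turn, Bool.not_true, Bool.not_false, if_true, if_false, Bool.false_eq_true]
          at hs hk ⊢ <;>
        first | (exfalso; linarith) | (split_ifs <;> linarith)
  · have hk : turn i.2 * turn s < 0 :=
      lt_of_le_of_ne (not_lt.1 hk) (mul_ne_zero (turn_ne_zero _) (turn_ne_zero _))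
    refine ⟨turn s, turn (!α i), ?_, ?_⟩
    · filter_upwards [hev] with d' hd'
      exact ⟨fun h' => (hd'.1 (mul_pos_of_neg_of_neg hk h')).sgn_eq h.plane h.sys,
        fun h' => (hd'.2 (mul_neg_of_neg_of_pos hk h')).sgn_eq h.plane h.sys⟩
    · revert hk hs
      generalize α i = a, i.2 = k, ori i.1.1 i.1.2 o = x
      cases a <;> cases k <;> cases s <;> intro hs hk <;>
        simp only [turn, Bool.not_true, Bool.not_false, if_true, if_false, Bool.false_eq_true]
          at hs hk ⊢ <;>
        first | (exfalso; linarith) | (split_ifs <;> linarith)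

/-- Sum of the signs of the endpoints seen in a half-plane. -/
theorem Assigned.sum_half (h : Assigned M w α) (ho : o ∉ walls M w) (hD : D ≠ 0)
    (hline : ∀ x ∈ endpoints M, cross D (x - o) ≠ 0) :
    sgn M w o (-D) - sgn M w o D = ∑ i ∈ M ×ˢ (univ : Finset Bool),
      if Sees M w α i o ∧ 0 < cross D (endpt i - o) then 2 * turn i.2 else 0 := by
  have hDD := scal_self_pos hD
  let dir : ℝ → Pt := fun s => perp D + s • (-D)
  have hcD : ∀ s, cross D (dir s) = scal D D := by
    intro s; simp [dir, cross, perp, scal]; ring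
  have hcdir : ∀ s t, cross (dir s) (dir t) = (t - s) * scal D D := by
    intro s t; simp [dir, cross, perp, scal]; ring
  let pos : (Pt × Pt) × Bool → ℝ := fun i =>
    cross (perp D) (endpt i - o) / cross D (endpt i - o)
  have hdir : ∀ v : Pt, 0 < cross D v →
      v = (cross D v / scal D D) • dir (cross (perp D) v / cross D v) := by
    intro v hv
    have h1 : scal D D • v = cross D v • perp D + cross (perp D) v • (-D) := by
      ext <;> simp [cross, perp, scal] <;> ring
    calc v = (scal D D)⁻¹ • (scal D D • v) := by
          rw [smul_smul, inv_mul_cancel₀ hDD.ne', one_smul]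
      _ = _ := by
          rw [h1]
          simp only [dir, smul_add, smul_smul]
          congr 2 <;> field_simp
  refine sum_jumps _ pos _ (fun s => sgn M w o (dir s)) ?_ ?_ ?_
  · filter_upwards [tendsto_neg_atBot_atTop.eventually
      (h.tendsto_sgn ho hD hline (perp D))] with s hs
    simpa [dir] using hs
  · exact h.tendsto_sgn ho (neg_ne_zero.2 hD) (fun x hx h0 => hline x hx (by
      rw [← neg_eq_zero, ← h0]; simp [cross]; ring)) _
  · intro s
    have hdir0 : dir s ≠ 0 := fun h0 => by
      have := hcD s; rw [h0] at this; simp [cross] at this; linarith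
    obtain ⟨t, ht⟩ := h.sys.exists_hit ho hdir0
    have hcont : Tendsto dir (𝓝 s) (𝓝 (dir s)) := Continuous.tendsto (by fun_prop) _
    have hseen : ∀ i, Sees M w α i o ∧ 0 < cross D (endpt i - o) → pos i = s →
        endpt i = o + t • dir s := by
      rintro i ⟨⟨h1, -⟩, h2⟩ h3
      have h4 := hdir _ h2
      have hc : 0 < scal D D / cross D (endpt i - o) := div_pos hDD h2
      have h5 : (scal D D / cross D (endpt i - o)) • (endpt i - o) = dir s := by
        have h6 := congrArg ((scal D D / cross D (endpt i - o)) • ·) h4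
        simp only [smul_smul] at h6
        rwa [div_mul_div_cancel₀ h2.ne', div_self hDD.ne', one_smul,
          show cross (perp D) (endpt i - o) / cross D (endpt i - o) = s from h3] at h6
      have h6 := h1.smul hc
      rw [h5] at h6
      rw [ht.unique h6, ← h5, smul_smul, div_mul_cancel₀ _ hc.ne', one_smul]
      abel
    by_cases hz : o + t • dir s ∈ endpoints M
    · obtain ⟨i, hi, hzi⟩ := exists_endpt_eq hz
      obtain ⟨a, b, hab, hba⟩ := h.jump_eq hi ht hzi
      refine ⟨a, b, ?_, ?_⟩
      · filter_upwards [hcont.eventually hab] with r hr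
        rw [hcdir] at hr
        exact ⟨fun h' => hr.1 (mul_neg_of_neg_of_pos (by linarith) hDD),
          fun h' => hr.2 (mul_pos (by linarith) hDD)⟩
      · rw [hba, Finset.sum_eq_single i]
        · have h1 : endpt i - o = t • dir s := by rw [← hzi]; abel
          have h2 : 0 < cross D (endpt i - o) := by
            rw [h1, cross_smul_right, hcD]; exact mul_pos ht.1 hDD
          have h3 : pos i = s := by
            have h4 : cross (perp D) (dir s) = s * scal D D := by
              simp [dir, cross, perp, scal]; ring
            simp only [pos]
            rw [h1, cross_smul_right, cross_smul_right, hcD, h4, div_eq_iff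
              (mul_ne_zero ht.1.ne' hDD.ne')]
            ring
          have h4 : Hit (walls M w) o (endpt i - o) 1 := by
            have := ht.smul ht.1
            rwa [← h1, div_self ht.1.ne'] at this
          simp only [h3, h2, Sees, h4, true_and, and_true, if_true]
        · intro j hj hji
          by_cases h1 : pos j = s
          · rw [if_pos h1, if_neg]
            intro h2
            exact hji (endpt_injective h.plane (mem_product.1 hj).1 hi
              ((hseen j h2 h1).trans hzi))
          · rw [if_neg h1]
        · exact fun h' => absurd (mem_product.2 ⟨hi, mem_univ _⟩) h'
    · refine ⟨_, _, ?_, sub_self (sgn M w o (dir s)) |>.trans (Finset.sum_eq_zero ?_).symm⟩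
      · filter_upwards [hcont.eventually (h.eventually_sgn ht hz)] with r hr
        exact ⟨fun _ => hr, fun _ => hr⟩
      · intro i hi
        by_cases h1 : pos i = s
        · rw [if_pos h1, if_neg]
          exact fun h2 => hz (hseen i h2 h1 ▸ endpt_mem_endpoints (mem_product.1 hi).1)
        · rw [if_neg h1]

end

section

open Topology Filter

variable {M : Finset (Pt × Pt)} {w : Bool → Set Pt} {U : Finset Pt} {o d D x y z : Pt}
  {s s' : Bool} {i j : (Pt × Pt) × Bool} {α : (Pt × Pt) × Bool → Bool}

lemma Assigned.abs_sum_half_le (h : Assigned M w α) (ho : o ∉ walls M w) (hD : D ≠ 0)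
    (hline : ∀ x ∈ endpoints M, cross D (x - o) ≠ 0) :
    |∑ i ∈ M ×ˢ (univ : Finset Bool),
      if Sees M w α i o ∧ 0 < cross D (endpt i - o) then turn i.2 else 0| ≤ 1 := by
  have h1 := abs_sgn_sub_le (M := M) (w := w) (o := o) (d := -D) D
  rw [h.sum_half ho hD hline] at h1
  have h2 : ∀ i : (Pt × Pt) × Bool,
      (if Sees M w α i o ∧ 0 < cross D (endpt i - o) then 2 * turn i.2 else 0) =
      2 * if Sees M w α i o ∧ 0 < cross D (endpt i - o) then turn i.2 else 0 := by
    intro i; split_ifs <;> simp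
  simp only [h2] at h1
  rw [← Finset.mul_sum, abs_mul, abs_two] at h1
  linarith

/-- Some line through `o` misses finitely many given points. -/
lemma exists_direction (S : Finset Pt) (o : Pt) (ho : o ∉ S) :
    ∃ D : Pt, D ≠ 0 ∧ ∀ x ∈ S, cross D (x - o) ≠ 0 := by
  obtain ⟨s, hs⟩ := Infinite.exists_notMem_finset (S.image fun x => (x - o).2 / (x - o).1)
  refine ⟨(1, s), fun h => one_ne_zero (congrArg Prod.fst h), fun x hx h0 => ?_⟩
  have h1 : (x - o).2 - s * (x - o).1 = 0 := by simpa [cross] using h0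
  by_cases h2 : (x - o).1 = 0
  · rw [h2, mul_zero, sub_zero] at h1
    exact ho ((sub_eq_zero.1 (Prod.ext h2 h1 : x - o = 0)) ▸ hx)
  · exact hs (mem_image.2 ⟨x, hx, by rw [div_eq_iff h2]; linarith⟩)

lemma Assigned.sum_seen (h : Assigned M w α) (ho : o ∉ walls M w) :
    ∑ i ∈ M ×ˢ (univ : Finset Bool), (if Sees M w α i o then turn i.2 else 0) = 0 := by
  obtain ⟨D, hD, hline⟩ := exists_direction (endpoints M) o fun h' =>
    ho (mem_walls.2 (Or.inl (endpoint_mem_edgeUnion h')))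
  have hneg : ∀ v, cross (-D) v = -cross D v := fun v => by simp [cross]; ring
  have h1 := h.sum_half ho hD hline
  have h2 := h.sum_half ho (neg_ne_zero.2 hD) (fun x hx h0 => hline x hx (by
    rwa [hneg, neg_eq_zero] at h0))
  rw [neg_neg] at h2
  have h3 : 2 * ∑ i ∈ M ×ˢ (univ : Finset Bool), (if Sees M w α i o then turn i.2 else 0) =
      (sgn M w o (-D) - sgn M w o D) + (sgn M w o D - sgn M w o (-D)) := by
    rw [h1, h2, ← Finset.sum_add_distrib, Finset.mul_sum]
    refine Finset.sum_congr rfl fun i hi => ?_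
    rw [hneg]
    rcases lt_or_gt_of_ne (hline _ (endpt_mem_endpoints (mem_product.1 hi).1)) with hl | hl
    · by_cases h4 : Sees M w α i o <;> simp [h4, hl, hl.not_gt]
    · by_cases h4 : Sees M w α i o <;> simp [h4, hl, hl.not_gt]
  linarith

lemma Assigned.trans (h : Assigned M w α) (hxy : Vis (walls M w) x y)
    (hyz : Vis (walls M w) y z) : Vis (walls M w) x z :=
  Vis.trans h.sys.isClosed (fun x hx => h.sys.noEnd x hx (notMem_empty _)) hxy hyz

/-- The point `y` is close to `endpt i`, on the side `α i` of the edge. -/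
def Corner (M : Finset (Pt × Pt)) (w : Bool → Set Pt) (α : (Pt × Pt) × Bool → Bool)
    (i : (Pt × Pt) × Bool) (y : Pt) : Prop :=
  0 < turn (α i) * ori i.1.1 i.1.2 y ∧
    ∃ r, y ∈ Metric.ball (endpt i) r ∧ ∀ z ∈ Metric.ball (endpt i) r, LocalAt M w α i z

lemma Corner.vis (hy : Corner M w α i y) (hz : Corner M w α i z) : Vis (walls M w) y z := by
  obtain ⟨hy, r, hyr, hr⟩ := hy
  obtain ⟨hz, r', hzr, hr'⟩ := hz
  have h1 : ∃ r, y ∈ Metric.ball (endpt i) r ∧ z ∈ Metric.ball (endpt i) r ∧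
      ∀ z ∈ Metric.ball (endpt i) r, LocalAt M w α i z := by
    rcases le_total r r' with hl | hl
    · exact ⟨r', Metric.ball_subset_ball hl hyr, hzr, hr'⟩
    · exact ⟨r, hyr, Metric.ball_subset_ball hl hzr, hr⟩
  obtain ⟨r, hyr, hzr, hr⟩ := h1
  intro x hx hxW
  have h2 := (hr x ((convex_ball _ _).segment_subset hyr hzr hx)).mem_iff.1 hxW
  obtain ⟨t, h0, h1, rfl⟩ := mem_segment_iff.1 hx
  rw [ori_lineMap] at h2
  have : 0 < turn (α i) * ((1 - t) * ori i.1.1 i.1.2 y + t * ori i.1.1 i.1.2 z) := by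
    rcases h0.eq_or_lt with rfl | h0
    · simpa using hy
    · nlinarith [mul_pos h0 hz, mul_nonneg (sub_nonneg.2 h1) hy.le]
  rw [h2, mul_zero] at this
  exact this.false

lemma Assigned.eventually_corner (h : Assigned M w α) (hi : i.1 ∈ M) :
    ∀ᶠ y in 𝓝 (endpt i), 0 < turn (α i) * ori i.1.1 i.1.2 y → Corner M w α i y := by
  obtain ⟨r, hr, hball⟩ := Metric.eventually_nhds_iff_ball.1 (h.eventually_localAt hi)
  filter_upwards [Metric.ball_mem_nhds _ hr] with y hy hpos
  exact ⟨hpos, r, hy, hball⟩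

lemma tendsto_lineMap_nhdsGT (p x : Pt) :
    Tendsto (fun t : ℝ => p + t • (x - p)) (𝓝[>] 0) (𝓝 p) := by
  have : Tendsto (fun t : ℝ => p + t • (x - p)) (𝓝 0) (𝓝 (p + (0 : ℝ) • (x - p))) :=
    Continuous.tendsto (by fun_prop) _
  rw [zero_smul, add_zero] at this
  exact this.mono_left nhdsWithin_le_nhds

lemma Assigned.eventually_corner_lineMap (h : Assigned M w α) (hi : i.1 ∈ M)
    (hx : 0 < turn (α i) * ori i.1.1 i.1.2 x) :
    ∀ᶠ t : ℝ in 𝓝[>] 0, Corner M w α i (endpt i + t • (x - endpt i)) := by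
  filter_upwards [(tendsto_lineMap_nhdsGT (endpt i) x).eventually (h.eventually_corner hi),
    self_mem_nhdsWithin] with t ht (h0 : 0 < t)
  refine ht ?_
  rw [ori_of_mem (endpt_mem_segment i)]
  nlinarith [mul_pos h0 hx]

lemma Assigned.exists_corner (h : Assigned M w α) (hi : i.1 ∈ M) : ∃ y, Corner M w α i y := by
  have hx : 0 < turn (α i) * ori i.1.1 i.1.2
      (endpt i + (turn (α i) * turn i.2) • perp (inward i)) := by
    rw [ori_eq_cross_inward, add_sub_cancel_left, cross_smul_right, cross_perp]
    calc 0 < scal (inward i) (inward i) := scal_self_pos (inward_ne_zero h.plane hi)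
      _ = _ := by
        linear_combination (-scal (inward i) (inward i)) * turn_sq (α i) -
          turn (α i) * turn (α i) * scal (inward i) (inward i) * turn_sq i.2
  obtain ⟨t, ht⟩ := (h.eventually_corner_lineMap hi hx).exists
  exact ⟨_, ht⟩

lemma Hit.vis {W : Set Pt} (h : Hit W o (x - o) 1) {t : ℝ} (h0 : 0 < t) (h1 : t ≤ 1) :
    Vis W o (x + t • (o - x)) := by
  intro z hz
  obtain ⟨r, hr0, hr1, rfl⟩ := mem_segment_iff.1 hz
  have : o + r • (x + t • (o - x) - o) = o + (r * (1 - t)) • (x - o) := by module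
  rw [this]
  exact h.2.2 _ (mul_nonneg hr0 (by linarith)) (by nlinarith)

lemma Assigned.vis_of_sees (h : Assigned M w α) (hi : i.1 ∈ M) (hs : Sees M w α i o)
    (hy : Corner M w α i y) : Vis (walls M w) o y := by
  obtain ⟨t, h1, h2⟩ := ((h.eventually_corner_lineMap hi hs.2).and
    (Ioc_mem_nhdsGT zero_lt_one)).exists
  exact h.trans (hs.1.vis h2.1 h2.2) (h1.vis hy)

lemma Assigned.sees_of_vis (h : Assigned M w α) (hi : i.1 ∈ M) (hv : Vis (walls M w) o y)
    (hy : Corner M w α i y) : Sees M w α i o := by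
  have hpW : endpt i ∈ walls M w := mem_walls.2 (Or.inl ⟨_, hi, endpt_mem_segment i⟩)
  have hp : o + (1 : ℝ) • (endpt i - o) = endpt i := by module
  obtain ⟨t, ht, ht1⟩ := exists_hit_le h.sys.isClosed hv.left zero_le_one (by rwa [hp])
  have hcorner := h.eventually_corner_lineMap hi hy.1
  obtain rfl : t = 1 := by
    by_contra hne
    have hlt : t < 1 := lt_of_le_of_ne ht1 hne
    have h1 := Hit.eventually h.sys.isClosed ht (h.sys.noEnd _ ht.2.1 (notMem_empty _))
      (gt_mem_nhds hlt)
    have hT := (tendsto_lineMap_nhdsGT (endpt i) y).sub_const o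
    obtain ⟨r, ⟨t', ht', hh⟩, h2⟩ := ((hT.eventually h1).and hcorner).exists
    have h3 := h.trans hv (hy.vis h2)
    exact h3 _ (mem_segment_iff.2 ⟨t', hh.1.le, ht'.le, rfl⟩) hh.2.1
  refine ⟨ht, ?_⟩
  rcases lt_or_gt_of_ne (mul_ne_zero (turn_ne_zero (α i)) (h.ori_ne_zero_of_hit hi ht hp))
    with hl | hl
  · exfalso
    obtain ⟨hy0, r, hyr, hr⟩ := hy
    obtain ⟨t, h1, h2⟩ := (((tendsto_lineMap_nhdsGT (endpt i) o).eventually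
      (Metric.ball_mem_nhds _ (dist_nonneg.trans_lt hyr))).and
        (Ioc_mem_nhdsGT zero_lt_one)).exists
    have h3 := h.trans (ht.vis h2.1 h2.2).symm hv
    set z := endpt i + t • (o - endpt i) with hz
    have hz0 : turn (α i) * ori i.1.1 i.1.2 z < 0 := by
      rw [hz, ori_of_mem (endpt_mem_segment i)]
      nlinarith [mul_neg_of_pos_of_neg h2.1 hl]
    set a := turn (α i) * ori i.1.1 i.1.2 z
    set b := turn (α i) * ori i.1.1 i.1.2 y
    have hseg : z + (a / (a - b)) • (y - z) ∈ segment ℝ z y := mem_segment_iff.2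
      ⟨_, div_nonneg_of_nonpos hz0.le (by linarith), (div_le_one_of_neg (by linarith)).2
        (by linarith), rfl⟩
    refine h3 _ hseg ((hr _ ((convex_ball _ _).segment_subset h1 hyr hseg)).mem_iff.2 ?_)
    rw [ori_lineMap]
    refine (mul_eq_zero.1 ?_).resolve_left (turn_ne_zero (α i))
    have hab : a - b ≠ 0 := by linarith
    calc _ = (1 - a / (a - b)) * a + a / (a - b) * b := by simp only [a, b]; ring
      _ = 0 := by field_simp; ring
  · exact hl

end

section

open Topology Filter

variable {M : Finset (Pt × Pt)} {w : Bool → Set Pt} {U : Finset Pt} {q o d D x y z : Pt}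
  {s s' : Bool} {i j : (Pt × Pt) × Bool} {α : (Pt × Pt) × Bool → Bool}

lemma Sees.notMem (h : Sees M w α i y) : y ∉ walls M w := h.1.notMem

lemma Assigned.sees_congr (h : Assigned M w α) (hi : i.1 ∈ M) (hy : Sees M w α i y) :
    Sees M w α i z ↔ Vis (walls M w) y z := by
  obtain ⟨c, hc⟩ := h.exists_corner hi
  have hyc := h.vis_of_sees hi hy hc
  exact ⟨fun hz => h.trans hyc (h.vis_of_sees hi hz hc).symm,
    fun hz => h.sees_of_vis hi (h.trans hz.symm hyc) hc⟩

lemma Assigned.sees_of_corner (h : Assigned M w α) (hi : i.1 ∈ M) (hy : Corner M w α i y) :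
    Sees M w α i y :=
  h.sees_of_vis hi (hy.vis hy) hy

/-- The points which see the endpoint `endpt i` from the side `α i`. -/
def cell (M : Finset (Pt × Pt)) (w : Bool → Set Pt) (α : (Pt × Pt) × Bool → Bool)
    (i : (Pt × Pt) × Bool) : Set Pt := {y | Sees M w α i y}

lemma Assigned.cell_nonempty (h : Assigned M w α) (hi : i.1 ∈ M) : (cell M w α i).Nonempty :=
  (h.exists_corner hi).imp fun _ hy => h.sees_of_corner hi hy

lemma Assigned.cell_eq_iff (h : Assigned M w α) (hi : i.1 ∈ M) (hj : j.1 ∈ M)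
    (hy : y ∈ cell M w α i) : cell M w α j = cell M w α i ↔ Sees M w α j y := by
  refine ⟨fun h' => (h' ▸ hy : y ∈ cell M w α j), fun h' => ?_⟩
  ext z
  exact (h.sees_congr hj h').trans (h.sees_congr hi hy).symm

/-- The segment between two endpoints in the same cell lies in this cell. -/
lemma Assigned.sees_of_mem_openSegment (h : Assigned M w α) (hi : i.1 ∈ M) (hj : j.1 ∈ M)
    (hij : i.1 ≠ j.1) (hyi : Sees M w α i y) (hyj : Sees M w α j y)
    (hx : x ∈ openSegment ℝ (endpt i) (endpt j)) : Sees M w α i x := by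
  have key : ∀ i j : (Pt × Pt) × Bool, i.1 ∈ M → j.1 ∈ M → i.1 ≠ j.1 → Sees M w α i y →
      Sees M w α j y → 0 < turn (α i) * ori i.1.1 i.1.2 (endpt j) := by
    intro i j hi hj hij hyi hyj
    have hne : ori i.1.1 i.1.2 (endpt j) ≠ 0 := by
      have h1 : ∀ x, x = i.1.1 ∨ x = i.1.2 → x ≠ endpt j := by
        intro x hx hxj
        refine hij (h.plane.eq_of_mem _ hi _ hj (endpt j) ?_ (endpt_mem_segment j))
        rw [← hxj]
        rcases hx with rfl | rfl
        exacts [left_mem_segment _ _ _, right_mem_segment _ _ _]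
      exact h.plane.ori_ne _ (mem_endpoints.2 ⟨_, hi, Or.inl rfl⟩) _
        (mem_endpoints.2 ⟨_, hi, Or.inr rfl⟩) _ (endpt_mem_endpoints hj) (h.plane.ne _ hi)
        (h1 _ (Or.inl rfl)) (h1 _ (Or.inr rfl))
    have hT : Tendsto (fun t : ℝ =>
        turn (α i) * ori i.1.1 i.1.2 (endpt j + t • (y - endpt j))) (𝓝[>] 0)
        (𝓝 (turn (α i) * ori i.1.1 i.1.2 (endpt j))) :=
      (((continuous_ori _ _).const_mul _).tendsto _).comp (tendsto_lineMap_nhdsGT _ _)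
    refine lt_of_le_of_ne (ge_of_tendsto hT ?_) (mul_ne_zero (turn_ne_zero _) hne).symm
    filter_upwards [h.eventually_corner_lineMap hj hyj.2] with t ht
    exact ((h.sees_congr hi hyi).2 ((h.sees_congr hj hyj).1 (h.sees_of_corner hj ht))).2.le
  obtain ⟨r, h0, h1, rfl⟩ := mem_openSegment_iff.1 hx
  obtain ⟨t, ⟨hci, hcj⟩, ht0, ht1⟩ :=
    (((h.eventually_corner_lineMap hi (key i j hi hj hij hyi hyj)).and
      (h.eventually_corner_lineMap hj (key j i hj hi hij.symm hyj hyi))).and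
      (Ioo_mem_nhdsGT (lt_min h0 (sub_pos.2 h1)))).exists
  have hsi := h.sees_of_corner hi hci
  have hsj := (h.sees_congr hi hyi).2 ((h.sees_congr hj hyj).1 (h.sees_of_corner hj hcj))
  have hv := (h.sees_congr hi hsi).1 hsj
  refine (h.sees_congr hi hsi).2 (hv.mono (left_mem_segment _ _ _) ?_)
  have htr : t < r := ht1.trans_le (min_le_left _ _)
  have htr' : t < 1 - r := ht1.trans_le (min_le_right _ _)
  have hpos : 0 < 1 - 2 * t := by linarith
  refine mem_segment_iff.2 ⟨(r - t) / (1 - 2 * t), by apply div_nonneg <;> linarith,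
    (div_le_one hpos).2 (by linarith), ?_⟩
  have h2 : endpt j + t • (endpt i - endpt j) - (endpt i + t • (endpt j - endpt i)) =
      (1 - 2 * t) • (endpt j - endpt i) := by module
  rw [h2, smul_smul, div_mul_cancel₀ _ hpos.ne']
  module

/-- A cell with corners on both sides of a line meets the line. -/
lemma Assigned.exists_sees_line (h : Assigned M w α) (hD : D ≠ 0) (hi : i.1 ∈ M) (hj : j.1 ∈ M)
    (hyi : Sees M w α i y) (hyj : Sees M w α j y)
    (hij : cross D (endpt i - q) * cross D (endpt j - q) < 0) :
    ∃ τ : ℝ, Sees M w α i (q + τ • D) := by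
  have hg : Continuous fun x : Pt => cross D (x - q) := by unfold cross; fun_prop
  have h1 : Tendsto (fun t : ℝ => cross D (endpt i + t • (y - endpt i) - q) *
      cross D (endpt j + t • (y - endpt j) - q)) (𝓝[>] 0)
      (𝓝 (cross D (endpt i - q) * cross D (endpt j - q))) :=
    ((hg.tendsto _).comp (tendsto_lineMap_nhdsGT _ _)).mul
      ((hg.tendsto _).comp (tendsto_lineMap_nhdsGT _ _))
  obtain ⟨t, ⟨hci, hcj⟩, ht⟩ := (((h.eventually_corner_lineMap hi hyi.2).and
    (h.eventually_corner_lineMap hj hyj.2)).and (h1.eventually_lt_const hij)).exists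
  have hsi := h.sees_of_corner hi hci
  have hsj := (h.sees_congr hi hyi).2 ((h.sees_congr hj hyj).1 (h.sees_of_corner hj hcj))
  have hv := (h.sees_congr hi hsi).1 hsj
  obtain ⟨τ, hτ⟩ := exists_line_mem_openSegment hD ht
  exact ⟨τ, (h.sees_congr hi hsi).2
    (hv.mono (left_mem_segment _ _ _) (openSegment_subset_segment _ _ _ hτ))⟩

lemma sum_product_bool (M : Finset (Pt × Pt)) (p : (Pt × Pt) × Bool → Prop)
    [DecidablePred p] :
    ∑ i ∈ M ×ˢ (univ : Finset Bool), (if p i then turn i.2 else 0) =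
      ∑ e : M, (if p (e, true) then 1 else 0) - ∑ e : M, (if p (e, false) then 1 else 0) := by
  rw [Finset.sum_product, ← Finset.sum_sub_distrib, ← Finset.sum_coe_sort M]
  refine Finset.sum_congr rfl fun e _ => ?_
  rw [Fintype.sum_bool]
  split_ifs <;> norm_num [turn]

/-- Every cell has as many first as second endpoints. -/
lemma Assigned.card_eq (h : Assigned M w α) (c : Set Pt) :
    Fintype.card {e : M // cell M w α (e, true) = c} =
      Fintype.card {e : M // cell M w α (e, false) = c} := by
  have hmain : ∀ i : (Pt × Pt) × Bool, i.1 ∈ M → cell M w α i = c →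
      Fintype.card {e : M // cell M w α (e, true) = c} =
        Fintype.card {e : M // cell M w α (e, false) = c} := by
    rintro i hi rfl
    obtain ⟨y, hy⟩ := h.cell_nonempty hi
    have h1 := h.sum_seen (Sees.notMem hy)
    rw [sum_product_bool, sub_eq_zero, Finset.sum_boole, Finset.sum_boole, Nat.cast_inj] at h1
    rw [Fintype.card_subtype, Fintype.card_subtype]
    convert h1 using 3 with e _ e _ <;> exact h.cell_eq_iff hi (Subtype.coe_prop _) hy
  by_cases hc : ∃ i : (Pt × Pt) × Bool, i.1 ∈ M ∧ cell M w α i = c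
  · obtain ⟨i, hi, hic⟩ := hc
    exact hmain i hi hic
  · push Not at hc
    have h1 : IsEmpty {e : M // cell M w α (e, true) = c} := ⟨fun e => hc _ e.1.2 e.2⟩
    have h2 : IsEmpty {e : M // cell M w α (e, false) = c} := ⟨fun e => hc _ e.1.2 e.2⟩
    rw [Fintype.card_eq_zero, Fintype.card_eq_zero]

lemma sum_perm_swap {E A : Type*} [Fintype E] [DecidableEq E] [AddCommMonoid A] (π : Equiv.Perm E)
    {e e' : E} (hne : e ≠ e') (f : E → E → A) :
    ∃ r, ∑ x, f x (π x) = f e (π e) + f e' (π e') + r ∧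
      ∑ x, f x ((π * Equiv.swap e e') x) = f e (π e') + f e' (π e) + r := by
  have h1 : ∀ g : E → A, ∑ x, g x = g e + g e' + ∑ x ∈ (univ.erase e).erase e', g x := by
    intro g
    rw [add_assoc, Finset.add_sum_erase _ _ (mem_erase.2 ⟨hne.symm, mem_univ _⟩),
      Finset.add_sum_erase _ _ (mem_univ _)]
  refine ⟨_, h1 _, ?_⟩
  rw [h1]
  congr 1
  · simp
  · refine Finset.sum_congr rfl fun x hx => ?_
    simp only [mem_erase] at hx
    rw [Equiv.Perm.mul_apply, Equiv.swap_apply_of_ne_of_ne hx.2.1 hx.1]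

/-- There is a class-preserving assignment that cannot be improved by a swap within a class. -/
lemma exists_perm_of_card_eq {E κ : Type*} [Fintype E] [DecidableEq E] (a b : E → κ)
    (hab : ∀ c, Fintype.card {e // a e = c} = Fintype.card {e // b e = c})
    (χ : E → E → ℕ) (L : E → E → ℝ) :
    ∃ π : Equiv.Perm E, (∀ e, a e = b (π e)) ∧ ∀ e e', e ≠ e' → a e = a e' →
      χ e (π e) + χ e' (π e') ≤ χ e (π e') + χ e' (π e) ∧
      (χ e (π e) + χ e' (π e') = χ e (π e') + χ e' (π e) →
        L e (π e) + L e' (π e') ≤ L e (π e') + L e' (π e)) := by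
  let S : Finset (Equiv.Perm E) := univ.filter fun π => ∀ e, a e = b (π e)
  have hS : S.Nonempty :=
    ⟨Equiv.ofFiberEquiv fun c => Fintype.equivOfCardEq (hab c),
      mem_filter.2 ⟨mem_univ _, fun e => (Equiv.ofFiberEquiv_map _ e).symm⟩⟩
  obtain ⟨π, hπ, hmin⟩ := S.exists_min_image
    (fun π => toLex (∑ e, χ e (π e), ∑ e, L e (π e))) hS
  have hπ' := (mem_filter.1 hπ).2
  refine ⟨π, hπ', fun e e' hne haa => ?_⟩
  have h1 := hmin (π * Equiv.swap e e') (mem_filter.2 ⟨mem_univ _, fun x => by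
    rw [Equiv.Perm.mul_apply, ← hπ']
    rcases eq_or_ne x e with rfl | h1
    · rw [Equiv.swap_apply_left, haa]
    rcases eq_or_ne x e' with rfl | h2
    · rw [Equiv.swap_apply_right, haa]
    rw [Equiv.swap_apply_of_ne_of_ne h1 h2]⟩)
  obtain ⟨r, hr1, hr2⟩ := sum_perm_swap π hne χ
  obtain ⟨r', hr1', hr2'⟩ := sum_perm_swap π hne L
  simp only [hr1, hr2, hr1', hr2', Prod.Lex.toLex_le_toLex] at h1
  constructor
  · rcases h1 with h1 | h1 <;> omega
  · intro heq
    rcases h1 with h1 | h1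
    · omega
    · linarith [h1.2]

end

section

open Topology Filter

variable {M : Finset (Pt × Pt)} {w : Bool → Set Pt} {U : Finset Pt} {q o d D x y z : Pt}
  {s s' : Bool} {i j : (Pt × Pt) × Bool} {α : (Pt × Pt) × Bool → Bool} {Γ : Finset (ℝ × ℝ)}

/-- `1` if the segment `bc` crosses the line through `q` in direction `D`, and `0` otherwise. -/
noncomputable def crossNum (q D b c : Pt) : ℕ :=
  if cross D (b - q) * cross D (c - q) < 0 then 1 else 0

/-- Uncrossing two segments does not increase the number of crossings with a line. -/
lemma crossNum_swap_le {b r b' r' : Pt} (hx : x ∈ openSegment ℝ b r)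
    (hx' : x ∈ openSegment ℝ b' r') (hb : cross D (b - q) ≠ 0) (hr : cross D (r - q) ≠ 0)
    (hb' : cross D (b' - q) ≠ 0) (hr' : cross D (r' - q) ≠ 0) :
    crossNum q D b r' + crossNum q D b' r ≤ crossNum q D b r + crossNum q D b' r' := by
  obtain ⟨t, h0, h1, rfl⟩ := mem_openSegment_iff.1 hx
  obtain ⟨t', h0', h1', hxx⟩ := mem_openSegment_iff.1 hx'
  have hlin : ∀ t : ℝ, ∀ b r : Pt, cross D (b + t • (r - b) - q) =
      (1 - t) * cross D (b - q) + t * cross D (r - q) := by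
    intro t b r; simp [cross]; ring
  have key : (1 - t) * cross D (b - q) + t * cross D (r - q) =
      (1 - t') * cross D (b' - q) + t' * cross D (r' - q) := by
    rw [← hlin, ← hlin, hxx]
  unfold crossNum
  generalize cross D (b - q) = B, cross D (r - q) = R, cross D (b' - q) = B',
    cross D (r' - q) = R' at *
  have ht : 0 < 1 - t := by linarith
  have ht' : 0 < 1 - t' := by linarith
  rcases lt_or_gt_of_ne hb with hb | hb <;> rcases lt_or_gt_of_ne hr with hr | hr <;>
    rcases lt_or_gt_of_ne hb' with hb' | hb' <;> rcases lt_or_gt_of_ne hr' with hr' | hr' <;>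
    simp only [mul_neg_iff, hb, hr, hb', hr', hb.not_gt, hr.not_gt, hb'.not_gt, hr'.not_gt,
      and_self, and_true, and_false, or_true, or_false, or_self, if_true, if_false] <;>
    try norm_num
  · nlinarith [mul_pos ht (neg_pos.2 hb), mul_pos h0 (neg_pos.2 hr), mul_pos ht' hb',
      mul_pos h0' hr']
  · nlinarith [mul_pos ht hb, mul_pos h0 hr, mul_pos ht' (neg_pos.2 hb'),
      mul_pos h0' (neg_pos.2 hr')]

/-- The Euclidean distance. -/
noncomputable def eudist (b c : Pt) : ℝ :=
  dist ((WithLp.linearEquiv 2 ℝ (ℝ × ℝ)).symm b) ((WithLp.linearEquiv 2 ℝ (ℝ × ℝ)).symm c)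

lemma eudist_add_eq_iff {a b c : Pt} :
    eudist a b + eudist b c = eudist a c ↔ b ∈ segment ℝ a c := by
  unfold eudist
  rw [dist_add_dist_eq_iff, ← mem_segment_iff_wbtw]
  have := image_segment ℝ
    (WithLp.linearEquiv 2 ℝ (ℝ × ℝ)).symm.toLinearMap.toAffineMap a c
  simp only [LinearMap.coe_toAffineMap, LinearEquiv.coe_coe] at this
  rw [← this, (LinearEquiv.injective _).mem_set_image]

/-- Uncrossing two segments makes them shorter. -/
lemma eudist_swap_lt {b r b' r' : Pt} (hx : x ∈ openSegment ℝ b r)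
    (hx' : x ∈ segment ℝ b' r') (hori : ori b r r' ≠ 0) :
    eudist b r' + eudist b' r < eudist b r + eudist b' r' := by
  have h1 := eudist_add_eq_iff.2 (openSegment_subset_segment _ _ _ hx)
  have h2 := eudist_add_eq_iff.2 hx'
  have h3 : eudist b' r ≤ eudist b' x + eudist x r := dist_triangle _ _ _
  have h4 : eudist b r' ≤ eudist b x + eudist x r' := dist_triangle _ _ _
  have h5 : eudist b r' ≠ eudist b x + eudist x r' := by
    intro h5
    have h6 := ori_eq_zero_of_mem_segment (eudist_add_eq_iff.1 h5.symm)
    obtain ⟨t, h0, -, rfl⟩ := mem_openSegment_iff.1 hx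
    have h7 : ori b r' (b + t • (r - b)) = -(t * ori b r r') := by
      simp [ori, cross]; ring
    rw [h7, neg_eq_zero] at h6
    exact hori ((mul_eq_zero.1 h6).resolve_left h0.ne')
  have := lt_of_le_of_ne h4 h5
  linarith

/-- The endpoints can be matched within the cells, without crossings, such that at most one
edge per gap crosses the line. -/
theorem Assigned.exists_perm (h : Assigned M w α) (hD : D ≠ 0)
    (hqg : ∀ p ∈ endpoints M, cross D (p - q) ≠ 0) (hΓ : Gaps (walls M w) q D Γ) :
    ∃ π : Equiv.Perm M,
      (∀ e : M, π e ≠ e → ∀ x ∈ openSegment ℝ e.1.1 (π e).1.2, x ∉ edgeUnion M) ∧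
      (∀ e e' : M, e ≠ e' → ∀ x ∈ segment ℝ e.1.1 (π e).1.2,
        x ∉ segment ℝ e'.1.1 (π e').1.2) ∧
      (univ.filter fun e : M =>
        cross D (e.1.1 - q) * cross D ((π e).1.2 - q) < 0).card ≤ Γ.card := by
  obtain ⟨π, hπ, hmin⟩ := exists_perm_of_card_eq (fun e : M => cell M w α (e, true))
    (fun e : M => cell M w α (e, false)) h.card_eq (fun e e' => crossNum q D e.1.1 e'.1.2)
    (fun e e' => eudist e.1.1 e'.1.2)
  have hb : ∀ e : M, e.1.1 ∈ endpoints M := fun e => mem_endpoints.2 ⟨_, e.2, Or.inl rfl⟩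
  have hr : ∀ e : M, e.1.2 ∈ endpoints M := fun e => mem_endpoints.2 ⟨_, e.2, Or.inr rfl⟩
  have hsees : ∀ (e : M) y, Sees M w α (e, true) y ↔ Sees M w α (π e, false) y := fun e y =>
    Set.ext_iff.1 (hπ e) y
  have hcell : ∀ (e e' : M) y, Sees M w α (e, true) y → Sees M w α (e', true) y →
      cell M w α (e, true) = cell M w α (e', true) := fun e e' y hy hy' =>
    (h.cell_eq_iff (i := (e'.1, true)) (j := (e.1, true)) e'.2 e.2 hy').2 hy
  have hopen : ∀ e : M, π e ≠ e → ∀ x ∈ openSegment ℝ e.1.1 (π e).1.2,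
      Sees M w α (e, true) x := by
    intro e hne x hx
    obtain ⟨y, hy⟩ := h.cell_nonempty (i := (e.1, true)) e.2
    exact h.sees_of_mem_openSegment (i := (e.1, true)) (j := ((π e).1, false)) e.2 (π e).2
      (fun h' => hne (Subtype.ext h'.symm)) hy ((hsees e y).1 hy) hx
  have hopenE : ∀ e : M, π e ≠ e → ∀ x ∈ openSegment ℝ e.1.1 (π e).1.2, x ∉ edgeUnion M :=
    fun e hne x hx hE => (hopen e hne x hx).notMem (mem_walls.2 (Or.inl hE))
  have hcase : ∀ (e : M), ∀ x ∈ segment ℝ e.1.1 (π e).1.2,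
      x = e.1.1 ∨ x = (π e).1.2 ∨ x ∈ openSegment ℝ e.1.1 (π e).1.2 := by
    intro e x hx
    by_cases h1 : x = e.1.1
    · exact Or.inl h1
    by_cases h2 : x = (π e).1.2
    · exact Or.inr (Or.inl h2)
    exact Or.inr (Or.inr (mem_openSegment_of_mem hx h1 h2))
  have hbne : ∀ e e' : M, e ≠ e' → e.1.1 ≠ e'.1.1 := fun e e' hne h' =>
    hne (Subtype.ext (congrArg Prod.fst (endpt_injective h.plane (i := (e.1, true))
      (j := (e'.1, true)) e.2 e'.2 h')))
  have hrne : ∀ e e' : M, e ≠ e' → (π e).1.2 ≠ (π e').1.2 := fun e e' hne h' =>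
    hne (π.injective (Subtype.ext (congrArg Prod.fst (endpt_injective h.plane
      (i := ((π e).1, false)) (j := ((π e').1, false)) (π e).2 (π e').2 h'))))
  have hbr : ∀ e e' : M, e.1.1 ≠ e'.1.2 := fun e e' h' =>
    Bool.noConfusion (congrArg Prod.snd (endpt_injective h.plane
      (i := (e.1, true)) (j := (e'.1, false)) e.2 e'.2 h'))
  have hfix : ∀ e e' : M, e ≠ e' → π e = e → ∀ x ∈ segment ℝ e.1.1 (π e).1.2,
      x ∉ segment ℝ e'.1.1 (π e').1.2 := by
    intro e e' hne hfe x hx hx'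
    rw [hfe] at hx
    have hne' : e ≠ π e' := fun h' => hne (π.injective (hfe.trans h'))
    by_cases hfe' : π e' = e'
    · rw [hfe'] at hx'
      exact hne (Subtype.ext (h.plane.eq_of_mem _ e.2 _ e'.2 x hx hx'))
    rcases hcase e' x hx' with rfl | rfl | hx'
    · exact hne (Subtype.ext (h.plane.eq_of_mem _ e.2 _ e'.2 _ hx (left_mem_segment _ _ _)))
    · exact hne' (Subtype.ext (h.plane.eq_of_mem _ e.2 _ (π e').2 _ hx (right_mem_segment _ _ _)))
    · exact hopenE e' hfe' x hx' ⟨_, e.2, hx⟩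
  refine ⟨π, hopenE, fun e e' hne x hx hx' => ?_, ?_⟩
  · by_cases hfe : π e = e
    · exact hfix e e' hne hfe x hx hx'
    by_cases hfe' : π e' = e'
    · exact hfix e' e hne.symm hfe' x hx' hx
    have hE : ∀ e : M, π e ≠ e → x ∈ openSegment ℝ e.1.1 (π e).1.2 → x ∉ endpoints M :=
      fun e hfe hx hx' => hopenE e hfe x hx (endpoint_mem_edgeUnion hx')
    rcases hcase e x hx with h1 | h1 | h1 <;> rcases hcase e' x hx' with h2 | h2 | h2
    · exact hbne e e' hne (h1.symm.trans h2)
    · exact hbr _ _ (h1.symm.trans h2)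
    · exact hE e' hfe' h2 (h1 ▸ hb e)
    · exact hbr _ _ (h2.symm.trans h1)
    · exact hrne e e' hne (h1.symm.trans h2)
    · exact hE e' hfe' h2 (h1 ▸ hr (π e))
    · exact hE e hfe h1 (h2 ▸ hb e')
    · exact hE e hfe h1 (h2 ▸ hr (π e'))
    · obtain ⟨h3, h4⟩ := hmin e e' hne (hcell e e' x (hopen e hfe x h1) (hopen e' hfe' x h2))
      have h5 := crossNum_swap_le (D := D) (q := q) h1 h2 (hqg _ (hb _)) (hqg _ (hr _))
        (hqg _ (hb _)) (hqg _ (hr _))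
      have h6 := eudist_swap_lt h1 (openSegment_subset_segment _ _ _ h2)
        (h.plane.ori_ne _ (hb _) _ (hr _) _ (hr _) (hbr _ _) (hbr _ _) (hrne e e' hne))
      exact absurd (h4 (le_antisymm h3 h5)) h6.not_ge
  · -- crossing edges of the same cell cross in the same direction
    have hdir : ∀ (e e' : M) y, Sees M w α (e, true) y → Sees M w α (e', true) y →
        cross D (e.1.1 - q) * cross D ((π e).1.2 - q) < 0 →
        cross D (e'.1.1 - q) * cross D ((π e').1.2 - q) < 0 →
        0 < cross D (e.1.1 - q) * cross D (e'.1.1 - q) := by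
      intro e e' y hy hy' hc hc'
      by_cases hne : e = e'
      · subst hne; exact mul_self_pos.2 (hqg _ (hb e))
      by_contra hcon
      have h1 : cross D (e.1.1 - q) * cross D (e'.1.1 - q) < 0 :=
        lt_of_le_of_ne (not_lt.1 hcon) (mul_ne_zero (hqg _ (hb e)) (hqg _ (hb e')))
      have h2 := (hmin e e' hne (hcell e e' y hy hy')).1
      simp only [crossNum] at h2
      rw [if_pos hc, if_pos hc', if_neg, if_neg] at h2
      · omega
      · rcases mul_neg_iff.1 h1 with h1 | h1 <;> rcases mul_neg_iff.1 hc with h3 | h3 <;>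
          nlinarith
      · rcases mul_neg_iff.1 h1 with h1 | h1 <;> rcases mul_neg_iff.1 hc' with h3 | h3 <;>
          nlinarith
    have hτ : ∀ e : M, cross D (e.1.1 - q) * cross D ((π e).1.2 - q) < 0 →
        ∃ τ : ℝ, Sees M w α (e, true) (q + τ • D) := by
      intro e hc
      obtain ⟨y, hy⟩ := h.cell_nonempty (i := (e.1, true)) e.2
      exact h.exists_sees_line (i := (e.1, true)) (j := ((π e).1, false)) hD e.2 (π e).2 hy
        ((hsees e y).1 hy) hc
    have hγ : ∀ e : M, ∃ γ : ℝ × ℝ, cross D (e.1.1 - q) * cross D ((π e).1.2 - q) < 0 →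
        γ ∈ Γ ∧ ∃ τ : ℝ, Sees M w α (e, true) (q + τ • D) ∧ γ.1 < τ ∧ τ < γ.2 := by
      intro e
      by_cases hc : cross D (e.1.1 - q) * cross D ((π e).1.2 - q) < 0
      · obtain ⟨τ, h1⟩ := hτ e hc
        obtain ⟨γ, h2, h3⟩ := hΓ.cover τ h1.notMem
        exact ⟨γ, fun _ => ⟨h2, τ, h1, h3⟩⟩
      · exact ⟨0, fun h' => absurd h' hc⟩
    choose γ hγ using hγ
    refine Finset.card_le_card_of_injOn γ (fun e he => (hγ e (mem_filter.1 he).2).1) ?_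
    intro e he e' he' hee
    replace he := (mem_filter.1 he).2
    replace he' := (mem_filter.1 he').2
    obtain ⟨hΓe, τ, hτ, h1, h2⟩ := hγ e he
    obtain ⟨-, τ', hτ', h1', h2'⟩ := hγ e' he'
    rw [← hee] at h1' h2'
    have hvis : Vis (walls M w) (q + τ' • D) (q + τ • D) := by
      intro z hz
      obtain ⟨t, h3, h4, rfl⟩ := mem_segment_iff.1 hz
      have : q + τ' • D + t • (q + τ • D - (q + τ' • D)) = q + ((1 - t) * τ' + t * τ) • D := by
        module
      rw [this]
      refine hΓ.free _ hΓe _ ?_ ?_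
      · rcases h3.eq_or_lt with rfl | h3 <;> nlinarith
      · rcases h3.eq_or_lt with rfl | h3 <;> nlinarith
    have hτ'' := (h.sees_congr (i := (e'.1, true)) e'.2 hτ').2 hvis
    by_contra hne
    set y := q + τ • D with hy
    have hg : ∀ p : Pt, cross D (p - y) = cross D (p - q) := by
      intro p; simp [hy, cross]; ring
    have hsum := h.abs_sum_half_le hτ.notMem hD (fun x hx => by rw [hg]; exact hqg x hx)
    rw [sum_product_bool M fun i => Sees M w α i y ∧ 0 < cross D (endpt i - y),
      ← Equiv.sum_comp π fun e : M =>
        if Sees M w α (e.1, false) y ∧ 0 < cross D (endpt (e.1, false) - y) then (1 : ℝ) else 0,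
      ← Finset.sum_sub_distrib] at hsum
    obtain ⟨s, hs⟩ := turn_mul_pos_or (hqg _ (hb e))
    set F : M → ℝ := fun e =>
      (if Sees M w α (e.1, true) y ∧ 0 < cross D (endpt (e.1, true) - q) then (1 : ℝ) else 0) -
      (if Sees M w α (e.1, true) y ∧ 0 < cross D (endpt ((π e).1, false) - q) then 1 else 0)
      with hF
    replace hsum : |∑ x, F x| ≤ 1 := by
      convert hsum using 5 <;> simp only [hsees, hg]
    have hF1 : ∀ x : M, Sees M w α (x.1, true) y →
        cross D (x.1.1 - q) * cross D ((π x).1.2 - q) < 0 → turn s * F x = 1 := by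
      intro x hx hxc
      have h3 := hdir e x y hτ hx he hxc
      have e1 : endpt (x.1, true) = x.1.1 := rfl
      have e2 : endpt ((π x).1, false) = (π x).1.2 := rfl
      simp only [hF, hx, true_and, e1, e2]
      rcases mul_neg_iff.1 hxc with h4 | h4
      · rw [if_pos h4.1, if_neg h4.2.not_gt]
        have h5 := (pos_iff_pos_of_mul_pos h3).2 h4.1
        cases s <;> simp [turn] at hs ⊢
        linarith
      · rw [if_neg h4.1.not_gt, if_pos h4.2]
        have h5 : cross D (e.1.1 - q) < 0 := by nlinarith
        cases s <;> simp [turn] at hs ⊢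
        linarith
    have hF0 : ∀ x : M, 0 ≤ turn s * F x := by
      intro x
      by_cases hx : Sees M w α (x.1, true) y
      · by_cases hxc : cross D (x.1.1 - q) * cross D ((π x).1.2 - q) < 0
        · rw [hF1 x hx hxc]; norm_num
        · have e1 : endpt (x.1, true) = x.1.1 := rfl
          have e2 : endpt ((π x).1, false) = (π x).1.2 := rfl
          have h3 : 0 < cross D (x.1.1 - q) ↔ 0 < cross D ((π x).1.2 - q) := by
            have h4 := lt_of_le_of_ne (not_lt.1 hxc)
              (mul_ne_zero (hqg _ (hb x)) (hqg _ (hr (π x)))).symm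
            exact pos_iff_pos_of_mul_pos h4
          simp only [hF, e1, e2, h3, sub_self, mul_zero, le_refl]
      · simp [hF, hx]
    have h3 : turn s * F e + turn s * F e' ≤ ∑ x, turn s * F x := by
      rw [← Finset.sum_pair hne (f := fun x => turn s * F x)]
      exact Finset.sum_le_sum_of_subset_of_nonneg (subset_univ _) fun x _ _ => hF0 x
    rw [hF1 e hτ he, hF1 e' hτ'' he', ← Finset.mul_sum] at h3
    have h4 : |turn s| = 1 := by cases s <;> simp [turn]
    have h5 := (le_abs_self _).trans' h3
    rw [abs_mul, h4, one_mul] at h5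
    linarith

end

section

open Topology Filter

variable {B R : Finset Pt} {M : Finset (Pt × Pt)} {q D : Pt}

lemma collinear_of_ori_eq_zero {p q r : Pt} (hpq : p ≠ q) (h : ori p q r = 0) :
    Collinear ℝ ({p, q, r} : Set Pt) := by
  have hr : ∃ t : ℝ, r = p + t • (q - p) := by
    have hne : (q.1 - p.1) ^ 2 + (q.2 - p.2) ^ 2 ≠ 0 := by
      intro h0
      refine hpq (Prod.ext ?_ ?_) <;> nlinarith [sq_nonneg (q.1 - p.1), sq_nonneg (q.2 - p.2)]
    refine ⟨((r.1 - p.1) * (q.1 - p.1) + (r.2 - p.2) * (q.2 - p.2)) /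
      ((q.1 - p.1) ^ 2 + (q.2 - p.2) ^ 2), ?_⟩
    simp only [ori, cross, Prod.fst_sub, Prod.snd_sub] at h
    ext
    · simp only [Prod.fst_add, Prod.smul_fst, Prod.fst_sub, smul_eq_mul]
      field_simp
      linear_combination (-(q.2 - p.2)) * h
    · simp only [Prod.snd_add, Prod.smul_snd, Prod.snd_sub, smul_eq_mul]
      field_simp
      linear_combination (q.1 - p.1) * h
  obtain ⟨t, rfl⟩ := hr
  refine (collinear_iff_of_mem (p₀ := p) (by simp)).2 ⟨q - p, ?_⟩
  rintro x (rfl | rfl | rfl)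
  · exact ⟨0, by simp⟩
  · exact ⟨1, by simp⟩
  · exact ⟨t, by simp [add_comm]⟩

lemma IsBRMatching.endpoints_subset (hM : IsBRMatching B R M) {p : Pt} (hp : p ∈ endpoints M) :
    p ∈ B ∪ R := by
  obtain ⟨e, he, rfl | rfl⟩ := mem_endpoints.1 hp
  · exact mem_union_left _ (hM.1 e he).1
  · exact mem_union_right _ (hM.1 e he).2

lemma IsBRMatching.planeMatching (hM : IsBRMatching B R M) (hdisj : B ∩ R = ∅)
    (hgen : GenPos (B ∪ R)) : PlaneMatching M where
  ne e he h := by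
    have h1 : e.1 ∈ B ∩ R := mem_inter.2 ⟨(hM.1 e he).1, h ▸ (hM.1 e he).2⟩
    simp [hdisj] at h1
  ori_ne p hp q hq r hr hpq hpr hqr h :=
    hgen p (hM.endpoints_subset hp) q (hM.endpoints_subset hq) r (hM.endpoints_subset hr)
      hpq hpr hqr (collinear_of_ori_eq_zero hpq h)
  eq_of_mem e he e' he' x hx hx' := by
    by_contra hne
    have h1 := hM.2.2.2 e he e' he' hne
    exact Set.notMem_empty x (h1 ▸ ⟨hx, hx'⟩)

lemma IsBRMatching.card_filter_fst (hM : IsBRMatching B R M) (p : Pt → Prop) :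
    (M.filter fun e => p e.1).card = (B.filter p).card := by
  refine Finset.card_nbij Prod.fst (fun e he => ?_) (fun e he e' he' h => ?_) fun b hb => ?_
  · rw [mem_coe, mem_filter] at he ⊢
    exact ⟨(hM.1 e he.1).1, he.2⟩
  · rw [mem_coe, mem_filter] at he he'
    exact (hM.2.1 e.1 (hM.1 e he.1).1).unique ⟨he.1, rfl⟩ ⟨he'.1, h.symm⟩
  · rw [mem_coe, mem_filter] at hb
    obtain ⟨e, ⟨he, rfl⟩, -⟩ := hM.2.1 b hb.1
    exact ⟨e, mem_coe.2 (mem_filter.2 ⟨he, hb.2⟩), rfl⟩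

lemma IsBRMatching.card_filter_snd (hM : IsBRMatching B R M) (p : Pt → Prop) :
    (M.filter fun e => p e.2).card = (R.filter p).card := by
  refine Finset.card_nbij Prod.snd (fun e he => ?_) (fun e he e' he' h => ?_) fun b hb => ?_
  · rw [mem_coe, mem_filter] at he ⊢
    exact ⟨(hM.1 e he.1).2, he.2⟩
  · rw [mem_coe, mem_filter] at he he'
    exact (hM.2.2.1 e.2 (hM.1 e he.1).2).unique ⟨he.1, rfl⟩ ⟨he'.1, h.symm⟩
  · rw [mem_coe, mem_filter] at hb
    obtain ⟨e, ⟨he, rfl⟩, -⟩ := hM.2.2.1 b hb.1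
    exact ⟨e, mem_coe.2 (mem_filter.2 ⟨he, hb.2⟩), rfl⟩

/-- If the line through `q` in direction `D` has as many blue as red points on one side, then
edges cross it in both directions as soon as some edge crosses it. -/
lemma IsBRMatching.exists_cross_both (hM : IsBRMatching B R M)
    (hqg : ∀ p ∈ B ∪ R, cross D (p - q) ≠ 0)
    (hbal : (B.filter fun p => cross D (p - q) < 0).card =
      (R.filter fun p => cross D (p - q) < 0).card)
    (hex : ∃ e ∈ M, cross D (e.1 - q) * cross D (e.2 - q) < 0) :
    (∃ e ∈ M, 0 < cross D (e.1 - q) ∧ cross D (e.2 - q) < 0) ∧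
      ∃ e ∈ M, cross D (e.1 - q) < 0 ∧ 0 < cross D (e.2 - q) := by
  have hcard : (M.filter fun e => cross D (e.1 - q) < 0).card =
      (M.filter fun e => cross D (e.2 - q) < 0).card := by
    rw [hM.card_filter_fst fun p => cross D (p - q) < 0,
      hM.card_filter_snd fun p => cross D (p - q) < 0, hbal]
  have hne1 : ∀ e ∈ M, cross D (e.1 - q) ≠ 0 := fun e he =>
    hqg _ (mem_union_left _ (hM.1 e he).1)
  have hne2 : ∀ e ∈ M, cross D (e.2 - q) ≠ 0 := fun e he =>
    hqg _ (mem_union_right _ (hM.1 e he).2)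
  by_contra hcon
  have hiff : ∀ e ∈ M, cross D (e.1 - q) < 0 ↔ cross D (e.2 - q) < 0 := by
    rcases not_and_or.1 hcon with h | h
    · have hsub : (M.filter fun e => cross D (e.2 - q) < 0) ⊆
          M.filter fun e => cross D (e.1 - q) < 0 := by
        intro e he
        rw [mem_filter] at he ⊢
        refine ⟨he.1, lt_of_not_ge fun h' => h ⟨e, he.1, ?_, he.2⟩⟩
        exact lt_of_le_of_ne h' (hne1 e he.1).symm
      have heq := Finset.eq_of_subset_of_card_le hsub hcard.le
      intro e he
      have := Finset.ext_iff.1 heq e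
      simp only [mem_filter, he, true_and] at this
      exact this.symm
    · have hsub : (M.filter fun e => cross D (e.1 - q) < 0) ⊆
          M.filter fun e => cross D (e.2 - q) < 0 := by
        intro e he
        rw [mem_filter] at he ⊢
        refine ⟨he.1, lt_of_not_ge fun h' => h ⟨e, he.1, he.2, ?_⟩⟩
        exact lt_of_le_of_ne h' (hne2 e he.1).symm
      have heq := Finset.eq_of_subset_of_card_le hsub hcard.ge
      intro e he
      have := Finset.ext_iff.1 heq e
      simp only [mem_filter, he, true_and] at this
      exact this
  obtain ⟨e, he, h⟩ := hex
  rcases mul_neg_iff.1 h with h | h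
  · exact ((hiff e he).2 h.2).not_gt h.1
  · exact ((hiff e he).1 h.1).not_gt h.2

/-- Recombining the edges of a matching along a permutation. -/
lemma IsBRMatching.image_perm (hM : IsBRMatching B R M) (π : Equiv.Perm M)
    (hπ : ∀ e e' : M, e ≠ e' → ∀ x ∈ segment ℝ e.1.1 (π e).1.2,
      x ∉ segment ℝ e'.1.1 (π e').1.2) :
    IsBRMatching B R (univ.image fun e : M => (e.1.1, (π e).1.2)) := by
  refine ⟨fun e he => ?_, fun b hb => ?_, fun r hr => ?_, fun e he e' he' hne => ?_⟩
  · obtain ⟨e, -, rfl⟩ := mem_image.1 he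
    exact ⟨(hM.1 _ e.2).1, (hM.1 _ (π e).2).2⟩
  · obtain ⟨e, ⟨he, rfl⟩, hu⟩ := hM.2.1 b hb
    refine ⟨_, ⟨mem_image_of_mem _ (mem_univ ⟨e, he⟩), rfl⟩, ?_⟩
    rintro e' ⟨he', h⟩
    obtain ⟨e', -, rfl⟩ := mem_image.1 he'
    have : e' = ⟨e, he⟩ := Subtype.ext (hu _ ⟨e'.2, h⟩)
    rw [this]
  · obtain ⟨e, ⟨he, rfl⟩, hu⟩ := hM.2.2.1 r hr
    refine ⟨_, ⟨mem_image_of_mem _ (mem_univ (π.symm ⟨e, he⟩)), by simp⟩, ?_⟩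
    rintro e' ⟨he', h⟩
    obtain ⟨e', -, rfl⟩ := mem_image.1 he'
    have : π e' = ⟨e, he⟩ := Subtype.ext (hu _ ⟨(π e').2, h⟩)
    rw [← this, Equiv.symm_apply_apply]
  · obtain ⟨e, -, rfl⟩ := mem_image.1 he
    obtain ⟨e', -, rfl⟩ := mem_image.1 he'
    refine Set.eq_empty_of_forall_notMem fun x hx => hπ e e' ?_ x hx.1 hx.2
    rintro rfl
    exact hne rfl

lemma PlaneMatching.compatible_image_perm (hM : PlaneMatching M) (π : Equiv.Perm M)
    (hπ : ∀ e : M, π e ≠ e → ∀ x ∈ openSegment ℝ e.1.1 (π e).1.2, x ∉ edgeUnion M) :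
    Compatible M (univ.image fun e : M => (e.1.1, (π e).1.2)) := by
  intro e he e' he'
  obtain ⟨e', -, rfl⟩ := mem_image.1 he'
  by_cases hfix : π e' = e'
  · rw [hfix]
    by_cases hee : e = e'.1
    · exact Or.inl hee
    · exact Or.inr fun x hx => absurd (hM.eq_of_mem e he _ e'.2 x hx.1 hx.2) hee
  · refine Or.inr ?_
    rintro x ⟨hx, hx'⟩
    have hend : x = e'.1.1 ∨ x = (π e').1.2 := by
      by_contra hcon
      push Not at hcon
      exact hπ e' hfix x (mem_openSegment_of_mem hx' hcon.1 hcon.2) ⟨e, he, hx⟩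
    refine ⟨?_, hend⟩
    rcases hend with rfl | rfl
    · exact Or.inl (congrArg Prod.fst (hM.eq_of_mem e he _ e'.2 _ hx (left_mem_segment _ _ _))).symm
    · exact Or.inr (congrArg Prod.snd
        (hM.eq_of_mem e he _ (π e').2 _ hx (right_mem_segment _ _ _))).symm

/-- A compatible matching with at least two fewer edges crossing the given line. -/
theorem IsBRMatching.exists_compatible_fewer (hM : IsBRMatching B R M) (hdisj : B ∩ R = ∅)
    (hgen : GenPos (B ∪ R)) (hD : D ≠ 0) (hqg : ∀ p ∈ B ∪ R, cross D (p - q) ≠ 0)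
    (hbal : (B.filter fun p => cross D (p - q) < 0).card =
      (R.filter fun p => cross D (p - q) < 0).card)
    (hex : ∃ e ∈ M, cross D (e.1 - q) * cross D (e.2 - q) < 0) :
    ∃ M', IsBRMatching B R M' ∧ Compatible M M' ∧
      (M'.filter fun e => cross D (e.1 - q) * cross D (e.2 - q) < 0).card + 2 ≤
        (M.filter fun e => cross D (e.1 - q) * cross D (e.2 - q) < 0).card := by
  have hplane := hM.planeMatching hdisj hgen
  obtain ⟨hpos, hneg⟩ := hM.exists_cross_both hqg hbal hex
  have hqg' : ∀ p ∈ endpoints M, cross D (p - q) ≠ 0 := fun p hp =>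
    hqg p (hM.endpoints_subset hp)
  obtain ⟨w, Γ, hw, hΓ, hcard⟩ := exists_wallSystem hplane hD hqg' hpos hneg
  have hα : ∀ i : (Pt × Pt) × Bool, ∃ s, i.1 ∈ M → endpt i ∉ w s := by
    intro i
    by_cases hi : i.1 ∈ M
    · obtain ⟨s, hs⟩ := (hw.extended _ hi _ (endpt_eq_or i) (notMem_empty _)).1
      exact ⟨s, fun _ => hs⟩
    · exact ⟨true, fun h => absurd h hi⟩
  choose α hα using hα
  obtain ⟨π, hπ1, hπ2, hπ3⟩ := Assigned.exists_perm ⟨hplane, hw, hα⟩ hD hqg' hΓ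
  refine ⟨_, hM.image_perm π hπ2, hplane.compatible_image_perm π hπ1, ?_⟩
  refine le_trans (Nat.add_le_add_right ?_ 2) hcard
  refine le_trans ?_ hπ3
  rw [Finset.filter_image]
  exact Finset.card_image_le

lemma tCompatible_refl (hM : IsBRMatching B R M) (t : ℕ) : TCompatible B R t M M :=
  ⟨0, Nat.zero_le _, fun _ => M, rfl, rfl, fun _ _ => hM, fun _ h => absurd h (Nat.not_lt_zero _)⟩

lemma TCompatible.cons {M' M'' : Finset (Pt × Pt)} {t : ℕ} (h : TCompatible B R t M' M'')
    (hM : IsBRMatching B R M) (hc : Compatible M M') : TCompatible B R (t + 1) M M'' := by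
  obtain ⟨k, hk, f, h0, h1, h2, h3⟩ := h
  refine ⟨k + 1, Nat.succ_le_succ hk, fun i => Nat.casesOn i M f, rfl, h1, ?_, ?_⟩
  · rintro (_ | i) hi
    · exact hM
    · exact h2 i (Nat.le_of_succ_le_succ hi)
  · rintro (_ | i) hi
    · show Compatible M (f 0)
      rwa [h0]
    · exact h3 i (Nat.lt_of_succ_lt_succ hi)

theorem IsBRMatching.exists_tCompatible (hdisj : B ∩ R = ∅)
    (hgen : GenPos (B ∪ R)) (hD : D ≠ 0) (hqg : ∀ p ∈ B ∪ R, cross D (p - q) ≠ 0)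
    (hbal : (B.filter fun p => cross D (p - q) < 0).card =
      (R.filter fun p => cross D (p - q) < 0).card) (m : ℕ) :
    ∀ M, IsBRMatching B R M →
      (M.filter fun e => cross D (e.1 - q) * cross D (e.2 - q) < 0).card ≤ m →
      ∃ M', IsBRMatching B R M' ∧ TCompatible B R (m / 2) M M' ∧
        ∀ e ∈ M', ¬ cross D (e.1 - q) * cross D (e.2 - q) < 0 := by
  induction m using Nat.strong_induction_on with
  | _ m ih =>
    intro M hM hm
    by_cases hex : ∃ e ∈ M, cross D (e.1 - q) * cross D (e.2 - q) < 0
    · obtain ⟨M', hM', hc, hcard⟩ := hM.exists_compatible_fewer hdisj hgen hD hqg hbal hex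
      obtain ⟨M'', h1, h2, h3⟩ := ih (m - 2) (by omega) M' hM' (by omega)
      have hm2 : m / 2 = (m - 2) / 2 + 1 := by omega
      exact ⟨M'', h1, hm2 ▸ h2.cons hM hc, h3⟩
    · push Not at hex
      exact ⟨M, hM, tCompatible_refl hM _, fun e he => (hex e he).not_gt⟩

lemma exists_cross_eq {a b : ℝ} (hab : (a, b) ≠ ((0 : ℝ), (0 : ℝ))) (c : ℝ) :
    ∃ D q : Pt, D ≠ 0 ∧ ∀ p : Pt, cross D (p - q) = a * p.1 + b * p.2 - c := by
  have hne : a ^ 2 + b ^ 2 ≠ 0 := by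
    intro h0
    refine hab (Prod.ext ?_ ?_) <;> simp only <;> nlinarith [sq_nonneg a, sq_nonneg b]
  refine ⟨(b, -a), (a * c / (a ^ 2 + b ^ 2), b * c / (a ^ 2 + b ^ 2)), ?_, fun p => ?_⟩
  · intro h
    simp only [Prod.mk_eq_zero, neg_eq_zero] at h
    exact hab (Prod.ext h.2 h.1)
  · simp only [cross, Prod.fst_sub, Prod.snd_sub]
    field_simp
    ring

lemma not_crosses {a b c : ℝ} (hg : ∀ p : Pt, cross D (p - q) = a * p.1 + b * p.2 - c)
    {e : Pt × Pt} (h1 : cross D (e.1 - q) ≠ 0) (h2 : cross D (e.2 - q) ≠ 0)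
    (h : ¬ cross D (e.1 - q) * cross D (e.2 - q) < 0) : ¬ Crosses a b c e := by
  rintro ⟨x, hx, hxc⟩
  obtain ⟨t, h3, h4, rfl⟩ := mem_segment_iff.1 hx
  have hlin : (1 - t) * cross D (e.1 - q) + t * cross D (e.2 - q) = 0 := by
    rw [hg, hg]
    simp only [Prod.fst_add, Prod.snd_add, Prod.smul_fst, Prod.smul_snd, Prod.fst_sub,
      Prod.snd_sub, smul_eq_mul] at hxc
    linear_combination hxc
  rcases h1.lt_or_gt with h1 | h1 <;> rcases h2.lt_or_gt with h2 | h2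
  · rcases h3.eq_or_lt with rfl | h3 <;> nlinarith
  · exact h (mul_neg_of_neg_of_pos h1 h2)
  · exact h (mul_neg_of_pos_of_neg h1 h2)
  · rcases h3.eq_or_lt with rfl | h3 <;> nlinarith

end

/-- For every BR-matching `M` and every ham-sandwich cut `ℓ` of `P`,
there is a BR-matching `M^ℓ` that is `⌊n/2⌋`-compatible with `M` and has no edge
intersecting `ℓ`. -/
theorem exists_compatible_matching_avoiding_cut (n : ℕ) (B R : Finset Pt)
    (hdisj : B ∩ R = ∅) (hB : B.card = n) (hR : R.card = n)
    (hgen : GenPos (B ∪ R))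
    (M : Finset (Pt × Pt)) (hM : IsBRMatching B R M)
    (a b c : ℝ) (hcut : IsHamSandwichCut a b c B R n) :
    ∃ Ml : Finset (Pt × Pt), IsBRMatching B R Ml ∧
      TCompatible B R (n / 2) M Ml ∧
      ∀ e ∈ Ml, ¬ Crosses a b c e := by
  obtain ⟨hab, hne, hcount⟩ := hcut
  obtain ⟨D, q, hD, hg⟩ := exists_cross_eq hab c
  have hqg : ∀ p ∈ B ∪ R, cross D (p - q) ≠ 0 := fun p hp => by
    rw [hg]; exact sub_ne_zero.2 (hne p hp)
  have hbal : (B.filter fun p => cross D (p - q) < 0).card =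
      (R.filter fun p => cross D (p - q) < 0).card := by
    simp only [hg, sub_neg]
    rcases hcount with h | h <;> rw [h.1, h.2.1]
  have hcard : (M.filter fun e => cross D (e.1 - q) * cross D (e.2 - q) < 0).card ≤ n := by
    refine (Finset.card_filter_le _ _).trans ?_
    have := hM.card_filter_fst fun _ => True
    simp only [Finset.filter_true, hB] at this
    exact this.le
  obtain ⟨Ml, h1, h2, h3⟩ :=
    IsBRMatching.exists_tCompatible hdisj hgen hD hqg hbal n M hM hcard
  exact ⟨Ml, h1, h2, fun e he => not_crosses hg (hqg _ (mem_union_left _ (h1.1 e he).1))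
    (hqg _ (mem_union_right _ (h1.1 e he).2)) (h3 e he)⟩
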